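/- arXiv:1810.05030 — 6 statements merged into one kernel-verified Lean document; each statement's English description precedes it below -/
import Mathlib

section
/- Let Q : ℂ^n → ℂ^n be a homogeneous polynomial map of degree m > 1. If Q admits infinitely many pairwise linearly independent eigenvectors (i.e., infinitely many distinct one-dimensional invariant subspaces), then Q admits a nilpotent, i.e., there exists v ≠ 0 with Q(v) = 0. -/
/-- A bounded algebraic subset of `ℂⁿ` is finite. -/
theorem finite_of_bounded_zeros {n : ℕ} (f : Fin n → MvPolynomial (Fin n) ℂ) (R : ℝ)
    (hR : ∀ x : Fin n → ℂ, (∀ i, MvPolynomial.eval x (f i) = 0) → ‖x‖ ≤ R) :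
    {x : Fin n → ℂ | ∀ i, MvPolynomial.eval x (f i) = 0}.Finite := by
  classical
  set I : Ideal (MvPolynomial (Fin n) ℂ) := Ideal.span (Set.range f) with hI
  have hle : ∀ x : Fin n → ℂ, (∀ i, MvPolynomial.eval x (f i) = 0) →
      ∀ a ∈ I, MvPolynomial.aeval x a = 0 := by
    intro x hx a ha
    have : I ≤ RingHom.ker (MvPolynomial.aeval (R := ℂ) x) := by
      rw [hI, Ideal.span_le]
      rintro _ ⟨i, rfl⟩
      simpa [RingHom.mem_ker, MvPolynomial.aeval_eq_eval] using hx i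
    exact this ha
  by_cases htop : I = ⊤
  · convert Set.finite_empty
    ext x
    simp only [Set.mem_ofPred_eq, Set.mem_empty_iff_false, iff_false]
    intro hx
    have := hle x hx 1 (by rw [htop]; trivial)
    simp at this
  obtain ⟨s, -, g, hinj, hint⟩ := exists_integral_inj_algHom_of_quotient I htop
  rcases Nat.eq_zero_or_pos s with rfl | hs
  · have key : ∀ i : Fin n, ∃ T : Set ℂ, T.Finite ∧
        ∀ x : Fin n → ℂ, (∀ i, MvPolynomial.eval x (f i) = 0) → x i ∈ T := by
      intro i
      obtain ⟨P, hP, hroot⟩ := hint (Ideal.Quotient.mk I (MvPolynomial.X i))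
      let e : MvPolynomial (Fin 0) ℂ →ₐ[ℂ] ℂ := MvPolynomial.aeval (fun j => j.elim0)
      refine ⟨{z | z ∈ (P.map e.toRingHom).roots.toFinset}, Finset.finite_toSet _, ?_⟩
      intro x hx
      let φ := Ideal.Quotient.liftₐ I (MvPolynomial.aeval (R := ℂ) x) (hle x hx)
      have he : φ.comp g = e := by
        apply MvPolynomial.algHom_ext
        intro j
        exact j.elim0
      have h1 := congrArg φ hroot
      rw [map_zero] at h1
      have h2 : φ (Ideal.Quotient.mk I (MvPolynomial.X i)) = x i := by
        simp [φ]
      have h3 : Polynomial.eval₂ (φ.comp g).toRingHom (x i) P = 0 := by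
        rw [← h1, ← h2]
        exact (Polynomial.hom_eval₂ P g.toRingHom φ.toRingHom _).symm
      rw [he] at h3
      simp only [Set.mem_ofPred_eq, Multiset.mem_toFinset]
      rw [Polynomial.mem_roots (hP.map _).ne_zero, Polynomial.IsRoot, Polynomial.eval_map]
      exact h3
    choose T hT hxT using key
    exact (Set.Finite.pi' hT).subset (fun x hx i => hxT i x hx)
  · exfalso
    let j : Fin s := ⟨0, hs⟩
    obtain ⟨q, hq⟩ := Ideal.Quotient.mk_surjective (g (MvPolynomial.X j))
    have hval : ∀ c : ℂ, ∃ x : Fin n → ℂ, ‖x‖ ≤ R ∧ MvPolynomial.eval x q = c := by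
      intro c
      have hnu : ¬ IsUnit (g (MvPolynomial.X j - MvPolynomial.C c)) := by
        intro hu
        have hloc := hint.isLocalHom hinj
        have hu' : IsUnit (MvPolynomial.X j - MvPolynomial.C c : MvPolynomial (Fin s) ℂ) :=
          hloc.map_nonunit _ hu
        have := hu'.map (MvPolynomial.eval (fun _ => c))
        simp at this
      obtain ⟨M, hM, hmem⟩ := exists_max_ideal_of_mem_nonunits hnu
      have hM' : (M.comap (Ideal.Quotient.mk I)).IsMaximal :=
        Ideal.comap_isMaximal_of_surjective _ Ideal.Quotient.mk_surjective
      obtain ⟨x, hx⟩ := MvPolynomial.isMaximal_iff_eq_vanishingIdeal_singleton.mp hM'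
      refine ⟨x, hR x ?_, ?_⟩
      · intro i
        have : f i ∈ M.comap (Ideal.Quotient.mk I) := by
          rw [Ideal.mem_comap, Ideal.Quotient.eq_zero_iff_mem.mpr (Ideal.subset_span (Set.mem_range_self i))]
          exact M.zero_mem
        rw [hx, MvPolynomial.mem_vanishingIdeal_singleton_iff] at this
        simpa [MvPolynomial.aeval_eq_eval] using this
      · have : q - MvPolynomial.C c ∈ M.comap (Ideal.Quotient.mk I) := by
          rw [Ideal.mem_comap, map_sub, hq]
          rw [map_sub] at hmem
          convert hmem using 2
          exact (g.commutes c).symm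
        rw [hx, MvPolynomial.mem_vanishingIdeal_singleton_iff] at this
        simpa [MvPolynomial.aeval_eq_eval, sub_eq_zero] using this
    obtain ⟨B, hB⟩ := (isCompact_closedBall (0 : Fin n → ℂ) R).exists_bound_of_continuousOn
      (f := fun x => MvPolynomial.eval x q) (MvPolynomial.continuous_eval q).continuousOn
    obtain ⟨x, hx, hxc⟩ := hval ((|B| + 1 : ℝ) : ℂ)
    have := hB x (by simpa using hx)
    rw [hxc, Complex.norm_real, Real.norm_eq_abs, abs_of_pos (by positivity)] at this
    linarith [le_abs_self B]

/-- If a homogeneous polynomial map `Q : ℂⁿ → ℂⁿ` of degree `m > 1` admits infinitely many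
pairwise linearly independent eigenvectors (i.e., infinitely many distinct one-dimensional
invariant subspaces), then it admits a nilpotent: some `v ≠ 0` with `Q v = 0`. -/
theorem stmt_0 {n m : ℕ} (hm : 1 < m) (Q : (Fin n → ℂ) → (Fin n → ℂ))
    (hQ : ∀ i : Fin n, ∃ p : MvPolynomial (Fin n) ℂ, p.IsHomogeneous m ∧
      ∀ x : Fin n → ℂ, Q x i = MvPolynomial.eval x p)
    (hinf : {W : Submodule ℂ (Fin n → ℂ) | ∃ v : Fin n → ℂ, v ≠ 0 ∧
      W = Submodule.span ℂ {v} ∧ ∃ l : ℂ, Q v = l • v}.Infinite) :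
    ∃ v : Fin n → ℂ, v ≠ 0 ∧ Q v = 0 := by
  by_contra! hnil
  choose p hp hpQ using hQ
  have hsmul : ∀ (c : ℂ) (x : Fin n → ℂ), Q (c • x) = c ^ m • Q x := by
    intro c x
    ext i
    rw [hpQ, Pi.smul_apply, hpQ, MvPolynomial.eval_eq, MvPolynomial.eval_eq, smul_eq_mul,
      Finset.mul_sum]
    refine Finset.sum_congr rfl fun d hd => ?_
    have hdeg := hp i (MvPolynomial.mem_support_iff.mp hd)
    have hd' : ∑ k ∈ d.support, d k = m := by
      rw [← hdeg, Finsupp.weight_apply, Finsupp.sum]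
      simp
    simp only [Pi.smul_apply, smul_eq_mul, mul_pow, Finset.prod_mul_distrib]
    rw [Finset.prod_pow_eq_pow_sum, hd']
    ring
  have hcont : Continuous Q := by
    refine continuous_pi fun i => ?_
    simp only [hpQ]
    exact MvPolynomial.continuous_eval _
  obtain ⟨δ, hδ, hδQ⟩ := (isCompact_sphere (0 : Fin n → ℂ) 1).exists_forall_le'
    (f := fun x => ‖Q x‖) hcont.norm.continuousOn (a := 0) (by
      intro x hx
      refine norm_pos_iff.mpr (hnil x ?_)
      rintro rfl
      simp at hx)
  have hfin := finite_of_bounded_zeros (fun i => p i - MvPolynomial.X i) (max 1 (1 / δ)) (by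
    intro x hx
    have hQx : Q x = x := by
      ext i
      have := hx i
      rw [map_sub, MvPolynomial.eval_X, sub_eq_zero] at this
      rw [hpQ, this]
    by_contra! hlt
    have h1 : 1 < ‖x‖ := (le_max_left _ _).trans_lt hlt
    have h2 : 1 / δ < ‖x‖ := (le_max_right _ _).trans_lt hlt
    have hpos : 0 < ‖x‖ := by linarith
    have hs := hδQ (((‖x‖⁻¹ : ℝ) : ℂ) • x) (by
      simp [norm_smul, hpos.ne'])
    simp only [hsmul, hQx, norm_smul, norm_pow, Complex.norm_real, norm_inv, norm_norm] at hs
    rw [inv_pow, ← div_eq_inv_mul, le_div_iff₀ (by positivity)] at hs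
    have h3 : ‖x‖ ^ 2 ≤ ‖x‖ ^ m := pow_le_pow_right₀ h1.le hm
    rw [div_lt_iff₀ hδ] at h2
    nlinarith)
  refine hinf ((hfin.image (fun v => Submodule.span ℂ {v})).subset ?_)
  rintro W ⟨v, hv, rfl, l, hl⟩
  have hl0 : l ≠ 0 := by
    rintro rfl
    exact hnil v hv (by simpa using hl)
  obtain ⟨c, hc⟩ := IsAlgClosed.exists_pow_nat_eq (l⁻¹) (n := m - 1) (by omega)
  have hc0 : c ≠ 0 := by
    rintro rfl
    rw [zero_pow (by omega)] at hc
    exact inv_ne_zero hl0 hc.symm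
  refine ⟨c • v, ?_, ?_⟩
  · intro i
    have : Q (c • v) = c • v := by
      rw [hsmul, hl, smul_smul]
      congr 1
      rw [show m = (m - 1) + 1 by omega, pow_succ, hc]
      field_simp
    have := congrFun this i
    rw [hpQ] at this
    rw [map_sub, MvPolynomial.eval_X, this, sub_self]
  · exact Submodule.span_singleton_smul_eq (IsUnit.mk0 c hc0) v
end

section
/- Let Q : ℂ^n → ℂ^n be a homogeneous polynomial map of degree m > 1. Then the number of pairwise linearly independent eigenvectors of Q (i.e., the number of distinct one-dimensional subspaces ℂv with Q(v) ∈ ℂv, v ≠ 0) is either infinite or at most (m^n − 1)/(m − 1) = 1 + m + m² + ⋯ + m^{n−1}. -/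
open MvPolynomial

/-- exponents of total degree at most `N` -/
noncomputable def expD (n N : ℕ) : Finset (Fin n →₀ ℕ) :=
  (Finset.Iic (Finsupp.equivFunOnFinite.symm fun _ => N)).filter fun s => s.degree ≤ N

lemma mem_expD {n N : ℕ} {s : Fin n →₀ ℕ} : s ∈ expD n N ↔ s.degree ≤ N := by
  simp only [expD, Finset.mem_filter, Finset.mem_Iic, and_iff_right_iff_imp]
  intro h i
  simpa using (Finsupp.le_degree i s).trans h

lemma card_expD_le (n N : ℕ) : (expD n N).card ≤ (N + 1) ^ n := by
  refine (Finset.card_filter_le _ _).trans ?_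
  rw [Finsupp.card_Iic]
  refine (Finset.prod_le_pow_card _ _ (N + 1) ?_).trans ?_
  · intro i _; simp
  · exact Nat.pow_le_pow_right (Nat.succ_pos _) (by simpa using Finset.card_le_univ (Finsupp.equivFunOnFinite.symm fun _ : Fin n => N).support)

lemma card_expD_mul (n m k C : ℕ) (hm : 0 < m) :
    (expD n (m * k + C)).card ≤ m ^ n * (expD n (k + C)).card := by
  classical
  have : ((Finset.univ : Finset (Fin n → Fin m)) ×ˢ expD n (k + C)).card
      = m ^ n * (expD n (k + C)).card := by simp
  rw [← this]
  refine Finset.card_le_card_of_injOn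
    (fun s => (fun i => ⟨s i % m, Nat.mod_lt _ hm⟩, s.mapRange (· / m) (Nat.zero_div m))) ?_ ?_
  · intro s hs
    simp only [Finset.mem_coe, mem_expD] at hs
    simp only [Finset.coe_product, Set.mem_prod, Finset.mem_coe, Finset.mem_univ, true_and, mem_expD]
    rw [Finsupp.degree_eq_sum] at hs ⊢
    simp only [Finsupp.mapRange_apply]
    have h1 : m * ∑ i, s i / m ≤ ∑ i, s i := by
      rw [Finset.mul_sum]
      exact Finset.sum_le_sum fun i _ => Nat.mul_div_le _ _
    have h2 : m * ∑ i, s i / m ≤ m * (k + C) := by nlinarith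
    exact Nat.le_of_mul_le_mul_left h2 hm
  · intro s _ t _ h
    simp only [Prod.mk.injEq] at h
    ext i
    have h1 := congrFun h.1 i
    have h2 := DFunLike.congr_fun h.2 i
    simp only [Fin.mk.injEq, Finsupp.mapRange_apply] at h1 h2
    rw [← Nat.div_add_mod (s i) m, ← Nat.div_add_mod (t i) m, h1, h2]

lemma exists_growth (n r C : ℕ) :
    ∃ k, r * (expD n (k + C)).card < (r + 1) * (expD n k).card := by
  by_contra! H
  have h1 : ∀ j : ℕ, (r + 1) ^ j ≤ r ^ j * (expD n (j * C)).card := by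
    intro j
    induction j with
    | zero =>
      have : 0 ∈ expD n (0 * C) := mem_expD.2 (by simp)
      simpa using Finset.card_pos.2 ⟨_, this⟩
    | succ j ih =>
      calc (r + 1) ^ (j + 1) = (r + 1) ^ j * (r + 1) := pow_succ _ _
        _ ≤ r ^ j * (expD n (j * C)).card * (r + 1) := Nat.mul_le_mul_right _ ih
        _ = r ^ j * ((r + 1) * (expD n (j * C)).card) := by ring
        _ ≤ r ^ j * (r * (expD n (j * C + C)).card) := Nat.mul_le_mul_left _ (H _)
        _ = _ := by rw [pow_succ, Nat.succ_mul]; ring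
  have h2 : ∀ j : ℕ, 1 ≤ j → (1 : ℝ) ≤ (C + 1) ^ n * ((j : ℝ) ^ n * ((r : ℝ) / (r + 1)) ^ j) := by
    intro j hj
    have h3 : (r + 1) ^ j ≤ r ^ j * (j * (C + 1)) ^ n := by
      refine (h1 j).trans (Nat.mul_le_mul_left _ ((card_expD_le _ _).trans ?_))
      exact Nat.pow_le_pow_left (by nlinarith) _
    have h4 : ((r : ℝ) + 1) ^ j ≤ r ^ j * (j * (C + 1)) ^ n := by exact_mod_cast h3
    have h5 : (0 : ℝ) < ((r : ℝ) + 1) ^ j := by positivity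
    rw [div_pow]
    rw [show ((C : ℝ) + 1) ^ n * ((j : ℝ) ^ n * ((r : ℝ) ^ j / ((r : ℝ) + 1) ^ j))
      = (r ^ j * (j * (C + 1)) ^ n) / ((r : ℝ) + 1) ^ j by rw [mul_pow]; ring]
    rwa [le_div_iff₀ h5, one_mul]
  have h3 : Filter.Tendsto (fun j : ℕ => ((C : ℝ) + 1) ^ n * ((j : ℝ) ^ n * ((r : ℝ) / (r + 1)) ^ j))
      Filter.atTop (nhds (((C : ℝ) + 1) ^ n * 0)) := by
    refine Filter.Tendsto.const_mul _ (tendsto_pow_const_mul_const_pow_of_abs_lt_one n ?_)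
    rw [abs_of_nonneg (by positivity), div_lt_one (by positivity)]
    linarith
  have h4 := ge_of_tendsto h3 (Filter.eventually_atTop.2 ⟨1, h2⟩)
  norm_num at h4

lemma exists_relation {n m : ℕ} (hm : 0 < m) (f : Fin n → MvPolynomial (Fin n) ℂ)
    (hf : ∀ i, (f i).totalDegree ≤ m) (g : MvPolynomial (Fin n) ℂ) (hg : g.totalDegree ≤ 1) :
    ∃ P : Polynomial (MvPolynomial (Fin n) ℂ), P ≠ 0 ∧ P.natDegree ≤ m ^ n ∧
      Polynomial.eval₂ (aeval f : MvPolynomial (Fin n) ℂ →ₐ[ℂ] MvPolynomial (Fin n) ℂ).toRingHom g P = 0 := by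
  classical
  obtain ⟨k, hk⟩ := exists_growth n (m ^ n) (m ^ n)
  set r := m ^ n with hr
  let v : (expD n k) × Fin (r + 1) → MvPolynomial (Fin n) ℂ := fun x =>
    aeval f (monomial x.1.1 (1 : ℂ)) * g ^ (x.2 : ℕ)
  have hdeg : ∀ x, (v x).totalDegree ≤ m * k + r := by
    intro x
    refine (totalDegree_mul _ _).trans (add_le_add ?_ ?_)
    · rw [aeval_monomial, map_one, one_mul]
      refine (totalDegree_finsetProd _ _).trans ?_
      have hx := mem_expD.1 x.1.2
      rw [Finsupp.degree] at hx
      refine le_trans (Finset.sum_le_sum (g := fun i => m * x.1.1 i) ?_) ?_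
      · intro i _
        refine (totalDegree_pow _ _).trans ?_
        rw [mul_comm]
        exact Nat.mul_le_mul_right _ (hf i)
      · rw [← Finset.mul_sum]
        exact Nat.mul_le_mul_left _ hx
    · refine (totalDegree_pow _ _).trans ?_
      have := x.2.2
      nlinarith
  have hspan : ∀ x, v x ∈ Submodule.span ℂ
      (((expD n (m * k + r)).image fun s => monomial s (1 : ℂ) : Finset (MvPolynomial (Fin n) ℂ)) : Set (MvPolynomial (Fin n) ℂ)) := by
    intro x
    rw [← support_sum_monomial_coeff (v x)]
    refine Submodule.sum_mem _ fun s hs => ?_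
    rw [show monomial s (coeff s (v x)) = coeff s (v x) • monomial s (1 : ℂ) by simp [smul_monomial]]
    refine Submodule.smul_mem _ _ (Submodule.subset_span ?_)
    refine Finset.mem_coe.2 (Finset.mem_image_of_mem _ (mem_expD.2 ?_))
    exact (le_totalDegree hs).trans (hdeg x)
  have hdep : ¬ LinearIndependent ℂ v := by
    intro hli
    have h1 := linearIndependent_le_span' v hli _ (Set.range_subset_iff.2 hspan)
    have h2 : ((expD n k).card * (r + 1)) ≤ (expD n (m * k + r)).card := by
      have this : ((expD n k).card * (r + 1)) ≤
          ((expD n (m * k + r)).image fun s => monomial s (1 : ℂ)).card := by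
        simpa [← Nat.cast_succ, ← Nat.cast_mul] using h1
      refine this.trans (Finset.card_image_le)
    have h3 := card_expD_mul n m k r hm
    rw [← hr] at h3
    nlinarith
  rw [Fintype.not_linearIndependent_iff] at hdep
  obtain ⟨c, hc, ⟨s0, j0⟩, hne⟩ := hdep
  refine ⟨∑ x, Polynomial.monomial (x.2 : ℕ) (monomial x.1.1 (c x)), ?_, ?_, ?_⟩
  · intro h0
    apply hne
    have := congrArg (fun P => coeff s0.1 (Polynomial.coeff P j0)) h0
    simp only [Polynomial.finsetSum_coeff, Polynomial.coeff_monomial, Polynomial.coeff_zero, coeff_zero] at this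
    rw [coeff_sum, Finset.sum_eq_single (s0, j0)] at this
    · simpa using this
    · rintro ⟨s, j⟩ _ hx
      split_ifs with h
      · have hj : j = j0 := Fin.ext h
        subst hj
        rw [coeff_monomial, if_neg]
        intro h; apply hx; rw [show s = s0 from Subtype.ext h]
      · simp
    · simp
  · refine Polynomial.natDegree_sum_le_of_forall_le _ _ fun x _ => ?_
    exact (Polynomial.natDegree_monomial_le _).trans (Nat.lt_succ_iff.1 x.2.2)
  · rw [Polynomial.eval₂_finsetSum, ← hc]
    refine Finset.sum_congr rfl fun x _ => ?_
    rw [Polynomial.eval₂_monomial]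
    simp only [v, aeval_monomial, AlgHom.toRingHom_eq_coe, RingHom.coe_coe, map_one, one_mul, MvPolynomial.algebraMap_eq, ← C_mul', mul_assoc]

lemma homogeneousComponent_mul_homog {n m d : ℕ} (hd : m ≤ d) (h q : MvPolynomial (Fin n) ℂ)
    (hq : q.IsHomogeneous m) :
    homogeneousComponent d (h * q) = homogeneousComponent (d - m) h * q := by
  induction h using MvPolynomial.induction_on' with
  | monomial s c =>
    have h1 : (monomial s c : MvPolynomial (Fin n) ℂ).IsHomogeneous s.degree :=
      isHomogeneous_monomial c rfl
    rw [homogeneousComponent_of_mem h1, homogeneousComponent_of_mem (h1.mul hq)]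
    by_cases h : s.degree + m = d
    · rw [if_pos h.symm, if_pos (by omega)]
    · rw [if_neg (Ne.symm h), if_neg (by omega), zero_mul]
  | add p q hp hq => rw [add_mul, map_add, map_add, hp, hq, add_mul]

lemma exists_pow_le {n : ℕ} (q : Fin n → MvPolynomial (Fin n) ℂ)
    (hz : ∀ x : Fin n → ℂ, (∀ i, eval x (q i) = 0) → x = 0) :
    ∃ B : ℕ, idealOfVars (Fin n) ℂ ^ B ≤ Ideal.span (Set.range q) := by
  refine Ideal.exists_pow_le_of_le_radical_of_fg ?_ (idealOfVars_fg (Fin n) ℂ)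
  rw [← vanishingIdeal_zeroLocus_eq_radical (K := ℂ), Ideal.span_le]
  rintro _ ⟨i, rfl⟩
  rw [SetLike.mem_coe, mem_vanishingIdeal_iff]
  intro x hx
  have : x = 0 := hz x fun j => by
    have := hx (q j) (Ideal.subset_span ⟨j, rfl⟩)
    simpa [aeval_eq_eval] using this
  simp [this]

lemma finite_adjoin {n m : ℕ} (hm : 1 < m) (q : Fin n → MvPolynomial (Fin n) ℂ)
    (hq : ∀ i, (q i).IsHomogeneous m)
    (hz : ∀ x : Fin n → ℂ, (∀ i, eval x (q i) = 0) → x = 0) :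
    Module.Finite (Algebra.adjoin ℂ (Set.range fun i => q i - X i)) (MvPolynomial (Fin n) ℂ) := by
  classical
  obtain ⟨B, hB⟩ := exists_pow_le q hz
  set A := Algebra.adjoin ℂ (Set.range fun i => q i - X i) with hA
  let F : Finset (MvPolynomial (Fin n) ℂ) := (expD n (B + m)).image fun s => monomial s (1 : ℂ)
  refine ⟨⟨F, ?_⟩⟩
  have hC : ∀ (c : ℂ) (p : MvPolynomial (Fin n) ℂ), p ∈ Submodule.span A (F : Set (MvPolynomial (Fin n) ℂ)) →
      c • p ∈ Submodule.span A (F : Set (MvPolynomial (Fin n) ℂ)) := by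
    intro c p hp
    rw [← algebraMap_smul A c p]
    exact Submodule.smul_mem _ _ hp
  have key : ∀ d : ℕ, ∀ p : MvPolynomial (Fin n) ℂ, p.totalDegree ≤ d →
      p ∈ Submodule.span A (F : Set (MvPolynomial (Fin n) ℂ)) := by
    intro d
    induction d using Nat.strong_induction_on with
    | _ d ih =>
    intro p hp
    by_cases hd : d ≤ B + m
    · rw [← support_sum_monomial_coeff p]
      refine Submodule.sum_mem _ fun s hs => ?_
      rw [show monomial s (coeff s p) = coeff s p • monomial s (1 : ℂ) by simp [smul_monomial]]
      refine hC _ _ (Submodule.subset_span ?_)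
      refine Finset.mem_coe.2 (Finset.mem_image_of_mem _ (mem_expD.2 ?_))
      exact (le_totalDegree hs).trans (hp.trans hd)
    push Not at hd
    rw [← sum_homogeneousComponent p]
    refine Submodule.sum_mem _ fun i hi => ?_
    have hid : i ≤ d := by
      have := Finset.mem_range.1 hi
      omega
    have hhom := homogeneousComponent_isHomogeneous i p
    rcases hid.lt_or_eq with hlt | rfl
    · exact ih i hlt _ hhom.totalDegree_le
    set r := homogeneousComponent i p
    have hmem : r ∈ Ideal.span (Set.range q) := by
      apply hB
      rw [mem_pow_idealOfVars_iff]
      intro s hs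
      have h1 : s.degree = i := by
        by_contra hne
        exact (mem_support_iff.1 hs) (hhom.coeff_eq_zero hne)
      omega
    obtain ⟨h, hh⟩ := Ideal.mem_span_range_iff_exists_fun.1 hmem
    have h2 : r = ∑ j, homogeneousComponent (i - m) (h j) * q j := by
      have := congrArg (homogeneousComponent i) hh
      rw [map_sum, homogeneousComponent_eq_self hhom] at this
      rw [← this]
      exact Finset.sum_congr rfl fun j _ => homogeneousComponent_mul_homog (by omega) _ _ (hq j)
    rw [h2]
    refine Submodule.sum_mem _ fun j _ => ?_
    set t := homogeneousComponent (i - m) (h j)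
    have ht : t.totalDegree ≤ i - m := (homogeneousComponent_isHomogeneous (i - m) (h j)).totalDegree_le
    have h3 : t * q j = (⟨q j - X j, Algebra.subset_adjoin ⟨j, rfl⟩⟩ : A) • t + t * X j := by
      rw [Subalgebra.smul_def, smul_eq_mul]; ring
    rw [h3]
    refine Submodule.add_mem _ (Submodule.smul_mem _ _ (ih (i - m) (by omega) _ ht)) ?_
    refine ih (i - m + 1) (by omega) _ ((totalDegree_mul _ _).trans (add_le_add ht ?_))
    rw [totalDegree_X]
  exact eq_top_iff.2 fun p _ => key _ p le_rfl

lemma exists_eval_ne_zero {n : ℕ} {ι : Type*} (s : Finset ι) (p : ι → MvPolynomial (Fin n) ℂ)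
    (hp : ∀ i ∈ s, ∃ x, eval x (p i) ≠ 0) : ∃ x, ∀ i ∈ s, eval x (p i) ≠ 0 := by
  by_contra! H
  have : ∏ i ∈ s, p i = 0 := by
    refine MvPolynomial.funext fun x => ?_
    obtain ⟨i, hi, h0⟩ := H x
    rw [map_prod, map_zero]
    exact Finset.prod_eq_zero hi h0
  rw [Finset.prod_eq_zero_iff] at this
  obtain ⟨i, hi, h0⟩ := this
  obtain ⟨x, hx⟩ := hp i hi
  simp [h0] at hx

/-- the linear form with coefficients `a` -/
noncomputable def linForm {n : ℕ} (a : Fin n → ℂ) : MvPolynomial (Fin n) ℂ := ∑ i, C (a i) * X i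

lemma eval_linForm {n : ℕ} (a x : Fin n → ℂ) : eval x (linForm a) = ∑ i, a i * x i := by
  simp [linForm]

lemma linForm_hom {n : ℕ} (a : Fin n → ℂ) : (linForm a).IsHomogeneous 1 := by
  refine IsHomogeneous.sum _ _ _ fun i _ => ?_
  simpa using (isHomogeneous_C (Fin n) (a i)).mul (isHomogeneous_X ℂ i)

lemma exists_separating {n : ℕ} (S : Finset (Fin n → ℂ)) :
    ∃ a : Fin n → ℂ, Set.InjOn (fun x => eval x (linForm a)) S := by
  classical
  obtain ⟨a, ha⟩ := exists_eval_ne_zero ((S ×ˢ S).filter fun x => x.1 ≠ x.2)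
    (fun x => linForm (x.1 - x.2)) (by
      intro x hx
      have hne := (Finset.mem_filter.1 hx).2
      obtain ⟨i, hi⟩ := Function.ne_iff.1 hne
      refine ⟨Pi.single i 1, ?_⟩
      rw [eval_linForm]
      simpa [Pi.single_apply, sub_eq_zero] using hi)
  refine ⟨a, fun x hx y hy hxy => ?_⟩
  by_contra hne
  refine ha (x, y) (by simp [hne]; exact ⟨hx, hy⟩) ?_
  simp only [eval_linForm] at hxy ⊢
  rw [← sub_eq_zero, ← Finset.sum_sub_distrib] at hxy
  rw [← hxy]
  exact Finset.sum_congr rfl fun i _ => by simp; ring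

lemma bezout {n m : ℕ} (hm : 1 < m) (q : Fin n → MvPolynomial (Fin n) ℂ)
    (hq : ∀ i, (q i).IsHomogeneous m)
    (hz : ∀ x : Fin n → ℂ, (∀ i, eval x (q i) = 0) → x = 0)
    (S : Finset (Fin n → ℂ)) (hS : ∀ x ∈ S, ∀ i, eval x (q i) = x i) : S.card ≤ m ^ n := by
  classical
  rcases S.eq_empty_or_nonempty with rfl | ⟨x0, hx0⟩
  · simp
  let f : Fin n → MvPolynomial (Fin n) ℂ := fun i => q i - X i
  let A := Algebra.adjoin ℂ (Set.range f)
  have : Module.Finite A (MvPolynomial (Fin n) ℂ) := finite_adjoin hm q hq hz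
  have : Algebra.IsIntegral A (MvPolynomial (Fin n) ℂ) := Algebra.IsIntegral.of_finite _ _
  have : Algebra.IsAlgebraic A (MvPolynomial (Fin n) ℂ) := inferInstance
  have hai : AlgebraicIndependent ℂ f := by
    refine (Algebra.IsAlgebraic.isTranscendenceBasis_of_le_trdeg_of_finite ℂ f ?_).1
    rw [MvPolynomial.trdeg_of_isDomain]
    simp
  have : IsIntegrallyClosed A := IsIntegrallyClosed.of_equiv hai.aevalEquiv.toRingEquiv
  obtain ⟨a, ha⟩ := exists_separating S
  set g := linForm a with hg
  obtain ⟨P, hP0, hPd, hP⟩ := exists_relation (m := m) (by omega) f (fun i => by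
    refine (totalDegree_sub _ _).trans (max_le (hq i).totalDegree_le ?_)
    rw [totalDegree_X]; omega) g (linForm_hom a).totalDegree_le
  let P' : Polynomial A := P.map hai.aevalEquiv.toRingEquiv.toRingHom
  have hP'0 : P' ≠ 0 := by
    rwa [Ne, Polynomial.map_eq_zero_iff hai.aevalEquiv.injective]
  have hP' : Polynomial.aeval g P' = 0 := by
    rw [Polynomial.aeval_def, Polynomial.eval₂_map, ← hP]
    congr 1
  have hint : IsIntegral A g := Algebra.IsIntegral.isIntegral g
  have hdvd := minpoly.isIntegrallyClosed_dvd hint hP'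
  have hdeg : (minpoly A g).natDegree ≤ m ^ n :=
    (Polynomial.natDegree_le_of_dvd hdvd hP'0).trans (Polynomial.natDegree_map_le.trans hPd)
  have hf0 : ∀ x ∈ S, ∀ i, eval x (f i) = 0 := by
    intro x hx i
    simp [f, hS x hx i]
  -- specialise at `x0`
  let ψ : A →+* ℂ := (eval x0).comp (algebraMap A (MvPolynomial (Fin n) ℂ))
  have hψ : ∀ x ∈ S, (eval x).comp (algebraMap A (MvPolynomial (Fin n) ℂ)) = ψ := by
    intro x hx
    ext ⟨b, hb⟩
    change eval x b = eval x0 b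
    induction hb using Algebra.adjoin_induction with
    | mem y hy =>
      obtain ⟨i, rfl⟩ := hy
      rw [hf0 x hx, hf0 x0 hx0]
    | algebraMap r => simp
    | add y z _ _ h1 h2 => rw [map_add, map_add, h1, h2]
    | mul y z _ _ h1 h2 => rw [map_mul, map_mul, h1, h2]
  let R : Polynomial ℂ := (minpoly A g).map ψ
  have hmonic : R.Monic := (minpoly.monic hint).map ψ
  have hroot : ∀ x ∈ S, eval x g ∈ R.roots.toFinset := by
    intro x hx
    rw [Multiset.mem_toFinset, Polynomial.mem_roots hmonic.ne_zero, Polynomial.IsRoot.def,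
      Polynomial.eval_map, ← hψ x hx, ← Polynomial.hom_eval₂, ← Polynomial.aeval_def,
      minpoly.aeval, map_zero]
  calc S.card ≤ R.roots.toFinset.card := Finset.card_le_card_of_injOn _ hroot ha
    _ ≤ R.roots.card := Multiset.toFinset_card_le _
    _ ≤ R.natDegree := R.card_roots'
    _ ≤ (minpoly A g).natDegree := Polynomial.natDegree_map_le
    _ ≤ m ^ n := hdeg

theorem stmt_1 {n m : ℕ} (hm : 1 < m) (Q : (Fin n → ℂ) → (Fin n → ℂ))
    (hQ : ∀ i : Fin n, ∃ p : MvPolynomial (Fin n) ℂ, p.IsHomogeneous m ∧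
      ∀ x : Fin n → ℂ, Q x i = MvPolynomial.eval x p) :
    {W : Submodule ℂ (Fin n → ℂ) | ∃ v : Fin n → ℂ, v ≠ 0 ∧
      W = Submodule.span ℂ {v} ∧ ∃ l : ℂ, Q v = l • v}.Infinite ∨
    {W : Submodule ℂ (Fin n → ℂ) | ∃ v : Fin n → ℂ, v ≠ 0 ∧
      W = Submodule.span ℂ {v} ∧ ∃ l : ℂ, Q v = l • v}.ncard ≤
      ∑ k ∈ Finset.range n, m ^ k := by
  classical
  set T := {W : Submodule ℂ (Fin n → ℂ) | ∃ v : Fin n → ℂ, v ≠ 0 ∧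
      W = Submodule.span ℂ {v} ∧ ∃ l : ℂ, Q v = l • v} with hT
  by_cases hfin : T.Finite
  swap
  · exact Or.inl hfin
  right
  have : Fintype T := hfin.fintype
  choose p hp hpQ using hQ
  have hrep : ∀ W : T, ∃ v : Fin n → ℂ, v ≠ 0 ∧
      W.1 = Submodule.span ℂ {v} ∧ ∃ l : ℂ, Q v = l • v := fun W => W.2
  choose v hv0 hvW l hl using hrep
  -- perturbation by a power of a linear form
  obtain ⟨a, ha⟩ := exists_eval_ne_zero (Finset.univ : Finset T)
    (fun W => C (l W) + linForm (v W) ^ (m - 1)) (by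
      intro W _
      by_cases h0 : l W = 0
      · obtain ⟨i, hi⟩ := Function.ne_iff.1 (hv0 W)
        refine ⟨Pi.single i 1, ?_⟩
        simp only [map_add, map_pow, eval_C, eval_linForm, h0, zero_add]
        apply pow_ne_zero
        simpa [Pi.single_apply] using hi
      · refine ⟨0, ?_⟩
        rw [map_add, map_pow, eval_linForm, eval_C]
        simp [zero_pow (show m - 1 ≠ 0 by omega), h0])
  let q : Fin n → MvPolynomial (Fin n) ℂ := fun i => p i + linForm a ^ (m - 1) * X i
  have hq : ∀ i, (q i).IsHomogeneous m := by
    intro i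
    refine (hp i).add ?_
    have := ((linForm_hom a).pow (m - 1)).mul (isHomogeneous_X ℂ i)
    rwa [one_mul, Nat.sub_add_cancel hm.le] at this
  have hqe : ∀ x i, eval x (q i) = Q x i + eval x (linForm a) ^ (m - 1) * x i := by
    intro x i
    simp [q, hpQ]
  have hqs : ∀ (c : ℂ) x i, eval (c • x) (q i) = c ^ m * eval x (q i) := by
    intro c x i
    rw [eval_eq, eval_eq, Finset.mul_sum]
    refine Finset.sum_congr rfl fun s hs => ?_
    have hd : s.degree = m := by
      by_contra hne
      exact (mem_support_iff.1 hs) ((hq i).coeff_eq_zero hne)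
    simp only [Pi.smul_apply, smul_eq_mul, mul_pow, Finset.prod_mul_distrib]
    rw [Finset.prod_pow_eq_pow_sum, show ∑ j ∈ s.support, s j = m from hd]
    ring
  let μ : T → ℂ := fun W => l W + eval (v W) (linForm a) ^ (m - 1)
  have hμ0 : ∀ W, μ W ≠ 0 := by
    intro W
    have := ha W (Finset.mem_univ _)
    simpa [μ, eval_linForm, mul_comm] using this
  have hμ : ∀ W i, eval (v W) (q i) = μ W * v W i := by
    intro W i
    rw [hqe, hl W]
    simp [μ]; ring
  have hz : ∀ x : Fin n → ℂ, (∀ i, eval x (q i) = 0) → x = 0 := by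
    intro x hx
    by_contra hx0
    let W : T := ⟨Submodule.span ℂ {x}, x, hx0, rfl, -eval x (linForm a) ^ (m - 1), by
      ext i
      have := hx i
      rw [hqe] at this
      simp only [Pi.smul_apply, smul_eq_mul]
      linear_combination this⟩
    have hvx : v W ∈ Submodule.span ℂ {x} := by
      change v W ∈ W.1
      rw [hvW W]
      exact Submodule.mem_span_singleton_self _
    obtain ⟨c, hc⟩ := Submodule.mem_span_singleton.1 hvx
    apply hv0 W
    ext i
    have h1 := hμ W i
    rw [← hc, hqs, hx, mul_zero, hc] at h1
    simpa [hμ0 W] using h1.symm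
  -- fixed representatives
  have hu : ∀ W : T, ∃ u : Fin n → ℂ, u ≠ 0 ∧ W.1 = Submodule.span ℂ {u} ∧
      ∀ i, eval u (q i) = u i := by
    intro W
    obtain ⟨s, hs⟩ := IsAlgClosed.exists_pow_nat_eq (μ W)⁻¹ (n := m - 1) (by omega)
    have hs0 : s ≠ 0 := by
      rintro rfl
      rw [zero_pow (by omega)] at hs
      exact hμ0 W (inv_eq_zero.1 hs.symm)
    refine ⟨s • v W, smul_ne_zero hs0 (hv0 W), ?_, fun i => ?_⟩
    · rw [hvW W, Submodule.span_singleton_smul_eq (IsUnit.mk0 s hs0)]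
    · rw [hqs, hμ, ← Nat.sub_add_cancel hm.le, pow_succ, hs]
      have := hμ0 W
      simp only [Pi.smul_apply, smul_eq_mul]
      field_simp
  choose u hu0 huW huf using hu
  let Z : Finset ℂ := Polynomial.nthRootsFinset (m - 1) 1
  have hZ : Z.card = m - 1 :=
    (Complex.isPrimitiveRoot_exp (m - 1) (by omega)).card_nthRootsFinset
  have hZm : ∀ ζ ∈ Z, ζ ^ (m - 1) = 1 := fun ζ h =>
    (Polynomial.mem_nthRootsFinset (by omega) _).1 h
  have hZ0 : ∀ ζ ∈ Z, ζ ≠ 0 := by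
    rintro ζ h rfl
    have := hZm _ h
    rw [zero_pow (by omega)] at this
    exact zero_ne_one this
  let F : Finset (Fin n → ℂ) := ((Finset.univ : Finset T) ×ˢ Z).image fun x => x.2 • u x.1
  have hF : F.card = Fintype.card T * (m - 1) := by
    rw [Finset.card_image_of_injOn, Finset.card_product, hZ, Finset.card_univ]
    rintro ⟨W, ζ⟩ h1 ⟨W', ζ'⟩ h2 h
    have h1 : ζ ∈ Z := (Finset.mem_product.1 (Finset.mem_coe.1 h1)).2
    have h2 : ζ' ∈ Z := (Finset.mem_product.1 (Finset.mem_coe.1 h2)).2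
    simp only at h
    have hW : W = W' := by
      apply Subtype.ext
      rw [huW W, huW W', ← Submodule.span_singleton_smul_eq (IsUnit.mk0 ζ (hZ0 _ h1)), h,
        Submodule.span_singleton_smul_eq (IsUnit.mk0 ζ' (hZ0 _ h2))]
    subst hW
    rw [smul_left_injective ℂ (hu0 W) h]
  have h0F : (0 : Fin n → ℂ) ∉ F := by
    intro h
    obtain ⟨⟨W, ζ⟩, h1, h2⟩ := Finset.mem_image.1 h
    exact smul_ne_zero (hZ0 _ (Finset.mem_product.1 h1).2) (hu0 W) h2
  have hbez := bezout hm q hq hz (insert 0 F) (by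
    intro x hx i
    rcases Finset.mem_insert.1 hx with rfl | hx
    · have := hqs 0 0 i
      rw [zero_pow (by omega), zero_mul, smul_zero] at this
      simpa using this
    · obtain ⟨⟨W, ζ⟩, h1, rfl⟩ := Finset.mem_image.1 hx
      have h1 := hZm _ (Finset.mem_product.1 h1).2
      simp only at h1 ⊢
      rw [hqs, huf, ← Nat.sub_add_cancel hm.le, pow_succ, h1]
      simp)
  rw [Finset.card_insert_of_notMem h0F, hF] at hbez
  have hcard : T.ncard = Fintype.card T := by
    rw [← Nat.card_coe_set_eq, Nat.card_eq_fintype_card]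
  rw [hcard]
  have hgeom : (∑ k ∈ Finset.range n, m ^ k) * (m - 1) + 1 = m ^ n := by
    obtain ⟨k, rfl⟩ := Nat.exists_eq_add_of_lt hm
    have := geom_sum_mul_add (1 + k) n
    rw [show 1 + k + 1 - 1 = 1 + k by omega, show 1 + k + 1 = (1 + k) + 1 from rfl]
    exact this
  exact Nat.le_of_mul_le_mul_right (by omega) (show 0 < m - 1 by omega)
end

section
/- Let Q : ℝ^n → ℝ^n be a homogeneous polynomial map of degree m > 1, and let Q_ℂ : ℂ^n → ℂ^n denote the homogeneous polynomial map obtained by extending the (real) coordinate polynomials of Q to ℂ^n. Assume Q_ℂ admits only finitely many pairwise linearly independent eigenvectors. If m is even, or if both m and n are odd, then Q admits a real eigenvector: there exist v ∈ ℝ^n, v ≠ 0, and λ ∈ ℝ with Q(v) = λ v. -/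
lemma odd_monic_root (P : Polynomial ℝ) (hP : P.Monic) (ho : Odd P.natDegree) :
    ∃ x, P.IsRoot x := by
  have hd : 0 < P.natDegree := ho.pos
  have h1 : Filter.Tendsto (fun x => P.eval x) Filter.atTop Filter.atTop :=
    P.tendsto_atTop_of_leadingCoeff_nonneg (Polynomial.natDegree_pos_iff_degree_pos.1 hd)
      (by rw [hP.leadingCoeff]; norm_num)
  have h2 : Filter.Tendsto (fun x => (P.comp (-Polynomial.X)).eval x) Filter.atTop Filter.atBot := by
    apply Polynomial.tendsto_atBot_of_leadingCoeff_nonpos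
    · rw [← Polynomial.natDegree_pos_iff_degree_pos, Polynomial.natDegree_comp]
      simpa using hd
    · rw [Polynomial.leadingCoeff_comp (by simp), hP.leadingCoeff]
      simp [ho.neg_one_pow]
  have h3 : Filter.Tendsto (fun x => P.eval x) Filter.atBot Filter.atBot := by
    have := h2.comp Filter.tendsto_neg_atBot_atTop
    refine this.congr fun x => ?_
    simp [Polynomial.eval_comp]
  obtain ⟨x, hx⟩ := (Polynomial.continuous P).surjective h1 h3 0
  exact ⟨x, hx⟩

lemma odd_common {A : Type*} [CommRing A] [Algebra ℝ A] (B : Set A) :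
    ∀ (d : ℕ) (K : Submodule ℝ A), FiniteDimensional ℝ K → Module.finrank ℝ K = d → Odd d →
      (∀ b ∈ B, ∀ w ∈ K, b * w ∈ K) →
      ∃ w ∈ K, w ≠ 0 ∧ ∀ b ∈ B, ∃ c : ℝ, b * w = c • w := by
  intro d
  induction d using Nat.strong_induction_on with
  | _ d ih =>
  intro K hK hd ho hB
  by_cases h : ∀ b ∈ B, ∃ c : ℝ, ∀ w ∈ K, b * w = c • w
  · have : K ≠ ⊥ := by
      rintro rfl
      simp at hd
      subst hd
      simp at ho
    obtain ⟨w, hw, hw0⟩ := K.exists_mem_ne_zero_of_ne_bot this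
    exact ⟨w, hw, hw0, fun b hb => (h b hb).imp fun c hc => hc w hw⟩
  push Not at h
  obtain ⟨b, hb, hns⟩ := h
  let T : K →ₗ[ℝ] K := (LinearMap.mulLeft ℝ b).restrict (fun w hw => hB b hb w hw)
  have hTc : Odd T.charpoly.natDegree := by
    rw [LinearMap.charpoly_natDegree, hd]; exact ho
  obtain ⟨μ, hμ⟩ := odd_monic_root _ T.charpoly_monic hTc
  rw [← Module.End.hasEigenvalue_iff_isRoot_charpoly] at hμ
  obtain ⟨v, hv⟩ := hμ.exists_hasEigenvector
  let D : K →ₗ[ℝ] K := T - μ • LinearMap.id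
  have hDv : ∀ w : K, ((D w : K) : A) = b * w - μ • (w : A) := fun w => by
    simp only [D, T, LinearMap.sub_apply, LinearMap.smul_apply, LinearMap.id_apply,
      Submodule.coe_sub, Submodule.coe_smul]
    rfl
  have hrk := D.finrank_range_add_finrank_ker
  have e1 : Module.finrank ℝ ((LinearMap.ker D).map K.subtype) = Module.finrank ℝ (LinearMap.ker D) :=
    Submodule.finrank_map_subtype_eq K _
  have e2 : Module.finrank ℝ ((LinearMap.range D).map K.subtype) =
      Module.finrank ℝ (LinearMap.range D) :=
    Submodule.finrank_map_subtype_eq K _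
  have hkerpos : 0 < Module.finrank ℝ (LinearMap.ker D) := by
    refine (Module.finrank_pos_iff_exists_ne_zero (R := ℝ) (M := LinearMap.ker D)).2 ⟨⟨v, ?_⟩, ?_⟩
    · rw [LinearMap.mem_ker]
      simp [D, hv.apply_eq_smul]
    · intro h
      exact hv.2 (congrArg Subtype.val h)
  have hranpos : 0 < Module.finrank ℝ (LinearMap.range D) := by
    obtain ⟨w, hw, hne⟩ := hns μ
    refine (Module.finrank_pos_iff_exists_ne_zero (R := ℝ) (M := LinearMap.range D)).2 ⟨⟨D ⟨w, hw⟩, ⟨_, rfl⟩⟩, ?_⟩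
    intro h
    have h' : D ⟨w, hw⟩ = 0 := congrArg Subtype.val h
    have := hDv ⟨w, hw⟩
    rw [h'] at this
    exact hne (sub_eq_zero.1 this.symm)
  have key : ∃ K' : Submodule ℝ A, K' ≤ K ∧ Module.finrank ℝ K' < d ∧ Odd (Module.finrank ℝ K') ∧
      (∀ b ∈ B, ∀ w ∈ K', b * w ∈ K') := by
    rcases Nat.even_or_odd (Module.finrank ℝ (LinearMap.ker D)) with he | hodd
    · refine ⟨(LinearMap.range D).map K.subtype, Submodule.map_subtype_le _ _, by omega, ?_, ?_⟩
      · rw [e2]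
        rw [← hd, ← hrk] at ho
        exact (Nat.odd_add.1 ho).2 he
      · rintro b' hb' _ ⟨_, ⟨w, rfl⟩, rfl⟩
        refine ⟨D ⟨b' * w, hB b' hb' _ w.2⟩, ⟨_, rfl⟩, ?_⟩
        simp only [Submodule.subtype_apply, hDv, mul_sub, mul_smul_comm]
        ring_nf
    · refine ⟨(LinearMap.ker D).map K.subtype, Submodule.map_subtype_le _ _, by omega, ?_, ?_⟩
      · rw [e1]; exact hodd
      · rintro b' hb' _ ⟨w, hw, rfl⟩
        refine ⟨⟨b' * w, hB b' hb' _ w.2⟩, ?_, rfl⟩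
        have hw' : D w = 0 := hw
        have h1 := hDv w
        rw [hw'] at h1
        apply Subtype.ext
        rw [hDv]
        have : b * (b' * (w : A)) - μ • (b' * (w : A)) = b' * (b * w - μ • (w : A)) := by
          rw [mul_sub, mul_smul_comm]; ring_nf
        simp only [this, ← h1]
        simp
  obtain ⟨K', hle, hlt, hodd, hst⟩ := key
  have hfd : FiniteDimensional ℝ K' := Submodule.finiteDimensional_of_le hle
  obtain ⟨w, hw, h⟩ := ih _ hlt K' hfd rfl hodd hst
  exact ⟨w, hle hw, h⟩

/-- number of tuples with entries in `0..k` and sum `r` mod `k` -/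
lemma count_aux (k : ℕ) (hk : 0 < k) (n : ℕ) :
    ∃ e : ℕ, (∀ r : ZMod k,
      Fintype.card {a : Fin n → Fin (k + 1) // ∑ i, ((a i : ℕ) : ZMod k) = r} =
        e + if r = 0 then 1 else 0) ∧
      ((Even (k + 1) ∧ 0 < n) ∨ Odd n → Odd e) ∧ (Odd (k + 1) → Even n → Even e) := by
  have : NeZero k := ⟨hk.ne'⟩
  induction n with
  | zero =>
    refine ⟨0, fun r => ?_, by simp, by simp⟩
    by_cases h : r = 0
    · subst h; simp
    · simp [h, Ne.symm h]
  | succ n ih =>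
    obtain ⟨e, he, h1, h2⟩ := ih
    refine ⟨1 + (k + 1) * e, fun r => ?_, ?_, ?_⟩
    · have eq : {a : Fin (n+1) → Fin (k + 1) // ∑ i, ((a i : ℕ) : ZMod k) = r} ≃
          (Σ j : Fin (k+1), {a : Fin n → Fin (k + 1) // ∑ i, ((a i : ℕ) : ZMod k) =
            r - ((j : ℕ) : ZMod k)}) :=
        { toFun := fun a => ⟨a.1 0, Fin.tail a.1, by
            have := a.2
            rw [Fin.sum_univ_succ] at this
            exact eq_sub_of_add_eq' this⟩
          invFun := fun s => ⟨Fin.cons s.1 s.2.1, by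
            rw [Fin.sum_univ_succ]; simp [s.2.2]⟩
          left_inv := fun a => by simp
          right_inv := fun s => rfl }
      rw [Fintype.card_congr eq, Fintype.card_sigma]
      simp only [he, Finset.sum_add_distrib]
      rw [Fin.sum_univ_castSucc]
      have : ∑ j : Fin k, (if r - (((j.castSucc : Fin (k+1)) : ℕ) : ZMod k) = 0 then 1 else 0) = 1 := by
        have hs : ∀ j : Fin k, (r - (((j.castSucc : Fin (k+1)) : ℕ) : ZMod k) = 0) ↔
            j = ⟨r.val, r.val_lt⟩ := by
          intro j
          rw [sub_eq_zero]
          constructor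
          · rintro rfl
            apply Fin.ext
            simp [ZMod.val_natCast, Nat.mod_eq_of_lt j.2]
          · rintro rfl
            simp
        simp only [hs]
        simp
      simp only [Finset.sum_const, Finset.card_univ, Fintype.card_fin, smul_eq_mul]
      rw [Fin.sum_univ_castSucc, this]
      simp
      ring
    · intro h
      rw [Nat.odd_add]
      simp only [odd_one, true_iff, Nat.even_mul]
      rcases h with ⟨h, -⟩ | h
      · exact Or.inl h
      · rcases Nat.even_or_odd (k+1) with hh | hh
        · exact Or.inl hh
        · exact Or.inr (h2 hh (by rcases Nat.even_or_odd n with h' | h'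
                                  · exact h'
                                  · exfalso; exact (Nat.not_even_iff_odd.2 h) h'.add_one))
    · intro ho hn
      have hn' : Odd n := by
        rcases Nat.even_or_odd n with h' | h'
        · exfalso; exact (Nat.not_even_iff_odd.2 h'.add_one) hn
        · exact h'
      have := h1 (Or.inr hn')
      exact Odd.add_odd odd_one (ho.mul this)
open MvPolynomial

/-- `x^a g^b` where `c = a + m b`. -/
noncomputable def phiMon {R : Type*} [CommRing R] {n : ℕ} (m : ℕ) (g : Fin n → MvPolynomial (Fin n) R)
    (c : Fin n →₀ ℕ) : MvPolynomial (Fin n) R :=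
  ∏ i, (X i ^ (c i % m) * g i ^ (c i / m))

noncomputable def phiLin {n : ℕ} (m : ℕ) (g : Fin n → MvPolynomial (Fin n) ℝ) :
    MvPolynomial (Fin n) ℝ →ₗ[ℝ] MvPolynomial (Fin n) ℝ :=
  (basisMonomials (Fin n) ℝ).constr ℝ (phiMon m g)

lemma phiLin_monomial {n : ℕ} (m : ℕ) (g : Fin n → MvPolynomial (Fin n) ℝ) (c : Fin n →₀ ℕ) :
    phiLin m g (monomial c 1) = phiMon m g c := by
  have := (basisMonomials (Fin n) ℝ).constr_basis ℝ (phiMon m g) c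
  simpa [phiLin] using this

lemma phiLin_apply {n : ℕ} (m : ℕ) (g : Fin n → MvPolynomial (Fin n) ℝ)
    (p : MvPolynomial (Fin n) ℝ) :
    phiLin m g p = ∑ c ∈ p.support, coeff c p • phiMon m g c := by
  conv_lhs => rw [p.as_sum]
  rw [map_sum]
  refine Finset.sum_congr rfl fun c _ => ?_
  rw [← phiLin_monomial, ← map_smul, smul_monomial]
  simp

lemma phiMon_map {R S : Type*} [CommRing R] [CommRing S] (f : R →+* S) {n : ℕ} (m : ℕ)
    (g : Fin n → MvPolynomial (Fin n) R) (c : Fin n →₀ ℕ) :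
    map f (phiMon m g c) = phiMon m (fun i => map f (g i)) c := by
  simp [phiMon, map_prod]

lemma prod_X_pow_eq {R : Type*} [CommRing R] {n : ℕ} (c : Fin n →₀ ℕ) :
    ∏ i, (X i : MvPolynomial (Fin n) R) ^ (c i) = monomial c 1 := by
  rw [monomial_eq]
  simp [Finsupp.prod_fintype]

lemma phiMon_base {R : Type*} [CommRing R] {n : ℕ} (m : ℕ) (c : Fin n →₀ ℕ) :
    phiMon m (fun i => (X i ^ m : MvPolynomial (Fin n) R)) c = monomial c 1 := by
  rw [← prod_X_pow_eq]
  unfold phiMon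
  refine Finset.prod_congr rfl fun i _ => ?_
  rw [← pow_mul, ← pow_add, Nat.mod_add_div]

lemma inj_generic {n : ℕ} (m : ℕ) (q : Fin n → MvPolynomial (Fin n) ℝ) :
    ∃ Z : Set ℝ, Z.Countable ∧ ∀ ε, ε ∉ Z →
      Function.Injective (phiLin m (fun i => X i ^ m + C ε * q i)) := by
  let G : Fin n → MvPolynomial (Fin n) (Polynomial ℝ) :=
    fun i => X i ^ m + C Polynomial.X * map Polynomial.C (q i)
  have hG : ∀ ε : ℝ, (fun i => map (Polynomial.evalRingHom ε) (G i)) =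
      fun i => X i ^ m + C ε * q i := by
    intro ε
    funext i
    have : (Polynomial.evalRingHom ε).comp Polynomial.C = RingHom.id ℝ := by ext; simp
    simp only [G, map_add, map_pow, map_mul, map_X, map_C, map_map, this, map_id]
    simp
  let M : ∀ s : Finset (Fin n →₀ ℕ), Matrix s s (Polynomial ℝ) :=
    fun s => Matrix.of fun c' c => coeff c'.1 (phiMon m G c.1)
  have hM : ∀ (s : Finset (Fin n →₀ ℕ)) (ε : ℝ), (Polynomial.evalRingHom ε).mapMatrix (M s) =
      Matrix.of fun c' c : s => coeff c'.1 (phiMon m (fun i => X i ^ m + C ε * q i) c.1) := by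
    intro s ε
    ext c' c
    simp only [RingHom.mapMatrix_apply, Matrix.map_apply, M, Matrix.of_apply]
    rw [← hG, ← phiMon_map, coeff_map]
  have hM0 : ∀ s, (M s).det ≠ 0 := by
    intro s h
    have h1 := RingHom.map_det (Polynomial.evalRingHom 0) (M s)
    rw [h, hM] at h1
    have : (Matrix.of fun c' c : s => coeff c'.1
        (phiMon m (fun i => X i ^ m + C (0:ℝ) * q i) c.1)) = 1 := by
      ext c' c
      simp only [map_zero, zero_mul, add_zero, phiMon_base, Matrix.of_apply, coeff_monomial,
        Matrix.one_apply]
      by_cases h : c = c'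
      · subst h; simp
      · rw [if_neg (fun h' => h (Subtype.ext h')), if_neg (fun h' => h h'.symm)]
    rw [this] at h1
    simp at h1
  refine ⟨⋃ s : Finset (Fin n →₀ ℕ), {ε | (M s).det.IsRoot ε}, ?_, ?_⟩
  · refine Set.countable_iUnion fun s => ?_
    exact (Polynomial.finite_setOfPred_isRoot (hM0 s)).countable
  · intro ε hε
    rw [injective_iff_map_eq_zero]
    intro p hp
    by_contra hne
    apply hε
    refine Set.mem_iUnion.2 ⟨p.support, ?_⟩
    by_contra hroot
    have hdet : ((Polynomial.evalRingHom ε).mapMatrix (M p.support)).det ≠ 0 := by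
      rw [← RingHom.map_det]; exact hroot
    have hv := Matrix.eq_zero_of_mulVec_eq_zero hdet (v := fun c => coeff c.1 p) (by
      rw [hM]
      funext c'
      simp only [Matrix.mulVec, dotProduct, Matrix.of_apply, Pi.zero_apply]
      have := congrArg (coeff c'.1) hp
      rw [phiLin_apply, coeff_sum, coeff_zero, ← Finset.sum_coe_sort] at this
      rw [← this]
      refine Finset.sum_congr rfl fun c _ => ?_
      rw [coeff_smul, smul_eq_mul, mul_comm])
    apply hne
    ext c
    by_cases hc : c ∈ p.support
    · exact congrFun hv ⟨c, hc⟩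
    · simpa using hc

lemma phi_surj {n : ℕ} (m : ℕ) (g : Fin n → MvPolynomial (Fin n) ℝ)
    (hinj : Function.Injective (phiLin m g)) (s : Set (Fin n →₀ ℕ)) (hs : s.Finite)
    (hmap : ∀ c ∈ s, phiMon m g c ∈ restrictSupport ℝ s) (p : MvPolynomial (Fin n) ℝ)
    (hp : p ∈ restrictSupport ℝ s) : ∃ p' ∈ restrictSupport ℝ s, phiLin m g p' = p := by
  have hst : ∀ x ∈ restrictSupport ℝ s, phiLin m g x ∈ restrictSupport ℝ s := by
    intro x hx
    rw [phiLin_apply]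
    refine Submodule.sum_mem _ fun c hc => Submodule.smul_mem _ _ (hmap c (hx hc))
  have : Finite s := hs
  have : FiniteDimensional ℝ (restrictSupport ℝ s) :=
    Module.Finite.of_basis (basisRestrictSupport ℝ s)
  have hi : Function.Injective ((phiLin m g).restrict hst) := by
    intro x y hxy
    exact Subtype.ext (hinj (congrArg Subtype.val hxy))
  obtain ⟨x, hx⟩ := LinearMap.surjective_of_injective hi ⟨p, hp⟩
  exact ⟨x, x.2, congrArg Subtype.val hx⟩

/-- exponents of degree at most `d` and congruent to `d` -/
def degSet (n k d : ℕ) : Set (Fin n →₀ ℕ) := {c | c.degree ≤ d ∧ c.degree ≡ d [MOD k]}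

lemma degSet_finite (n k d : ℕ) : (degSet n k d).Finite := by
  refine Set.Finite.subset (Set.Finite.preimage
    (DFunLike.coe_injective.injOn) (Set.finite_Iic (fun _ : Fin n => d))) ?_
  intro c hc i
  exact (Finsupp.le_degree i c).trans hc.1

lemma mul_mem_degSet {n k d e : ℕ} {p q : MvPolynomial (Fin n) ℝ}
    (hp : p ∈ restrictSupport ℝ (degSet n k d)) (hq : q ∈ restrictSupport ℝ (degSet n k e)) :
    p * q ∈ restrictSupport ℝ (degSet n k (d + e)) := by
  have h := Submodule.mul_mem_mul hp hq
  rw [← restrictSupport_add] at h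
  refine restrictSupport_mono ℝ ?_ h
  rintro _ ⟨a, ha, b, hb, rfl⟩
  refine ⟨?_, ?_⟩
  · simp only [map_add]; exact add_le_add ha.1 hb.1
  · simp only [map_add]; exact ha.2.add hb.2

lemma one_mem_degSet {n k : ℕ} :
    (1 : MvPolynomial (Fin n) ℝ) ∈ restrictSupport ℝ (degSet n k 0) := by
  rw [show (1 : MvPolynomial (Fin n) ℝ) = monomial 0 1 from rfl, monomial_mem_restrictSupport]
  left
  exact ⟨by simp, by simp [Nat.ModEq]⟩

lemma pow_mem_degSet {n k d : ℕ} {p : MvPolynomial (Fin n) ℝ}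
    (hp : p ∈ restrictSupport ℝ (degSet n k d)) (j : ℕ) :
    p ^ j ∈ restrictSupport ℝ (degSet n k (d * j)) := by
  induction j with
  | zero => simpa using one_mem_degSet
  | succ j ih => rw [pow_succ, mul_add_one]; exact mul_mem_degSet ih hp

lemma prod_mem_degSet {n k : ℕ} {ι : Type*} (s : Finset ι) (d : ι → ℕ)
    (p : ι → MvPolynomial (Fin n) ℝ)
    (hp : ∀ i, p i ∈ restrictSupport ℝ (degSet n k (d i))) :
    ∏ i ∈ s, p i ∈ restrictSupport ℝ (degSet n k (∑ i ∈ s, d i)) := by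
  classical
  induction s using Finset.induction_on with
  | empty => simpa using one_mem_degSet
  | insert a s ha ih => rw [Finset.prod_insert ha, Finset.sum_insert ha]; exact mul_mem_degSet (hp a) ih

lemma X_mem_degSet {n k : ℕ} (i : Fin n) :
    (X i : MvPolynomial (Fin n) ℝ) ∈ restrictSupport ℝ (degSet n k 1) := by
  rw [X, monomial_mem_restrictSupport]
  left
  exact ⟨by simp, by simp [Nat.ModEq]⟩

lemma degSet_mono_mod {n k d e : ℕ} (h : d ≤ e) (h' : d ≡ e [MOD k]) :
    degSet n k d ⊆ degSet n k e := fun _ hc => ⟨hc.1.trans h, hc.2.trans h'⟩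

lemma homog_mem_degSet {n k d : ℕ} {p : MvPolynomial (Fin n) ℝ} (hp : p.IsHomogeneous d) :
    p ∈ restrictSupport ℝ (degSet n k d) := by
  intro c hc
  have : c.degree = d := by
    by_contra h
    exact mem_support_iff.1 hc (hp.coeff_eq_zero h)
  exact ⟨this.le, by rw [this]⟩

section
variable {n k : ℕ} (q : Fin n → MvPolynomial (Fin n) ℝ) (ε : ℝ)

noncomputable def gpoly (k : ℕ) (i : Fin n) : MvPolynomial (Fin n) ℝ :=
  X i ^ (k + 1) + C ε * (q i - X i)

lemma gpoly_mem (hq : ∀ i, (q i).IsHomogeneous (k + 1)) (i : Fin n) :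
    gpoly q ε k i ∈ restrictSupport ℝ (degSet n k (k + 1)) := by
  unfold gpoly
  refine Submodule.add_mem _ ?_ ?_
  · simpa using pow_mem_degSet (X_mem_degSet (k := k) i) (k + 1)
  · rw [← smul_eq_C_mul]
    refine Submodule.smul_mem _ _ (Submodule.sub_mem _ (homog_mem_degSet (hq i)) ?_)
    exact restrictSupport_mono ℝ (degSet_mono_mod (by omega) (by simp [Nat.ModEq])) (X_mem_degSet i)

lemma phiMon_mem (hq : ∀ i, (q i).IsHomogeneous (k + 1)) (c : Fin n →₀ ℕ) :
    phiMon (k + 1) (gpoly q ε k) c ∈ restrictSupport ℝ (degSet n k c.degree) := by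
  have : c.degree = ∑ i, (1 * (c i % (k + 1)) + (k + 1) * (c i / (k + 1))) := by
    rw [Finsupp.degree_eq_sum]
    refine Finset.sum_congr rfl fun i _ => ?_
    rw [one_mul, Nat.mod_add_div]
  rw [this]
  refine prod_mem_degSet _ _ _ fun i => ?_
  exact mul_mem_degSet (pow_mem_degSet (X_mem_degSet i) _) (pow_mem_degSet (gpoly_mem q ε hq i) _)

lemma phiMon_coeff_zero (hq : ∀ i, (q i).IsHomogeneous (k + 1)) (c : Fin n →₀ ℕ) (hc : c ≠ 0) :
    coeff 0 (phiMon (k + 1) (gpoly q ε k) c) = 0 := by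
  have hg : ∀ i, constantCoeff (gpoly q ε k i) = 0 := by
    intro i
    have : constantCoeff (q i) = 0 := by
      rw [constantCoeff_eq]
      exact (hq i).coeff_eq_zero (by simp)
    simp [gpoly, this]
  rw [← constantCoeff_eq, phiMon, map_prod]
  obtain ⟨i, hi⟩ := Finsupp.ne_iff.1 hc
  refine Finset.prod_eq_zero (Finset.mem_univ i) ?_
  have h1 := Nat.mod_add_div (c i) (k + 1)
  by_cases h : c i % (k + 1) = 0
  · have : c i / (k + 1) ≠ 0 := by
      intro h2; rw [h, h2] at h1; simp at h1 hi; exact hi h1.symm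
    simp [hg, this]
  · simp [h]

/-- exponents in the box -/
noncomputable def boxExp (a : Fin n → Fin (k + 1)) : Fin n →₀ ℕ :=
  Finsupp.equivFunOnFinite.symm fun i => (a i : ℕ)

lemma phiMon_of_lt (g : Fin n → MvPolynomial (Fin n) ℝ) (c : Fin n →₀ ℕ) (hc : ∀ i, c i < k + 1) :
    phiMon (k + 1) g c = monomial c 1 := by
  rw [← prod_X_pow_eq]
  unfold phiMon
  refine Finset.prod_congr rfl fun i _ => ?_
  rw [Nat.mod_eq_of_lt (hc i), Nat.div_eq_of_lt (hc i)]; simp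

lemma phiMon_mem_ideal (g : Fin n → MvPolynomial (Fin n) ℝ) (c : Fin n →₀ ℕ)
    (hc : ∃ i, k + 1 ≤ c i) : phiMon (k + 1) g c ∈ Ideal.span (Set.range g) := by
  obtain ⟨i, hi⟩ := hc
  have h : c i / (k + 1) ≠ 0 := by
    have := Nat.div_pos hi (Nat.succ_pos k); omega
  unfold phiMon
  refine Ideal.mem_of_dvd _ (Finset.dvd_prod_of_mem _ (Finset.mem_univ i)) ?_
  refine Ideal.mul_mem_left _ _ (Ideal.pow_mem_of_mem _ (Ideal.subset_span (Set.mem_range_self i)) _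
    (Nat.pos_of_ne_zero h))

lemma phiMon_mul (g : Fin n → MvPolynomial (Fin n) ℝ) (c : Fin n →₀ ℕ) (i : Fin n) :
    phiMon (k + 1) g c * g i = phiMon (k + 1) g (c + Finsupp.single i (k + 1)) := by
  unfold phiMon
  rw [← Finset.mul_prod_erase _ _ (Finset.mem_univ i), ← Finset.mul_prod_erase Finset.univ
    (fun j => X j ^ ((c + Finsupp.single i (k + 1)) j % (k + 1)) *
      g j ^ ((c + Finsupp.single i (k + 1)) j / (k + 1))) (Finset.mem_univ i)]
  have : ∏ j ∈ Finset.univ.erase i, (X j ^ ((c + Finsupp.single i (k + 1)) j % (k + 1)) *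
      g j ^ ((c + Finsupp.single i (k + 1)) j / (k + 1))) =
      ∏ j ∈ Finset.univ.erase i, (X j ^ (c j % (k + 1)) * g j ^ (c j / (k + 1))) := by
    refine Finset.prod_congr rfl fun j hj => ?_
    have hj' : i ≠ j := fun h => by simp [h] at hj
    simp [hj']
  rw [this]
  simp only [Finsupp.add_apply, Finsupp.single_eq_same, Nat.add_mod_right,
    Nat.add_div_right _ (Nat.succ_pos k), pow_succ]
  ring

lemma phiLin_surj (hq : ∀ i, (q i).IsHomogeneous (k + 1))
    (hinj : Function.Injective (phiLin (k + 1) (gpoly q ε k))) (p : MvPolynomial (Fin n) ℝ) :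
    ∃ p', phiLin (k + 1) (gpoly q ε k) p' = p := by
  suffices h : ⊤ ≤ LinearMap.range (phiLin (k + 1) (gpoly q ε k)) from h trivial
  rw [← (basisMonomials (Fin n) ℝ).span_eq, Submodule.span_le]
  rintro _ ⟨c, rfl⟩
  obtain ⟨p', -, h⟩ := phi_surj (k + 1) (gpoly q ε k) hinj _ (degSet_finite n k c.degree)
    (fun c' hc' => restrictSupport_mono ℝ (degSet_mono_mod hc'.1 hc'.2) (phiMon_mem q ε hq c'))
    (monomial c 1) ((monomial_mem_restrictSupport ℝ).2 (Or.inl ⟨le_rfl, rfl⟩))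
  exact ⟨p', by simpa using h⟩

lemma ideal_le (hq : ∀ i, (q i).IsHomogeneous (k + 1))
    (hinj : Function.Injective (phiLin (k + 1) (gpoly q ε k))) (p : MvPolynomial (Fin n) ℝ)
    (hp : p ∈ Ideal.span (Set.range (gpoly q ε k))) :
    ∃ p' ∈ restrictSupport ℝ {c : Fin n →₀ ℕ | ∃ i, k + 1 ≤ c i},
      phiLin (k + 1) (gpoly q ε k) p' = p := by
  set N := (restrictSupport ℝ {c : Fin n →₀ ℕ | ∃ i, k + 1 ≤ c i}).map
    (phiLin (k + 1) (gpoly q ε k)) with hN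
  suffices h : p ∈ N by
    obtain ⟨p', h1, h2⟩ := h
    exact ⟨p', h1, h2⟩
  refine Submodule.span_induction (p := fun x _ => ∀ r : MvPolynomial (Fin n) ℝ, r * x ∈ N)
    ?_ ?_ ?_ ?_ hp 1 |> fun h => by simpa using h
  · rintro _ ⟨i, rfl⟩ r
    obtain ⟨r, rfl⟩ := phiLin_surj q ε hq hinj r
    rw [phiLin_apply, Finset.sum_mul]
    refine Submodule.sum_mem _ fun c _ => ?_
    rw [smul_mul_assoc, phiMon_mul]
    refine Submodule.smul_mem _ _ ⟨monomial (c + Finsupp.single i (k + 1)) 1, ?_, ?_⟩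
    · exact (monomial_mem_restrictSupport ℝ).2 (Or.inl ⟨i, by simp⟩)
    · rw [phiLin_monomial]
  · intro r; simp
  · intro x y _ _ hx hy r
    rw [mul_add]; exact Submodule.add_mem _ (hx r) (hy r)
  · intro a x _ hx r
    rw [smul_eq_mul, ← mul_assoc]; exact hx _

/-- monomials outside the ideal: independence -/
lemma box_indep (hq : ∀ i, (q i).IsHomogeneous (k + 1))
    (hinj : Function.Injective (phiLin (k + 1) (gpoly q ε k))) :
    LinearIndependent ℝ (fun a : Fin n → Fin (k + 1) =>
      Ideal.Quotient.mkₐ ℝ (Ideal.span (Set.range (gpoly q ε k))) (monomial (boxExp a) 1)) := by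
  have hli : LinearIndependent ℝ (fun a : Fin n → Fin (k + 1) =>
      (monomial (boxExp a) 1 : MvPolynomial (Fin n) ℝ)) := by
    have := (basisMonomials (Fin n) ℝ).linearIndependent.comp (boxExp (n := n) (k := k)) (by
      intro a b h
      have := Finsupp.equivFunOnFinite.symm.injective h
      funext i
      exact Fin.ext (congrFun this i))
    have he : (fun a : Fin n → Fin (k + 1) => (monomial (boxExp a) 1 : MvPolynomial (Fin n) ℝ)) =
      (basisMonomials (Fin n) ℝ) ∘ boxExp := by funext a; simp
    rw [he]
    exact this
  refine hli.map (f := (Ideal.Quotient.mkₐ ℝ (Ideal.span (Set.range (gpoly q ε k)))).toLinearMap) ?_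
  rw [Submodule.disjoint_def]
  intro x hx hker
  have hxb : x ∈ restrictSupport ℝ {c : Fin n →₀ ℕ | ∀ i, c i < k + 1} := by
    refine Submodule.span_le.2 ?_ hx
    rintro _ ⟨a, rfl⟩
    exact (monomial_mem_restrictSupport ℝ).2 (Or.inl fun i => (a i).2)
  have hxI : x ∈ Ideal.span (Set.range (gpoly q ε k)) := by
    rw [LinearMap.mem_ker] at hker
    exact Ideal.Quotient.eq_zero_iff_mem.1 hker
  obtain ⟨y, hy, hyx⟩ := ideal_le q ε hq hinj x hxI
  have hxx : phiLin (k + 1) (gpoly q ε k) x = x := by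
    rw [phiLin_apply]
    conv_rhs => rw [x.as_sum]
    refine Finset.sum_congr rfl fun c hc => ?_
    rw [phiMon_of_lt _ _ (hxb hc), smul_monomial]; simp
  have hyx' : y = x := hinj (hyx.trans hxx.symm)
  subst hyx'
  by_contra hne
  obtain ⟨c, hc⟩ := support_nonempty.2 hne
  obtain ⟨i, hi⟩ := hy hc
  have := hxb hc i
  omega

end

section
variable {n k : ℕ} (q : Fin n → MvPolynomial (Fin n) ℝ) (ε : ℝ)

/-- index type of the basis -/
abbrev BoxIdx (n k : ℕ) : Type :=
  {a : Fin n → Fin (k + 1) // ∑ i, ((a i : ℕ) : ZMod k) = 0 ∧ a ≠ 0}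

lemma boxIdx_card_odd (hk : 0 < k) (hn : 0 < n) (hpar : Even (k + 1) ∨ (Odd (k + 1) ∧ Odd n)) :
    Odd (Fintype.card (BoxIdx n k)) := by
  obtain ⟨e, he, h1, -⟩ := count_aux k hk n
  have h0 := he 0
  rw [if_pos rfl, Fintype.card_subtype] at h0
  have : Fintype.card (BoxIdx n k) = e := by
    rw [Fintype.card_subtype]
    have hs : (Finset.univ.filter fun a : Fin n → Fin (k + 1) =>
        ∑ i, ((a i : ℕ) : ZMod k) = 0 ∧ a ≠ 0) =
        (Finset.univ.filter fun a : Fin n → Fin (k + 1) =>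
        ∑ i, ((a i : ℕ) : ZMod k) = 0).erase 0 := by
      ext a
      simp [and_comm]
    rw [hs, Finset.card_erase_of_mem (by simp), h0]
    rfl
  rw [this]
  apply h1
  rcases hpar with h | h
  · exact Or.inl ⟨h, hn⟩
  · exact Or.inr h.2

lemma boxExp_degree (a : Fin n → Fin (k + 1)) :
    ((boxExp a).degree : ZMod k) = ∑ i, ((a i : ℕ) : ZMod k) := by
  rw [Finsupp.degree_eq_sum]
  simp [boxExp]

lemma boxExp_ne_zero (a : Fin n → Fin (k + 1)) (ha : a ≠ 0) : boxExp a ≠ 0 := by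
  intro h
  apply ha
  funext i
  apply Fin.ext
  have := DFunLike.congr_fun h i
  simpa [boxExp] using this

noncomputable abbrev boxSpan (k : ℕ) : Submodule ℝ
    (MvPolynomial (Fin n) ℝ ⧸ Ideal.span (Set.range (gpoly q ε k))) :=
  Submodule.span ℝ (Set.range fun a : BoxIdx n k =>
    Ideal.Quotient.mkₐ ℝ (Ideal.span (Set.range (gpoly q ε k))) (monomial (boxExp a.1) 1))

lemma mem_boxSpan (hq : ∀ i, (q i).IsHomogeneous (k + 1))
    (hinj : Function.Injective (phiLin (k + 1) (gpoly q ε k))) (c : Fin n →₀ ℕ)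
    (hc : c ≠ 0) (hkc : k ∣ c.degree) :
    Ideal.Quotient.mkₐ ℝ (Ideal.span (Set.range (gpoly q ε k))) (monomial c 1)
      ∈ boxSpan q ε k := by
  obtain ⟨p, hp, h⟩ := phi_surj (k + 1) (gpoly q ε k) hinj (degSet n k c.degree \ {0})
    ((degSet_finite n k c.degree).subset Set.sdiff_subset)
    (fun c' hc' x hx => ⟨restrictSupport_mono ℝ (degSet_mono_mod hc'.1.1 hc'.1.2)
      (phiMon_mem q ε hq c') hx, by
        rintro rfl
        exact mem_support_iff.1 hx (phiMon_coeff_zero q ε hq c' hc'.2)⟩)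
    (monomial c 1) ((monomial_mem_restrictSupport ℝ).2 (Or.inl ⟨⟨le_rfl, rfl⟩, hc⟩))
  rw [← h, phiLin_apply, map_sum]
  refine Submodule.sum_mem _ fun c' hc' => ?_
  rw [map_smul]
  refine Submodule.smul_mem _ _ ?_
  have hc'' := hp hc'
  by_cases hb : ∃ i, k + 1 ≤ c' i
  · have : Ideal.Quotient.mkₐ ℝ (Ideal.span (Set.range (gpoly q ε k)))
        (phiMon (k + 1) (gpoly q ε k) c') = 0 :=
      Ideal.Quotient.eq_zero_iff_mem.2 (phiMon_mem_ideal _ _ hb)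
    rw [this]
    exact Submodule.zero_mem _
  · push Not at hb
    rw [phiMon_of_lt _ _ hb]
    have hbe : boxExp (fun i => (⟨c' i, hb i⟩ : Fin (k + 1))) = c' := by
      ext i; simp [boxExp]
    refine Submodule.subset_span ⟨⟨fun i => ⟨c' i, hb i⟩, ?_, ?_⟩, ?_⟩
    · rw [← boxExp_degree, hbe, ZMod.natCast_eq_zero_iff]
      exact (Nat.modEq_zero_iff_dvd.1 (hc''.1.2.trans (Nat.modEq_zero_iff_dvd.2 hkc)))
    · intro h0
      apply hc''.2
      rw [← hbe, h0]
      ext i; simp [boxExp]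
    · simp only [hbe]

lemma aeval_scale {A : Type*} [CommRing A] [Algebra ℝ A] (u : A) (x : Fin n → A) {d : ℕ}
    (p : MvPolynomial (Fin n) ℝ) (hp : p.IsHomogeneous d) :
    aeval (fun j => u * x j) p = u ^ d * aeval x p := by
  rw [aeval_def, aeval_def, eval₂_eq', eval₂_eq', Finset.mul_sum]
  refine Finset.sum_congr rfl fun c hc => ?_
  have hd : ∑ i, c i = d := by
    rw [← Finsupp.degree_eq_sum]
    by_contra h
    exact mem_support_iff.1 hc (hp.coeff_eq_zero h)
  simp only [mul_pow, Finset.prod_mul_distrib, Finset.prod_pow_eq_pow_sum, hd]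
  ring

lemma aeval_eig {A : Type*} [CommRing A] [Algebra ℝ A] (w : A) (y : Fin n → A) (r : Fin n → ℝ)
    (h : ∀ j, y j * w = r j • w) (p : MvPolynomial (Fin n) ℝ) :
    aeval y p * w = eval r p • w := by
  induction p using MvPolynomial.induction_on with
  | C a => simp [Algebra.smul_def]
  | add p p' h1 h2 => simp [add_mul, add_smul, h1, h2]
  | mul_X p j hp =>
    rw [map_mul, map_mul, aeval_X, eval_X, mul_assoc, h, mul_smul_comm, hp, smul_smul, mul_comm]

lemma exists_split (c : Fin n →₀ ℕ) (hc : c ≠ 0) :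
    ∃ i c', c = Finsupp.single i 1 + c' ∧ c'.degree + 1 = c.degree := by
  obtain ⟨i, hi⟩ := Finsupp.ne_iff.1 hc
  have hle : Finsupp.single i 1 ≤ c := by
    rw [Finsupp.single_le_iff]
    simp at hi
    omega
  refine ⟨i, c - Finsupp.single i 1, (add_tsub_cancel_of_le hle).symm, ?_⟩
  conv_rhs => rw [← add_tsub_cancel_of_le hle]
  rw [map_add]
  simp [add_comm]

lemma main_generic (hk : 0 < k) (hn : 0 < n) (hpar : Even (k + 1) ∨ (Odd (k + 1) ∧ Odd n))
    (hq : ∀ i, (q i).IsHomogeneous (k + 1)) (hε : ε ≠ 0)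
    (hinj : Function.Injective (phiLin (k + 1) (gpoly q ε k))) :
    ∃ v : Fin n → ℝ, v ≠ 0 ∧ ∃ l : ℝ, ∀ j, eval v (q j) + ε⁻¹ * v j ^ (k + 1) = l * v j := by
  set I := Ideal.span (Set.range (gpoly q ε k)) with hI
  set mk := Ideal.Quotient.mkₐ ℝ I with hmk
  let x : Fin n → MvPolynomial (Fin n) ℝ ⧸ I := fun i => mk (X i)
  have hmkae : ∀ p, mk p = aeval x p := by
    intro p
    have : mk = aeval x := by
      apply MvPolynomial.algHom_ext
      intro i; simp [x]
    rw [this]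
  -- the basis and the common eigenvector
  have hli : LinearIndependent ℝ (fun a : BoxIdx n k => mk (monomial (boxExp a.1) 1)) :=
    (box_indep q ε hq hinj).comp (fun a : BoxIdx n k => a.1) Subtype.val_injective
  have hcard : Module.finrank ℝ (boxSpan q ε k) = Fintype.card (BoxIdx n k) :=
    finrank_span_eq_card hli
  have hfd : FiniteDimensional ℝ (boxSpan q ε k) :=
    FiniteDimensional.span_of_finite ℝ (Set.finite_range _)
  obtain ⟨w, hwK, hw0, hw⟩ := odd_common
    {b | ∃ c : Fin n →₀ ℕ, k ∣ c.degree ∧ b = mk (monomial c 1)} _ (boxSpan q ε k) hfd hcard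
    (boxIdx_card_odd hk hn hpar) (by
      rintro _ ⟨c, hc, rfl⟩ w hw
      induction hw using Submodule.span_induction with
      | mem y hy =>
        obtain ⟨a, rfl⟩ := hy
        beta_reduce
        rw [← map_mul, monomial_mul, one_mul]
        refine mem_boxSpan q ε hq hinj _ ?_ ?_
        · intro h
          have := boxExp_ne_zero a.1 a.2.2
          simp only [add_eq_zero] at h
          exact this h.2
        · rw [map_add]
          refine dvd_add hc ?_
          rw [← ZMod.natCast_eq_zero_iff, boxExp_degree]
          exact a.2.1
      | zero => rw [mul_zero]; exact Submodule.zero_mem _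
      | add y z _ _ hy hz => rw [mul_add]; exact Submodule.add_mem _ hy hz
      | smul t y _ hy => rw [mul_smul_comm]; exact Submodule.smul_mem _ _ hy)
  have hw' : ∀ c : Fin n →₀ ℕ, k ∣ c.degree → ∃ t : ℝ, mk (monomial c 1) * w = t • w :=
    fun c hc => hw _ ⟨c, hc, rfl⟩
  have hsm : ∀ s t : ℝ, s • w = t • w → s = t := fun s t h => smul_left_injective ℝ hw0 h
  -- the homogeneous polynomials
  let P : Fin n → MvPolynomial (Fin n) ℝ := fun j => q j + C ε⁻¹ * X j ^ (k + 1)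
  have hP : ∀ j, (P j).IsHomogeneous (k + 1) := by
    intro j
    refine (hq j).add ?_
    have := (isHomogeneous_C (Fin n) ε⁻¹).mul ((isHomogeneous_X ℝ j).pow (k + 1))
    simpa using this
  have hPx : ∀ j, mk (P j) = x j := by
    intro j
    have h0 : P j - X j = C ε⁻¹ * gpoly q ε k j := by
      simp only [P, gpoly, mul_add, ← mul_assoc, ← C_mul, inv_mul_cancel₀ hε, C_1]
      ring
    have : mk (P j - X j) = 0 := by
      apply Ideal.Quotient.eq_zero_iff_mem.2
      rw [h0]
      exact Ideal.mul_mem_left _ _ (Ideal.subset_span (Set.mem_range_self j))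
    rw [map_sub] at this
    exact sub_eq_zero.1 this
  have hxpow : ∀ i (e : ℕ), x i ^ e = mk (monomial (Finsupp.single i e) 1) := by
    intro i e
    rw [← X_pow_eq_monomial, map_pow]
  by_cases hcase : ∃ i, x i ^ k * w ≠ 0
  · obtain ⟨i, hi⟩ := hcase
    obtain ⟨c, hc⟩ := hw' (Finsupp.single i k) (by simp)
    rw [← hxpow] at hc
    have hc0 : c ≠ 0 := by
      rintro rfl
      rw [hc] at hi; simp at hi
    let u := x i ^ (k - 1)
    have hr : ∀ j, ∃ r : ℝ, (u * x j) * w = r • w := by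
      intro j
      obtain ⟨r, hr⟩ := hw' (Finsupp.single i (k - 1) + Finsupp.single j 1) (by
        rw [map_add, Finsupp.degree_single, Finsupp.degree_single, Nat.sub_add_cancel hk])
      refine ⟨r, ?_⟩
      rw [← hr, ← one_mul (1 : ℝ), ← monomial_mul, map_mul, ← hxpow, ← hxpow, pow_one]
    choose r hr using hr
    have hri : r i = c := by
      apply hsm
      rw [← hr, ← hc, ← pow_succ, Nat.sub_add_cancel hk]
    have huk : ∀ e : ℕ, (x i ^ k) ^ e * w = c ^ e • w := by
      intro e
      induction e with
      | zero => simp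
      | succ e ih => rw [pow_succ, mul_assoc, hc, mul_smul_comm, ih, smul_smul, pow_succ']
    let v : Fin n → ℝ := fun j => c⁻¹ * r j
    have hv : r = fun j => c * v j := by
      funext j; simp [v, hc0]
    refine ⟨v, fun h => ?_, c⁻¹, fun j => ?_⟩
    · have := congrFun h i
      simp [v, hri, hc0] at this
    · have e1 : u ^ (k + 1) * x j * w = eval r (P j) • w := by
        rw [← aeval_eig w _ r hr, aeval_scale u x _ (hP j), ← hmkae, hPx]
      have e2 : u ^ (k + 1) * x j * w = (c ^ (k - 1) * r j) • w := by
        have : u ^ (k + 1) * x j * w = (x i ^ k) ^ (k - 1) * ((u * x j) * w) := by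
          have : (x i ^ k) ^ (k - 1) = u ^ k := by
            simp only [u, ← pow_mul]; rw [mul_comm]
          rw [this]; ring
        rw [this, hr, mul_smul_comm, huk, smul_smul, mul_comm]
      have e3 := hsm _ _ (e1.symm.trans e2)
      have e4 : eval r (P j) = c ^ (k + 1) * eval v (P j) := by
        have := aeval_scale c v _ (hP j)
        rw [← hv] at this
        simpa [coe_aeval_eq_eval] using this
      have e5 : eval v (P j) = eval v (q j) + ε⁻¹ * v j ^ (k + 1) := by simp [P]
      rw [← e5]
      rw [e4, hv] at e3
      obtain ⟨k', rfl⟩ : ∃ k', k = k' + 1 := ⟨k - 1, by omega⟩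
      simp only [Nat.add_sub_cancel] at e3
      have : c ^ (k' + 2) ≠ 0 := pow_ne_zero _ hc0
      apply mul_left_cancel₀ this
      rw [show k' + 1 + 1 = k' + 2 from rfl] at e3
      rw [e3]
      field_simp
      ring
  · exfalso
    push Not at hcase
    let 𝔪 : Ideal (MvPolynomial (Fin n) ℝ ⧸ I) := Ideal.span (Set.range x)
    have hxm : ∀ i, x i ∈ 𝔪 := fun i => Ideal.subset_span (Set.mem_range_self i)
    have hsplit : ∀ (i : Fin n) (c' : Fin n →₀ ℕ),
        mk (monomial (Finsupp.single i 1 + c') 1) = x i * mk (monomial c' 1) := by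
      intro i c'
      rw [← one_mul (1 : ℝ), ← monomial_mul, map_mul, ← hxpow, pow_one, one_mul]
    have hmono : ∀ c : Fin n →₀ ℕ, c ≠ 0 → mk (monomial c 1) ∈ 𝔪 := by
      intro c hc
      obtain ⟨i, c', rfl, -⟩ := exists_split c hc
      rw [hsplit]
      exact Ideal.mul_mem_right _ _ (hxm i)
    have hsum : ∀ j, x j = ∑ c ∈ (P j).support, coeff c (P j) • mk (monomial c 1) := by
      intro j
      rw [← hPx j]
      conv_lhs => rw [(P j).as_sum]
      rw [map_sum]
      refine Finset.sum_congr rfl fun c _ => ?_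
      rw [← map_smul, smul_monomial]; simp
    have hdeg : ∀ j, ∀ c ∈ (P j).support, c.degree = k + 1 := by
      intro j c hc
      by_contra h
      exact mem_support_iff.1 hc ((hP j).coeff_eq_zero h)
    have hidem : 𝔪 ≤ 𝔪 * 𝔪 := by
      refine Ideal.span_le.2 ?_
      rintro _ ⟨j, rfl⟩
      rw [SetLike.mem_coe, hsum j]
      refine Ideal.sum_mem _ fun c hc => ?_
      have hd := hdeg j c hc
      obtain ⟨i, c', rfl, hc'⟩ := exists_split c (by rintro rfl; simp at hd)
      rw [hsplit]
      refine Submodule.smul_of_tower_mem _ _ (Ideal.mul_mem_mul (hxm i) (hmono _ ?_))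
      rintro rfl
      simp at hc' hd
      omega
    have hkill : ∀ c : Fin n →₀ ℕ, c.degree = k → mk (monomial c 1) * w = 0 := by
      intro c hc
      obtain ⟨t, ht⟩ := hw' c (by rw [hc])
      have hpow : ∀ e : ℕ, (mk (monomial c 1)) ^ e * w = t ^ e • w := by
        intro e
        induction e with
        | zero => simp
        | succ e ih => rw [pow_succ, mul_assoc, ht, mul_smul_comm, ih, smul_smul, pow_succ']
      obtain ⟨i, c', rfl, -⟩ := exists_split c (by rintro rfl; simp at hc; omega)
      have h0 := hpow k
      rw [hsplit, mul_pow, mul_right_comm, hcase i, zero_mul] at h0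
      have : t ^ k = 0 := hsm _ _ (by rw [← h0, zero_smul])
      rw [ht, (pow_eq_zero_iff hk.ne').1 this, zero_smul]
    have hxw : ∀ j, x j * w = 0 := by
      intro j
      rw [hsum j, Finset.sum_mul]
      refine Finset.sum_eq_zero fun c hc => ?_
      have hd := hdeg j c hc
      obtain ⟨i, c', rfl, hc'⟩ := exists_split c (by rintro rfl; simp at hd)
      rw [hsplit, smul_mul_assoc, mul_assoc, hkill c' (by omega), mul_zero, smul_zero]
    have hmw : ∀ y ∈ 𝔪, y * w = 0 := by
      intro y hy
      induction hy using Submodule.span_induction with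
      | mem y hy => obtain ⟨j, rfl⟩ := hy; exact hxw j
      | zero => simp
      | add y z _ _ hy hz => rw [add_mul, hy, hz, add_zero]
      | smul t y _ hy => rw [smul_eq_mul, mul_assoc, hy, mul_zero]
    have hwm : w ∈ 𝔪 := by
      have hle : boxSpan q ε k ≤ 𝔪.restrictScalars ℝ := by
        refine Submodule.span_le.2 ?_
        rintro _ ⟨a, rfl⟩
        exact hmono _ (boxExp_ne_zero a.1 a.2.2)
      exact hle hwK
    obtain ⟨e, he, hme⟩ := (Ideal.isIdempotentElem_iff_of_fg 𝔪
      (IsNoetherian.noetherian 𝔪)).1 (le_antisymm Ideal.mul_le_right hidem)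
    have hem : e ∈ 𝔪 := by rw [hme]; exact Submodule.mem_span_singleton_self e
    rw [hme] at hwm
    obtain ⟨a, ha⟩ := Submodule.mem_span_singleton.1 hwm
    have h1 := hmw e hem
    rw [← ha, smul_eq_mul, mul_left_comm, he.eq] at h1
    exact hw0 (by rw [← ha, smul_eq_mul, h1])

end

theorem stmt_2 {n m : ℕ} (hn : 0 < n) (hm : 1 < m)
    (Q : (Fin n → ℝ) → (Fin n → ℝ)) (Qc : (Fin n → ℂ) → (Fin n → ℂ))
    (hQ : ∀ i : Fin n, ∃ p : MvPolynomial (Fin n) ℝ, p.IsHomogeneous m ∧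
      (∀ x : Fin n → ℝ, Q x i = MvPolynomial.eval x p) ∧
      (∀ z : Fin n → ℂ, Qc z i = MvPolynomial.eval z (MvPolynomial.map (algebraMap ℝ ℂ) p)))
    (hfin : {W : Submodule ℂ (Fin n → ℂ) | ∃ v : Fin n → ℂ, v ≠ 0 ∧
      W = Submodule.span ℂ {v} ∧ ∃ l : ℂ, Qc v = l • v}.Finite)
    (hpar : Even m ∨ (Odd m ∧ Odd n)) :
    ∃ (v : Fin n → ℝ) (l : ℝ), v ≠ 0 ∧ Q v = l • v := by
  obtain ⟨k, rfl⟩ : ∃ k, m = k + 1 := ⟨m - 1, by omega⟩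
  have hk : 0 < k := by omega
  choose q hq hQq _ using hQ
  obtain ⟨Z, hZ, hZinj⟩ := inj_generic (k + 1) (fun i => q i - X i)
  -- perturbed eigenvectors
  have step : ∀ N : ℕ, ∃ (T : ℝ) (v : Fin n → ℝ), |T| ≤ 1 / ((N : ℝ) + 1) ∧ v ∈ Metric.sphere 0 1 ∧
      ∀ i j, (eval v (q i) + T * v i ^ (k + 1)) * v j = (eval v (q j) + T * v j ^ (k + 1)) * v i := by
    intro N
    obtain ⟨ε, hεZ, hε⟩ := (hZ.dense_compl ℝ).exists_gt ((N : ℝ) + 1)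
    have hN : (0 : ℝ) < (N : ℝ) + 1 := by positivity
    have hε0 : 0 < ε := hN.trans hε
    obtain ⟨v, hv0, l, hl⟩ := main_generic q ε hk hn hpar hq hε0.ne' (hZinj ε hεZ)
    refine ⟨ε⁻¹, fun j => ‖v‖⁻¹ * v j, ?_, ?_, ?_⟩
    · rw [abs_of_pos (inv_pos.2 hε0), ← one_div]
      exact one_div_le_one_div_of_le hN hε.le
    · have : (fun j => ‖v‖⁻¹ * v j) = ‖v‖⁻¹ • v := by funext j; simp
      rw [this, mem_sphere_zero_iff_norm, norm_smul, norm_inv, norm_norm]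
      exact inv_mul_cancel₀ (norm_ne_zero_iff.2 hv0)
    · have hs : ∀ j, eval (fun j => ‖v‖⁻¹ * v j) (q j) + ε⁻¹ * (‖v‖⁻¹ * v j) ^ (k + 1) =
          ‖v‖⁻¹ ^ (k + 1) * (l * v j) := by
        intro j
        have := aeval_scale ‖v‖⁻¹ v _ (hq j)
        rw [← hl j, mul_pow]
        have h2 : eval (fun j => ‖v‖⁻¹ * v j) (q j) = ‖v‖⁻¹ ^ (k + 1) * eval v (q j) := this
        rw [h2]; ring
      intro i j
      rw [hs i, hs j]; ring
  choose T v hT hv heq using step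
  obtain ⟨v₀, hv₀, φ, hφ, hlim⟩ := (isCompact_sphere (0 : Fin n → ℝ) 1).tendsto_subseq hv
  have hT0 : Filter.Tendsto T Filter.atTop (nhds 0) :=
    squeeze_zero_norm hT tendsto_one_div_add_atTop_nhds_zero_nat
  have hTφ := hT0.comp hφ.tendsto_atTop
  have hpi : ∀ i, Filter.Tendsto (fun N => v (φ N) i) Filter.atTop (nhds (v₀ i)) :=
    fun i => (tendsto_pi_nhds.1 hlim) i
  have hev : ∀ i, Filter.Tendsto (fun N => eval (v (φ N)) (q i)) Filter.atTop
      (nhds (eval v₀ (q i))) :=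
    fun i => ((MvPolynomial.continuous_eval (q i)).tendsto v₀).comp hlim
  have hpar0 : ∀ i j, eval v₀ (q i) * v₀ j = eval v₀ (q j) * v₀ i := by
    intro i j
    have h1 : ∀ i j, Filter.Tendsto (fun N => (eval (v (φ N)) (q i) +
        T (φ N) * v (φ N) i ^ (k + 1)) * v (φ N) j) Filter.atTop
        (nhds ((eval v₀ (q i) + 0 * v₀ i ^ (k + 1)) * v₀ j)) :=
      fun i j => ((hev i).add (hTφ.mul ((hpi i).pow _))).mul (hpi j)
    have h2 := tendsto_nhds_unique ((h1 i j).congr fun N => heq (φ N) i j) (h1 j i)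
    simpa using h2
  have hne : v₀ ≠ 0 := by
    rintro rfl
    simp at hv₀
  obtain ⟨i, hi⟩ := Function.ne_iff.1 hne
  refine ⟨v₀, eval v₀ (q i) / v₀ i, hne, ?_⟩
  funext j
  rw [hQq, Pi.smul_apply, smul_eq_mul, div_mul_eq_mul_div, eq_div_iff hi, ← hpar0 i j]
end

section
/- Let P : ℝ^n → ℝ^n be a polynomial map, P = P_0 + ⋯ + P_m with each P_k homogeneous of degree k and P_m ≠ 0, and assume P_m(z) ≠ 0 for all z ≠ 0. If m is odd, then P is surjective: for every y ∈ ℝ^n the equation P(x) = y has a solution x ∈ ℝ^n. -/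
open MvPolynomial in
/-- box monomials -/
noncomputable def boxE {R : Type*} [CommRing R] {n : ℕ} (m : ℕ) (f : Fin n → MvPolynomial (Fin n) R)
    (a : Fin n →₀ ℕ) : MvPolynomial (Fin n) R :=
  ∏ i, (X i ^ (a i % m) * f i ^ (a i / m))

lemma odd_root (p : Polynomial ℝ) (hp : p.Monic) (ho : Odd p.natDegree) : ∃ x, p.IsRoot x := by
  have hd : 0 < p.natDegree := ho.pos
  have h1 := p.tendsto_atTop_of_leadingCoeff_nonneg (Polynomial.natDegree_pos_iff_degree_pos.mp hd)
    (by rw [hp.leadingCoeff]; norm_num)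
  have hnd : (p.comp (-Polynomial.X)).natDegree = p.natDegree := by
    simp [Polynomial.natDegree_comp]
  have h2 := (p.comp (-Polynomial.X)).tendsto_atBot_of_leadingCoeff_nonpos
    (Polynomial.natDegree_pos_iff_degree_pos.mp (by omega))
    (by rw [Polynomial.leadingCoeff_comp (by simp)]; simp [hp.leadingCoeff, ho.neg_one_pow])
  obtain ⟨b, hb⟩ := (h1.eventually_ge_atTop 0).exists
  obtain ⟨a, ha⟩ := (h2.eventually_le_atBot 0).exists
  simp at ha
  obtain ⟨x, hx⟩ := mem_range_of_exists_le_of_exists_ge p.continuous ⟨-a, ha⟩ ⟨b, hb⟩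
  exact ⟨x, hx⟩

lemma common_eig {ι : Type} (d : ℕ) : ∀ (V : Type) [AddCommGroup V] [Module ℝ V]
    [FiniteDimensional ℝ V] (f : ι → Module.End ℝ V) (_ : ∀ i j v, f i (f j v) = f j (f i v))
    (_ : Module.finrank ℝ V = d) (_ : Odd d),
    ∃ v : V, v ≠ 0 ∧ ∀ i, ∃ c : ℝ, f i v = c • v := by
  induction d using Nat.strong_induction_on with
  | _ d ih =>
  intro V _ _ _ f hc hd ho
  by_cases hs : ∀ i, ∃ c : ℝ, ∀ v, f i v = c • v
  · have : Nontrivial V := Module.nontrivial_of_finrank_pos (R := ℝ) (by rw [hd]; exact ho.pos)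
    obtain ⟨v, hv⟩ := exists_ne (0 : V)
    exact ⟨v, hv, fun i => (hs i).imp fun c h => h v⟩
  push Not at hs
  obtain ⟨i, hi⟩ := hs
  obtain ⟨c, hcr⟩ := odd_root (f i).charpoly (f i).charpoly_monic
    (by rw [LinearMap.charpoly_natDegree, hd]; exact ho)
  have hev := (Module.End.hasEigenvalue_iff_isRoot_charpoly (f i) c).2 hcr
  obtain ⟨w, hw⟩ := hev.exists_hasEigenvector
  set g : Module.End ℝ V := f i - c • 1 with hg
  have hgv : ∀ v, g v = f i v - c • v := fun v => by simp [hg]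
  have hsum := g.finrank_range_add_finrank_ker
  have hkw : w ∈ LinearMap.ker g := by
    rw [LinearMap.mem_ker, hgv, hw.apply_eq_smul, sub_self]
  have hkpos : 0 < Module.finrank ℝ (LinearMap.ker g) := by
    apply Module.finrank_pos_iff_exists_ne_zero.2
    exact ⟨⟨w, hkw⟩, fun h => hw.2 (by simpa using congrArg Subtype.val h)⟩
  obtain ⟨u, hu⟩ := hi c
  have hrpos : 0 < Module.finrank ℝ (LinearMap.range g) := by
    apply Module.finrank_pos_iff_exists_ne_zero.2
    refine ⟨⟨g u, u, rfl⟩, fun h => hu ?_⟩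
    have := congrArg Subtype.val h
    simpa [hgv, sub_eq_zero] using this
  have key : ∀ W : Submodule ℝ V, (∀ j, ∀ v ∈ W, f j v ∈ W) → Module.finrank ℝ W < d →
      Odd (Module.finrank ℝ W) → ∃ v : V, v ≠ 0 ∧ ∀ i, ∃ c : ℝ, f i v = c • v := by
    intro W hW hlt hodd
    obtain ⟨v, hv, h⟩ := ih _ hlt W (fun j => (f j).restrict (hW j))
      (fun a b v => Subtype.ext (by simpa using hc a b v)) rfl hodd
    refine ⟨v, fun h => hv (Subtype.ext h), fun j => ?_⟩
    obtain ⟨e, he⟩ := h j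
    exact ⟨e, by simpa using congrArg Subtype.val he⟩
  rw [hd] at hsum
  rcases Nat.even_or_odd (Module.finrank ℝ (LinearMap.ker g)) with he | he
  · apply key (LinearMap.range g) _ (by omega) (by grind)
    rintro j _ ⟨v, rfl⟩
    exact ⟨f j v, by rw [hgv, hgv, map_sub, map_smul, hc]⟩
  · apply key (LinearMap.ker g) _ (by omega) he
    intro j v hv
    rw [LinearMap.mem_ker, hgv] at hv ⊢
    rw [hc, ← map_smul, ← map_sub, hv, map_zero]

open MvPolynomial in
lemma zero_of_bij {n m : ℕ} (hm : Odd m) (f : Fin n → MvPolynomial (Fin n) ℝ)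
    (Φ : MvPolynomial (Fin n) ℝ →ₗ[ℝ] MvPolynomial (Fin n) ℝ)
    (hΦ : ∀ a, Φ (monomial a 1) = boxE m f a) (hb : Function.Bijective Φ) :
    ∃ x : Fin n → ℝ, ∀ i, eval x (f i) = 0 := by
  classical
  have hm0 : 0 < m := hm.pos
  set B : Set (Fin n →₀ ℕ) := {a | ∀ i, a i < m} with hB
  set I : Ideal (MvPolynomial (Fin n) ℝ) := Ideal.span (Set.range f) with hI
  have hmap : (restrictSupport ℝ Bᶜ).map Φ = I.restrictScalars ℝ := by
    apply le_antisymm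
    · rw [restrictSupport_eq_span, Submodule.map_span_le]
      rintro _ ⟨a, ha, rfl⟩
      simp only [hΦ, Submodule.restrictScalars_mem]
      simp only [hB, Set.mem_compl_iff, Set.mem_ofPred_eq, not_forall, not_lt] at ha
      obtain ⟨i, hi⟩ := ha
      have h1 : f i ∣ boxE m f a := by
        refine dvd_trans ?_ (Finset.dvd_prod_of_mem _ (Finset.mem_univ i))
        exact Dvd.dvd.mul_left (dvd_pow_self _ (Nat.div_pos hi hm0).ne') _
      exact I.mem_of_dvd h1 (Ideal.subset_span ⟨i, rfl⟩)
    · have hstep : ∀ i q, f i * q ∈ (restrictSupport ℝ Bᶜ).map Φ := by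
        intro i q
        obtain ⟨p, rfl⟩ := hb.2 q
        induction p using MvPolynomial.induction_on' with
        | monomial a r =>
          have : monomial a r = r • (monomial a (1:ℝ)) := by simp [smul_monomial]
          rw [this, map_smul, mul_smul_comm, hΦ]
          refine Submodule.smul_mem _ _ ⟨monomial (a + Finsupp.single i m) 1, ?_, ?_⟩
          · refine (monomial_mem_restrictSupport _).2 (Or.inl ?_)
            simp only [hB, Set.mem_compl_iff, Set.mem_ofPred_eq, not_forall, not_lt]
            exact ⟨i, by simp⟩
          · rw [hΦ]
            simp only [boxE]
            rw [← Finset.mul_prod_erase _ _ (Finset.mem_univ i),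
              ← Finset.mul_prod_erase Finset.univ (fun i => X i ^ (a i % m) * f i ^ (a i / m)) (Finset.mem_univ i)]
            have : ∏ x ∈ Finset.univ.erase i, (X x ^ ((a + Finsupp.single i m) x % m) *
                f x ^ ((a + Finsupp.single i m) x / m)) =
                ∏ x ∈ Finset.univ.erase i, (X x ^ (a x % m) * f x ^ (a x / m)) := by
              refine Finset.prod_congr rfl fun x hx => ?_
              have : i ≠ x := (Finset.ne_of_mem_erase hx).symm
              simp [this]
            rw [this]
            simp [Nat.add_div_right _ hm0, pow_succ]
            ring
        | add p q hp hq => rw [map_add, mul_add]; exact Submodule.add_mem _ hp hq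
      intro p hp
      rw [Submodule.restrictScalars_mem] at hp
      induction hp using Submodule.span_induction with
      | mem x hx => obtain ⟨i, rfl⟩ := hx; simpa using hstep i 1
      | zero => exact Submodule.zero_mem _
      | add x y _ _ hx hy => exact Submodule.add_mem _ hx hy
      | smul a x hx _ =>
        clear * - hstep hx
        induction hx using Submodule.span_induction generalizing a with
        | mem x hx => obtain ⟨i, rfl⟩ := hx; rw [smul_eq_mul, mul_comm]; exact hstep i a
        | zero => simp
        | add x y _ _ hx hy => rw [smul_add]; exact Submodule.add_mem _ (hx a) (hy a)
        | smul b x _ hx => rw [smul_smul]; exact hx _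
  have hcompl : IsCompl (restrictSupport ℝ Bᶜ) (restrictSupport ℝ B) := by
    constructor
    · rw [Submodule.disjoint_def]
      intro p h1 h2
      rw [mem_restrictSupport_iff] at h1 h2
      rw [← support_eq_empty, Finset.eq_empty_iff_forall_notMem]
      intro a ha
      exact h1 ha (h2 ha)
    · rw [codisjoint_iff, eq_top_iff]
      intro p _
      induction p using MvPolynomial.induction_on' with
      | monomial a r =>
        by_cases ha : a ∈ B
        · exact Submodule.mem_sup_right ((monomial_mem_restrictSupport _).2 (Or.inl ha))
        · exact Submodule.mem_sup_left ((monomial_mem_restrictSupport _).2 (Or.inl ha))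
      | add p q hp hq => exact Submodule.add_mem _ (hp trivial) (hq trivial)
  let eB : B ≃ (Fin n → Fin m) :=
    { toFun := fun a i => ⟨a.1 i, a.2 i⟩
      invFun := fun b => ⟨Finsupp.equivFunOnFinite.symm fun i => (b i : ℕ), fun i => (b i).2⟩
      left_inv := fun a => by ext; simp
      right_inv := fun b => by ext; simp }
  let bas := (basisRestrictSupport ℝ B).reindex eB
  let Ψ := LinearEquiv.ofBijective Φ hb
  let e1 := Submodule.Quotient.equiv (restrictSupport ℝ Bᶜ) (I.restrictScalars ℝ) Ψ hmap
  let e2 := (Submodule.quotientEquivOfIsCompl _ _ hcompl).symm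
  let bas2 := (bas.map e2).map e1
  let V := MvPolynomial (Fin n) ℝ ⧸ (I.restrictScalars ℝ)
  let bas3 : Module.Basis _ ℝ (MvPolynomial (Fin n) ℝ ⧸ I) := bas2.map (Submodule.Quotient.restrictScalarsEquiv ℝ I)
  have hfd : FiniteDimensional ℝ (MvPolynomial (Fin n) ℝ ⧸ I) := Module.Finite.of_basis bas3
  have hfr : Odd (Module.finrank ℝ (MvPolynomial (Fin n) ℝ ⧸ I)) := by
    rw [Module.finrank_eq_card_basis bas3]
    simpa using hm.pow
  let π := Ideal.Quotient.mkₐ ℝ I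
  obtain ⟨v, hv, h⟩ := common_eig _ (MvPolynomial (Fin n) ℝ ⧸ I)
    (fun i => LinearMap.mulLeft ℝ (π (X i)))
    (fun i j v => by simp only [LinearMap.mulLeft_apply]; ring) rfl hfr
  choose x hx using h
  have hev : ∀ p, π p * v = eval x p • v := by
    intro p
    induction p using MvPolynomial.induction_on with
    | C r => rw [← algebraMap_eq, AlgHom.commutes, ← Algebra.smul_def]; simp
    | add p q hp hq => rw [map_add, add_mul, hp, hq, map_add, add_smul]
    | mul_X p i hp =>
      have := hx i
      rw [LinearMap.mulLeft_apply] at this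
      rw [map_mul, mul_assoc, this, mul_smul_comm, hp, smul_smul, map_mul, eval_X, mul_comm]
  refine ⟨x, fun i => ?_⟩
  have h0 : π (f i) = 0 := Ideal.Quotient.eq_zero_iff_mem.2 (Ideal.subset_span ⟨i, rfl⟩)
  have := hev (f i)
  rw [h0, zero_mul] at this
  exact (smul_eq_zero.1 this.symm).resolve_right hv

open MvPolynomial in
lemma boxE_degree {R : Type*} [CommRing R] [Nontrivial R] {n m : ℕ} (f : Fin n → MvPolynomial (Fin n) R)
    (hf : ∀ i, (f i).totalDegree ≤ m) (a : Fin n →₀ ℕ) : (boxE m f a).totalDegree ≤ a.degree := by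
  rw [boxE, Finsupp.degree_eq_sum]
  refine (totalDegree_finsetProd _ _).trans (Finset.sum_le_sum fun i _ => ?_)
  refine (totalDegree_mul _ _).trans ?_
  have h1 : (X i ^ (a i % m) : MvPolynomial (Fin n) R).totalDegree ≤ a i % m := by
    simp
  have h2 : (f i ^ (a i / m)).totalDegree ≤ a i / m * m :=
    (totalDegree_pow _ _).trans (Nat.mul_le_mul_left _ (hf i))
  have := Nat.mod_add_div' (a i) m
  omega

open MvPolynomial in
lemma boxE_map {R S : Type*} [CommRing R] [CommRing S] {n m : ℕ} (φ : R →+* S)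
    (f : Fin n → MvPolynomial (Fin n) R) (a : Fin n →₀ ℕ) :
    map φ (boxE m f a) = boxE m (fun i => map φ (f i)) a := by
  simp [boxE, map_prod]

open MvPolynomial in
lemma boxE_X {R : Type*} [CommRing R] {n m : ℕ} (a : Fin n →₀ ℕ) :
    boxE m (fun i => (X i ^ m : MvPolynomial (Fin n) R)) a = monomial a 1 := by
  rw [monomial_eq, Finsupp.prod_fintype _ _ (by simp)]
  simp only [boxE, ← pow_mul, ← pow_add, Nat.mod_add_div, C_1, one_mul]

open MvPolynomial in
lemma generic_bij {n m : ℕ} (g : Fin n → MvPolynomial (Fin n) ℝ)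
    (hg : ∀ i, (g i).totalDegree ≤ m) :
    ∃ S : Set ℝ, S.Countable ∧ ∀ t ∉ S,
      ∃ Φ : MvPolynomial (Fin n) ℝ →ₗ[ℝ] MvPolynomial (Fin n) ℝ,
      (∀ a, Φ (monomial a 1) = boxE m (fun i => X i ^ m + C t * g i) a) ∧ Function.Bijective Φ := by
  classical
  have hfin : ∀ d, Finite {a : Fin n →₀ ℕ // a.degree ≤ d} := fun d =>
    (Finsupp.finite_of_degree_le d)
  have hft : ∀ d, Fintype {a : Fin n →₀ ℕ // a.degree ≤ d} := fun d => Fintype.ofFinite _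
  let F : Fin n → MvPolynomial (Fin n) (Polynomial ℝ) := fun i =>
    X i ^ m + C Polynomial.X * map Polynomial.C (g i)
  have hF : ∀ t : ℝ, (fun i => map (Polynomial.evalRingHom t) (F i)) =
      fun i => X i ^ m + C t * g i := by
    intro t
    funext i
    have : (Polynomial.evalRingHom t).comp Polynomial.C = RingHom.id ℝ := by ext; simp
    simp [F, map_map, this, map_id]
  let M : ∀ d, Matrix {a : Fin n →₀ ℕ // a.degree ≤ d} {a : Fin n →₀ ℕ // a.degree ≤ d}
      (Polynomial ℝ) := fun d => Matrix.of fun a b => coeff b.1 (boxE m F a.1)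
  have hM : ∀ d t, (M d).map (Polynomial.evalRingHom t) = Matrix.of fun a b =>
      coeff b.1 (boxE m (fun i => X i ^ m + C t * g i) a.1) := by
    intro d t
    ext a b
    rw [← hF t]; simp only [← boxE_map]
    simp [M, coeff_map]
  have hdet : ∀ d t, (M d).det.eval t = (Matrix.of fun (a b : {a : Fin n →₀ ℕ // a.degree ≤ d}) =>
      coeff b.1 (boxE m (fun i => X i ^ m + C t * g i) a.1)).det := by
    intro d t
    rw [← hM d t, ← Polynomial.coe_evalRingHom, RingHom.map_det]; rfl
  have hne : ∀ d, (M d).det ≠ 0 := by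
    intro d h0
    have h1 := hdet d 0
    have h2 : (Matrix.of fun (a b : {a : Fin n →₀ ℕ // a.degree ≤ d}) =>
      coeff b.1 (boxE m (fun i => X i ^ m + C (0:ℝ) * g i) a.1)) = 1 := by
      ext a b
      simp only [C_0, zero_mul, add_zero, boxE_X, Matrix.of_apply, coeff_monomial, Matrix.one_apply,
        Subtype.ext_iff]
    rw [h2, h0] at h1
    simp at h1
  refine ⟨⋃ d, {t | (M d).det.IsRoot t}, Set.countable_iUnion fun d =>
    (Polynomial.finite_setOfPred_isRoot (hne d)).countable, fun t ht => ?_⟩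
  simp only [Set.mem_iUnion, not_exists, Set.mem_ofPred_eq, Polynomial.IsRoot] at ht
  set f : Fin n → MvPolynomial (Fin n) ℝ := fun i => X i ^ m + C t * g i with hfdef
  have hf : ∀ i, (f i).totalDegree ≤ m := by
    intro i
    refine (totalDegree_add _ _).trans (max_le (by simp) ?_)
    refine (totalDegree_mul _ _).trans ?_
    simpa using hg i
  let Φ := (basisMonomials (Fin n) ℝ).constr ℝ (boxE m f)
  have hΦ : ∀ a, Φ (monomial a 1) = boxE m f a := by
    intro a
    have := (basisMonomials (Fin n) ℝ).constr_basis ℝ (boxE m f) a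
    simpa using this
  refine ⟨Φ, hΦ, ?_⟩
  have hdec : ∀ d (p : MvPolynomial (Fin n) ℝ), p.totalDegree ≤ d →
      p = ∑ a : {a : Fin n →₀ ℕ // a.degree ≤ d}, coeff a.1 p • monomial a.1 1 := by
    intro d p hp
    ext b
    simp only [coeff_sum, coeff_smul, coeff_monomial, smul_eq_mul, mul_ite, mul_one, mul_zero]
    by_cases hb : b.degree ≤ d
    · rw [Finset.sum_eq_single ⟨b, hb⟩] <;> simp +contextual [Subtype.ext_iff]
    · rw [coeff_eq_zero_of_totalDegree_lt (by
        have : ∑ i ∈ b.support, b i = b.degree := rfl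
        omega)]
      rw [Finset.sum_eq_zero]
      rintro ⟨a, ha⟩ _
      have : a ≠ b := by rintro rfl; exact hb ha
      simp [this]
  have hval : ∀ d (p : MvPolynomial (Fin n) ℝ), p.totalDegree ≤ d →
      Φ p = ∑ a : {a : Fin n →₀ ℕ // a.degree ≤ d}, coeff a.1 p • boxE m f a.1 := by
    intro d p hp
    conv_lhs => rw [hdec d p hp]
    simp only [map_sum, map_smul, hΦ]
  have hinj : Function.Injective Φ := by
    rw [← LinearMap.ker_eq_bot, LinearMap.ker_eq_bot']
    intro p hp
    have h1 := hval _ p le_rfl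
    rw [hp] at h1
    set d := p.totalDegree
    have h2 : Matrix.vecMul (fun a => coeff a.1 p) (Matrix.of fun
      (a b : {a : Fin n →₀ ℕ // a.degree ≤ d}) => coeff b.1 (boxE m f a.1)) = 0 := by
      funext b
      have := congrArg (coeff b.1) h1
      simp only [coeff_sum, coeff_smul, smul_eq_mul, coeff_zero] at this
      simp [Matrix.vecMul, dotProduct, ← this]
    have h3 := Matrix.eq_zero_of_vecMul_eq_zero (by rw [← hdet]; exact ht d) h2
    rw [hdec d p le_rfl]
    refine Finset.sum_eq_zero fun a _ => ?_
    have := congrFun h3 a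
    simp only [Pi.zero_apply] at this
    rw [this, zero_smul]
  refine ⟨hinj, fun q => ?_⟩
  set d := q.totalDegree with hd
  have hpres : ∀ p ∈ restrictTotalDegree (Fin n) ℝ d, Φ p ∈ restrictTotalDegree (Fin n) ℝ d := by
    intro p hp
    rw [mem_restrictTotalDegree] at hp ⊢
    rw [hval d p hp]
    refine totalDegree_finsetSum_le fun a _ => ?_
    exact (totalDegree_smul_le _ _).trans ((boxE_degree f hf a.1).trans a.2)
  have hfd : FiniteDimensional ℝ (restrictTotalDegree (Fin n) ℝ d) := by
    have : Finite ({ a : Fin n →₀ ℕ | (a.sum fun _ e => e) ≤ d } : Set _) := hfin d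
    exact Module.Finite.of_basis (basisRestrictSupport ℝ { a : Fin n →₀ ℕ | (a.sum fun _ e => e) ≤ d })
  have hi2 : Function.Injective (Φ.restrict hpres) := by
    intro x y hxy
    exact Subtype.ext (hinj (by simpa using congrArg Subtype.val hxy))
  obtain ⟨p, hp⟩ := LinearMap.injective_iff_surjective.1 hi2
    ⟨q, (mem_restrictTotalDegree _ _ _).2 le_rfl⟩
  exact ⟨p.1, by simpa using congrArg Subtype.val hp⟩

/-- Let `P = P₀ + ⋯ + P_m : ℝⁿ → ℝⁿ` be a polynomial map, each `P k` homogeneous of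
degree `k`, with `P_m ≠ 0` and `P_m(z) ≠ 0` for all `z ≠ 0`. If `m` is odd then `P` is
surjective. -/
theorem stmt_3 {n m : ℕ} (P : ℕ → (Fin n → ℝ) → (Fin n → ℝ))
    (hP : ∀ k ≤ m, ∀ i : Fin n, ∃ p : MvPolynomial (Fin n) ℝ, p.IsHomogeneous k ∧
      ∀ x : Fin n → ℝ, P k x i = MvPolynomial.eval x p)
    (hPm : P m ≠ 0)
    (htop : ∀ z : Fin n → ℝ, z ≠ 0 → P m z ≠ 0)
    (hodd : Odd m) :
    ∀ y : Fin n → ℝ, ∃ x : Fin n → ℝ, (∑ k ∈ Finset.range (m + 1), P k x) = y := by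
  classical
  intro y
  choose! p hp hpe using hP
  have hm0 : m ≠ 0 := hodd.pos.ne'
  -- homogeneity
  have hhom : ∀ k ≤ m, ∀ (c : ℝ) x i, P k (c • x) i = c ^ k * P k x i := by
    intro k hk c x i
    rw [hpe k hk, hpe k hk, MvPolynomial.eval_eq, MvPolynomial.eval_eq, Finset.mul_sum]
    refine Finset.sum_congr rfl fun a ha => ?_
    have : a.degree = k := by
      rw [Finsupp.degree_eq_weight_one]; exact hp k hk i (MvPolynomial.mem_support_iff.1 ha)
    rw [← this]
    simp only [Pi.smul_apply, smul_eq_mul, mul_pow, Finset.prod_mul_distrib]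
    rw [Finset.prod_pow_eq_pow_sum]
    simp only [Finsupp.degree]
    change _ * (c ^ (∑ i ∈ a.support, a i) * _) = c ^ (∑ i ∈ a.support, a i) * _
    ring
  have hcont : ∀ k ≤ m, ∀ i, Continuous fun x => P k x i := by
    intro k hk i
    simp only [hpe k hk i]
    exact MvPolynomial.continuous_eval _
  let g : Fin n → MvPolynomial (Fin n) ℝ := fun i =>
    (∑ k ∈ Finset.range (m + 1), p k i) - MvPolynomial.C (y i)
  have hg : ∀ i, (g i).totalDegree ≤ m := by
    intro i
    refine (MvPolynomial.totalDegree_sub _ _).trans (max_le ?_ (by simp))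
    refine MvPolynomial.totalDegree_finsetSum_le fun k hk => ?_
    have hk : k ≤ m := by simpa [Nat.lt_succ_iff] using hk
    exact (hp k hk i).totalDegree_le.trans hk
  have hge : ∀ i x, MvPolynomial.eval x (g i) = (∑ k ∈ Finset.range (m + 1), P k x i) - y i := by
    intro i x
    simp only [g, map_sub, map_sum, MvPolynomial.eval_C]
    congr 1
    refine Finset.sum_congr rfl fun k hk => ?_
    rw [hpe k (by simpa [Nat.lt_succ_iff] using hk)]
  obtain ⟨S, hS, hbij⟩ := generic_bij g hg
  have hex : ∀ N : ℕ, ∃ t : ℝ, (N : ℝ) + 1 < t ∧ t ∉ S := by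
    intro N
    by_contra! h
    have : Set.Ioi ((N : ℝ) + 1) ⊆ S := fun t ht => h t ht
    have h2 := hS.mono this
    rw [← Cardinal.le_aleph0_iff_set_countable, Cardinal.mk_Ioi_real] at h2
    exact absurd h2 (not_le.2 Cardinal.aleph0_lt_continuum)
  choose t htN htS using hex
  have hsol : ∀ N, ∃ x : Fin n → ℝ, ∀ i, x i ^ m + t N * ((∑ k ∈ Finset.range (m + 1), P k x i) - y i) = 0 := by
    intro N
    obtain ⟨Φ, hΦ, hb⟩ := hbij _ (htS N)
    obtain ⟨x, hx⟩ := zero_of_bij hodd _ Φ hΦ hb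
    exact ⟨x, fun i => by simpa [hge] using hx i⟩
  choose x hx using hsol
  -- projectivise
  let H : Fin n → (Fin n → ℝ) × ℝ → ℝ := fun i w =>
    (∑ k ∈ Finset.range (m + 1), w.2 ^ (m - k) * P k w.1 i) - w.2 ^ m * y i
  have hHc : ∀ i, Continuous (H i) := by
    intro i
    refine Continuous.sub (continuous_finsetSum _ fun k hk => ?_) (by fun_prop)
    have := hcont k (by simpa [Nat.lt_succ_iff] using hk) i
    exact (continuous_snd.pow _).mul (this.comp continuous_fst)
  have hHh : ∀ i (c : ℝ) w, H i (c • w) = c ^ m * H i w := by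
    intro i c w
    simp only [H, Prod.smul_fst, Prod.smul_snd, smul_eq_mul, mul_sub, Finset.mul_sum, mul_pow]
    congr 1
    · refine Finset.sum_congr rfl fun k hk => ?_
      have hk : k ≤ m := by simpa [Nat.lt_succ_iff] using hk
      rw [hhom k hk]
      have : c ^ m = c ^ (m - k) * c ^ k := by rw [← pow_add, Nat.sub_add_cancel hk]
      rw [this]; ring
    · ring
  have hH1 : ∀ i x, H i (x, 1) = (∑ k ∈ Finset.range (m + 1), P k x i) - y i := by
    intro i x; simp [H]
  let w : ℕ → (Fin n → ℝ) × ℝ := fun N => ‖((x N, 1) : (Fin n → ℝ) × ℝ)‖⁻¹ • (x N, 1)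
  have hw : ∀ N, w N ∈ Metric.sphere (0 : (Fin n → ℝ) × ℝ) 1 := by
    intro N
    have : ((x N, 1) : (Fin n → ℝ) × ℝ) ≠ 0 := fun h => by simpa using congrArg Prod.snd h
    simp only [w, mem_sphere_zero_iff_norm]
    exact norm_smul_inv_norm (𝕜 := ℝ) this
  obtain ⟨z, hz, φ, hφ, hlim⟩ := (isCompact_sphere (0 : (Fin n → ℝ) × ℝ) 1).tendsto_subseq hw
  have hHw : ∀ i N, H i (w N) = - (t N)⁻¹ * (w N).1 i ^ m := by
    intro i N
    have hpos : (0:ℝ) < t N := by have := htN N; have : (0:ℝ) ≤ N := Nat.cast_nonneg N; linarith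
    have := hx N i
    simp only [w]
    rw [hHh, hH1]
    simp only [Prod.smul_fst, Pi.smul_apply, smul_eq_mul, mul_pow]
    have h3 : (∑ k ∈ Finset.range (m + 1), P k (x N) i) - y i = - (t N)⁻¹ * x N i ^ m := by
      field_simp
      linarith
    rw [h3]; ring
  have htinv : Filter.Tendsto (fun N => (t N)⁻¹) Filter.atTop (nhds 0) := by
    refine Filter.Tendsto.inv_tendsto_atTop ?_
    refine Filter.tendsto_atTop_mono (fun N => ?_) tendsto_natCast_atTop_atTop
    linarith [htN N]
  have hHz : ∀ i, H i z = 0 := by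
    intro i
    have h1 := ((hHc i).tendsto z).comp hlim
    have h2 : Filter.Tendsto (fun N => - (t (φ N))⁻¹ * (w (φ N)).1 i ^ m) Filter.atTop
        (nhds (- 0 * z.1 i ^ m)) := by
      refine ((htinv.comp hφ.tendsto_atTop).neg).mul ?_
      have : Continuous fun v : (Fin n → ℝ) × ℝ => v.1 i ^ m := by fun_prop
      exact (this.tendsto z).comp hlim
    have h3 := tendsto_nhds_unique h1 (h2.congr fun N => (hHw i (φ N)).symm)
    simpa using h3
  by_cases hz2 : z.2 = 0
  · exfalso
    have hz1 : z.1 ≠ 0 := by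
      intro h
      have : z = 0 := Prod.ext h hz2
      rw [this] at hz
      simp at hz
    apply htop z.1 hz1
    funext i
    have := hHz i
    simp only [H, hz2] at this
    rw [Finset.sum_range_succ, Finset.sum_eq_zero] at this
    · simpa [hm0] using this
    · intro k hk
      have : m - k ≠ 0 := by have := Finset.mem_range.1 hk; omega
      simp [this]
  · refine ⟨z.2⁻¹ • z.1, ?_⟩
    funext i
    have h1 : z.2⁻¹ • z = (z.2⁻¹ • z.1, 1) := Prod.ext rfl (by simp [hz2])
    have h2 := hHh i z.2⁻¹ z
    rw [hHz i, mul_zero, h1, hH1] at h2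
    rw [Finset.sum_apply]
    linarith
end

section
/- Let P : ℝ^n → ℝ^n be a polynomial map, P = P_0 + ⋯ + P_m with each P_k homogeneous of degree k and P_m ≠ 0, and assume P_m(z) ≠ 0 for all z ≠ 0. Suppose m is even, and let y ∈ ℝ^n be such that every solution z of P(z) = y satisfies det DP(z) ≠ 0 (i.e., y ∉ P(N_P), where N_P = {z : det DP(z) = 0}). Then the solution set {x ∈ ℝ^n : P(x) = y} is finite and has even cardinality. -/
open MvPolynomial Filter Topology

/-- deformed monomials -/
noncomputable def defMon {n : ℕ} {R : Type*} [CommRing R] (m : ℕ)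
    (F : Fin n → MvPolynomial (Fin n) R) (c : Fin n →₀ ℕ) : MvPolynomial (Fin n) R :=
  ∏ i, (X i ^ (c i % m) * F i ^ (c i / m))

lemma defMon_totalDegree {n : ℕ} {R : Type*} [CommRing R] [Nontrivial R] (m : ℕ)
    (F : Fin n → MvPolynomial (Fin n) R) (hF : ∀ i, (F i).totalDegree ≤ m) (c : Fin n →₀ ℕ) :
    (defMon m F c).totalDegree ≤ c.degree := by
  unfold defMon
  refine (totalDegree_finsetProd _ _).trans ?_
  rw [Finsupp.degree_eq_sum]
  refine Finset.sum_le_sum fun i _ => ?_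
  refine (totalDegree_mul _ _).trans ?_
  have h1 : (X i ^ (c i % m) : MvPolynomial (Fin n) R).totalDegree ≤ c i % m := by
    refine (totalDegree_pow _ _).trans ?_
    rw [totalDegree_X, mul_one]
  have h2 : (F i ^ (c i / m)).totalDegree ≤ (c i / m) * m :=
    (totalDegree_pow _ _).trans (Nat.mul_le_mul_left _ (hF i))
  have := Nat.mod_add_div (c i) m
  nlinarith

lemma defMon_map {n : ℕ} {R S : Type*} [CommRing R] [CommRing S] (f : R →+* S) (m : ℕ)
    (F : Fin n → MvPolynomial (Fin n) R) (c : Fin n →₀ ℕ) :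
    map f (defMon m F c) = defMon m (fun i => map f (F i)) c := by
  simp [defMon, map_prod]

lemma defMon_X {n : ℕ} {R : Type*} [CommRing R] (m : ℕ) (c : Fin n →₀ ℕ) :
    defMon m (fun i => (X i ^ m : MvPolynomial (Fin n) R)) c = monomial c 1 := by
  rw [monomial_eq, C_1, one_mul, Finsupp.prod_fintype _ _ (by simp)]
  unfold defMon
  refine Finset.prod_congr rfl fun i _ => ?_
  rw [← pow_mul, ← pow_add, Nat.mod_add_div]

lemma defMon_add {n : ℕ} {R : Type*} [CommRing R] (m : ℕ) (hm : 0 < m)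
    (F : Fin n → MvPolynomial (Fin n) R) (c : Fin n →₀ ℕ) (i : Fin n) :
    defMon m F (c + Finsupp.single i m) = F i * defMon m F c := by
  unfold defMon
  rw [← Finset.mul_prod_erase _ _ (Finset.mem_univ i), ← Finset.mul_prod_erase Finset.univ
    (fun j => X j ^ (c j % m) * F j ^ (c j / m)) (Finset.mem_univ i)]
  have : ∏ j ∈ Finset.univ.erase i, (X j ^ ((c + Finsupp.single i m) j % m) *
      F j ^ ((c + Finsupp.single i m) j / m)) =
      ∏ j ∈ Finset.univ.erase i, (X j ^ (c j % m) * F j ^ (c j / m)) := by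
    refine Finset.prod_congr rfl fun j hj => ?_
    have : i ≠ j := (Finset.ne_of_mem_erase hj).symm
    simp [Finsupp.single_eq_of_ne' this]
  rw [this]
  simp [Nat.add_div_right _ hm, pow_succ]
  ring

abbrev lowIdx (n N : ℕ) := {c : Fin n →₀ ℕ // c.degree ≤ N}

lemma lowIdx_finite (n N : ℕ) : Finite (lowIdx n N) := by
  have : Set.Finite {c : Fin n →₀ ℕ | c.degree ≤ N} := by
    refine Set.Finite.subset (Set.finite_Iic (Finsupp.equivFunOnFinite.symm fun _ : Fin n => N)) ?_
    intro c hc i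
    exact (Finsupp.le_degree i c).trans hc
  exact this

noncomputable instance (n N : ℕ) : Fintype (lowIdx n N) :=
  @Fintype.ofFinite _ (lowIdx_finite n N)

/-- coefficient matrix -/
noncomputable def cmat {n : ℕ} {R : Type*} [CommRing R] (m N : ℕ)
    (F : Fin n → MvPolynomial (Fin n) R) : Matrix (lowIdx n N) (lowIdx n N) R :=
  fun c c' => coeff c'.1 (defMon m F c.1)

lemma countable_bad {n m : ℕ} (q : Fin n → MvPolynomial (Fin n) ℝ) :
    {d : ℝ | ∃ N, (cmat m N (fun i => X i ^ m + C d * q i)).det = 0}.Countable := by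
  let G : Fin n → MvPolynomial (Fin n) (Polynomial ℝ) :=
    fun i => X i ^ m + C Polynomial.X * map Polynomial.C (q i)
  have hG : ∀ d : ℝ, (fun i => map (Polynomial.evalRingHom d) (G i)) =
      fun i => X i ^ m + C d * q i := by
    intro d
    funext i
    simp only [G, map_add, map_mul, map_pow, map_X, map_C, MvPolynomial.map_map]
    have : (Polynomial.evalRingHom d).comp Polynomial.C = RingHom.id ℝ := by ext; simp
    rw [this, MvPolynomial.map_id]
    simp
  have hdet : ∀ N (d : ℝ), (cmat m N (fun i => X i ^ m + C d * q i)).det =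
      ((cmat m N G).det).eval d := by
    intro N d
    rw [← Polynomial.coe_evalRingHom, RingHom.map_det]
    congr 1
    ext c c'
    simp only [cmat, ← hG d, ← defMon_map, coeff_map, RingHom.mapMatrix_apply, Matrix.map_apply]
  have hne : ∀ N, (cmat m N G).det ≠ 0 := by
    intro N h
    have h0 := hdet N 0
    rw [h] at h0
    have : cmat m N (fun i => X i ^ m + C (0:ℝ) * q i) = 1 := by
      ext c c'
      simp only [cmat, map_zero, zero_mul, add_zero, defMon_X, coeff_monomial, Matrix.one_apply,
        Subtype.ext_iff]
    rw [this] at h0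
    simp at h0
  have : {d : ℝ | ∃ N, (cmat m N (fun i => X i ^ m + C d * q i)).det = 0} =
      ⋃ N, {d | ((cmat m N G).det).IsRoot d} := by
    ext d
    simp [hdet, Polynomial.IsRoot]
  rw [this]
  exact Set.countable_iUnion fun N => (Polynomial.finite_setOfPred_isRoot (hne N)).countable

lemma defMon_span {n m : ℕ} (F : Fin n → MvPolynomial (Fin n) ℝ)
    (hF : ∀ i, (F i).totalDegree ≤ m) (h : ∀ N, (cmat m N F).det ≠ 0) :
    Submodule.span ℝ (Set.range (defMon m F)) = ⊤ := by
  rw [eq_top_iff, ← (basisMonomials (Fin n) ℝ).span_eq, Submodule.span_le]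
  rintro _ ⟨c, rfl⟩
  let N := c.degree
  let c0 : lowIdx n N := ⟨c, le_rfl⟩
  have key : (monomial c 1 : MvPolynomial (Fin n) ℝ) =
      ∑ a : lowIdx n N, (cmat m N F)⁻¹ c0 a • defMon m F a.1 := by
    ext b
    rw [coeff_sum]
    simp only [coeff_smul, coeff_monomial]
    by_cases hb : b.degree ≤ N
    · have h1 : ((cmat m N F)⁻¹ * cmat m N F) c0 ⟨b, hb⟩ = (1 : Matrix (lowIdx n N) (lowIdx n N) ℝ) c0 ⟨b, hb⟩ := by
        rw [Matrix.nonsing_inv_mul _ (isUnit_iff_ne_zero.mpr (h N))]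
      rw [Matrix.mul_apply, Matrix.one_apply] at h1
      simp only [c0, Subtype.mk.injEq] at h1
      exact h1.symm
    · rw [if_neg (by rintro rfl; exact hb le_rfl), Finset.sum_eq_zero]
      intro a _
      rw [coeff_eq_zero_of_totalDegree_lt, smul_zero]
      refine lt_of_le_of_lt ((defMon_totalDegree m F hF _).trans a.2) ?_
      rw [Finsupp.degree] at hb
      exact not_le.mp hb
  simp only [coe_basisMonomials]
  rw [key]
  exact Submodule.sum_mem _ fun a _ => Submodule.smul_mem _ _ (Submodule.subset_span ⟨_, rfl⟩)

lemma defMon_indep {n m : ℕ} (F : Fin n → MvPolynomial (Fin n) ℝ)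
    (h : ∀ N, (cmat m N F).det ≠ 0) :
    LinearIndependent ℝ (defMon m F) := by
  rw [linearIndependent_iff']
  intro s g hg i hi
  let N := s.sup Finsupp.degree
  have hs : ∀ c ∈ s, c.degree ≤ N := fun c hc => Finset.le_sup (f := Finsupp.degree) hc
  classical
  let v : lowIdx n N → ℝ := fun c => if c.1 ∈ s then g c.1 else 0
  have hv : Matrix.vecMul v (cmat m N F) = 0 := by
    ext b
    have := congrArg (coeff b.1) hg
    rw [coeff_sum] at this
    simp only [coeff_smul, coeff_zero] at this
    rw [Pi.zero_apply, ← this]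
    simp only [Matrix.vecMul, dotProduct, cmat, v]
    symm
    refine Finset.sum_bij_ne_zero (fun c hc _ => (⟨c, hs c hc⟩ : lowIdx n N)) (by simp)
      ?_ ?_ ?_
    · intro a _ _ b _ _ hab
      simpa using hab
    · rintro ⟨b', hb'⟩ _ hne
      by_cases hb's : b' ∈ s
      · exact ⟨b', hb's, by simpa [hb's] using hne, rfl⟩
      · simp [hb's] at hne
    · intro a ha _
      simp [ha]
  have := Matrix.eq_zero_of_vecMul_eq_zero (h N) hv
  have := congrFun this ⟨i, hs i hi⟩
  simpa [v, hi] using this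

lemma ideal_eq {n m : ℕ} (hm : 0 < m) (F : Fin n → MvPolynomial (Fin n) ℝ)
    (hsp : Submodule.span ℝ (Set.range (defMon m F)) = ⊤) :
    (Ideal.span (Set.range F)).restrictScalars ℝ =
      Submodule.span ℝ (defMon m F '' {c | ∀ i, c i < m}ᶜ) := by
  apply le_antisymm
  · intro f hf
    rw [Submodule.restrictScalars_mem] at hf
    obtain ⟨g, rfl⟩ := (Ideal.mem_span_range_iff_exists_fun).1 hf
    refine Submodule.sum_mem _ fun i _ => ?_
    have hgi : g i ∈ Submodule.span ℝ (Set.range (defMon m F)) := by rw [hsp]; trivial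
    generalize g i = gi at hgi
    induction hgi using Submodule.span_induction with
    | mem x hx =>
      obtain ⟨c, rfl⟩ := hx
      rw [mul_comm, ← defMon_add m hm]
      refine Submodule.subset_span ⟨_, ?_, rfl⟩
      simp only [Set.mem_compl_iff, Set.mem_ofPred_eq, not_forall, not_lt]
      exact ⟨i, by simp⟩
    | zero => simp
    | add x y _ _ hx hy => rw [add_mul]; exact Submodule.add_mem _ hx hy
    | smul a x _ hx => rw [smul_mul_assoc]; exact Submodule.smul_mem _ _ hx
  · rw [Submodule.span_le]
    rintro _ ⟨c, hc, rfl⟩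
    simp only [Set.mem_compl_iff, Set.mem_ofPred_eq, not_forall, not_lt] at hc
    obtain ⟨i, hi⟩ := hc
    have : c = (c - Finsupp.single i m) + Finsupp.single i m := by
      rw [tsub_add_cancel_of_le]
      simpa using hi
    rw [this, defMon_add m hm]
    exact Ideal.mul_mem_right _ _ (Ideal.subset_span ⟨i, rfl⟩)

lemma quot_dim {n m : ℕ} (hm : 0 < m) (F : Fin n → MvPolynomial (Fin n) ℝ)
    (hF : ∀ i, (F i).totalDegree ≤ m) (h : ∀ N, (cmat m N F).det ≠ 0) :
    Module.Finite ℝ (MvPolynomial (Fin n) ℝ ⧸ Ideal.span (Set.range F)) ∧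
    Module.finrank ℝ (MvPolynomial (Fin n) ℝ ⧸ Ideal.span (Set.range F)) = m ^ n := by
  have hsp := defMon_span F hF h
  have hli := defMon_indep F h
  have hI := ideal_eq hm F hsp
  let B : Set (Fin n →₀ ℕ) := {c | ∀ i, c i < m}
  let W := Submodule.span ℝ (defMon m F '' B)
  have hc : IsCompl ((Ideal.span (Set.range F)).restrictScalars ℝ) W := by
    rw [hI]
    constructor
    · exact hli.disjoint_span_image (by exact disjoint_compl_left)
    · rw [codisjoint_iff, ← Submodule.span_union, ← Set.image_union]
      simp only [B, Set.compl_union_self, Set.image_univ, hsp]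
  let eB : B ≃ (Fin n → Fin m) :=
    { toFun := fun c i => ⟨c.1 i, c.2 i⟩
      invFun := fun f => ⟨Finsupp.equivFunOnFinite.symm fun i => (f i : ℕ), fun i => by simp⟩
      left_inv := fun c => by ext; simp
      right_inv := fun f => by ext; simp }
  have : Fintype B := Fintype.ofEquiv _ eB.symm
  have hfinB : (defMon m F '' B).Finite := Set.toFinite _
  have hWf : Module.Finite ℝ W := Module.Finite.span_of_finite ℝ hfinB
  have hW : Module.finrank ℝ W = m ^ n := by
    have hli' : LinearIndependent ℝ (fun c : B => defMon m F c.1) :=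
      hli.comp _ Subtype.val_injective
    have := finrank_span_eq_card hli'
    rw [Set.range_comp' , Subtype.range_coe] at this
    rw [this, Fintype.card_congr eB]
    simp
  let e := Submodule.quotientEquivOfIsCompl _ W hc
  let e' : (MvPolynomial (Fin n) ℝ ⧸ Ideal.span (Set.range F)) ≃ₗ[ℝ] W := e
  exact ⟨Module.Finite.equiv e'.symm, e'.finrank_eq.trans hW⟩

lemma even_finrank_of_no_real {A : Type*} [CommRing A] [Algebra ℝ A] (d : ℕ) :
    ∀ (M : Type) [AddCommGroup M] [Module A M] [Module ℝ M] [IsScalarTower ℝ A M]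
    [Module.Finite ℝ M]
    (_ : ∀ χ : A →ₐ[ℝ] ℝ, ∃ a, χ a ≠ 0 ∧ ∀ x : M, a • x = 0)
    (_ : Module.finrank ℝ M = d), Even d := by
  induction d using Nat.strong_induction_on with
  | _ d ih =>
  intro M _ _ _ _ _ H hd
  rcases subsingleton_or_nontrivial M with hM | hM
  · rw [Module.finrank_zero_of_subsingleton] at hd
    simp [← hd]
  have : IsArtinian A M := isArtinian_of_tower ℝ inferInstance
  obtain ⟨S, hS⟩ := IsAtomic.exists_atom (Submodule A M)
  rw [← isSimpleModule_iff_isAtom] at hS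
  obtain ⟨I, hI, ⟨e⟩⟩ := isSimpleModule_iff_quot_maximal.1 hS
  let S' := S.restrictScalars ℝ
  have hfin : Module.Finite ℝ S := inferInstanceAs (Module.Finite ℝ S')
  let e' : S ≃ₗ[ℝ] (A ⧸ I) := e.restrictScalars ℝ
  have hfin2 : Module.Finite ℝ (A ⧸ I) := Module.Finite.equiv e'
  let _ : Field (A ⧸ I) := Ideal.Quotient.field I
  have hS2 : Module.finrank ℝ S = 2 := by
    rw [e'.finrank_eq]
    have halg : Algebra.IsAlgebraic ℝ (A ⧸ I) := Algebra.IsAlgebraic.of_finite ℝ _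
    rcases Real.nonempty_algEquiv_or (A ⧸ I) with hf | hf <;> obtain ⟨f⟩ := hf
    · exfalso
      let χ : A →ₐ[ℝ] ℝ := (f : (A ⧸ I) →ₐ[ℝ] ℝ).comp (Ideal.Quotient.mkₐ ℝ I)
      obtain ⟨a, ha, ha'⟩ := H χ
      apply ha
      have h1 : a • (e.symm 1) = 0 := Subtype.ext (ha' _)
      rw [← map_smul, LinearEquiv.map_eq_zero_iff] at h1
      have h2 : (Ideal.Quotient.mk I a) = 0 := by
        rw [← h1, Algebra.smul_def, mul_one]; rfl
      change f (Ideal.Quotient.mk I a) = 0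
      rw [h2, map_zero]
    · rw [f.toLinearEquiv.finrank_eq, Complex.finrank_real_complex]
  let eq := Submodule.Quotient.restrictScalarsEquiv ℝ S
  have hfin3 : Module.Finite ℝ (M ⧸ S) := Module.Finite.equiv eq
  have hsum : Module.finrank ℝ (M ⧸ S) + 2 = d := by
    rw [← hd, ← Submodule.finrank_quotient_add_finrank S', ← eq.finrank_eq, ← hS2]
    rfl
  have := ih (Module.finrank ℝ (M ⧸ S)) (by omega) (M ⧸ S) (by
    intro χ
    obtain ⟨a, ha, ha'⟩ := H χ
    refine ⟨a, ha, fun x => ?_⟩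
    obtain ⟨x, rfl⟩ := Submodule.Quotient.mk_surjective _ x
    rw [← Submodule.Quotient.mk_smul, ha', Submodule.Quotient.mk_zero]) rfl
  rw [← hsum]
  exact this.add (by decide)

/-- the vanishing ideal of a point -/
noncomputable def ptIdeal {n : ℕ} (z : Fin n → ℝ) : Ideal (MvPolynomial (Fin n) ℝ) :=
  Ideal.span (Set.range fun j => X j - C (z j))

lemma taylor_mem {n : ℕ} (z : Fin n → ℝ) (f : MvPolynomial (Fin n) ℝ) :
    f - C (eval z f) - ∑ j, C (eval z (pderiv j f)) * (X j - C (z j)) ∈ ptIdeal z ^ 2 := by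
  have hx : ∀ j, (X j - C (z j)) ∈ ptIdeal z := fun j => Ideal.subset_span ⟨j, rfl⟩
  induction f using MvPolynomial.induction_on with
  | C a => simp
  | add p q hp hq =>
    convert Ideal.add_mem _ hp hq using 1
    simp only [map_add, add_mul, Finset.sum_add_distrib]
    ring
  | mul_X p i hp =>
    have h1 : ∑ j, C (eval z (pderiv j (p * X i))) * (X j - C (z j)) =
        C (z i) * (∑ j, C (eval z (pderiv j p)) * (X j - C (z j))) +
          C (eval z p) * (X i - C (z i)) := by
      simp only [Derivation.leibniz, pderiv_X, smul_eq_mul, map_add, map_mul, add_mul,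
        Finset.sum_add_distrib, eval_X, Finset.mul_sum]
      rw [add_comm]
      congr 1
      · exact Finset.sum_congr rfl fun j _ => by ring
      · rw [Finset.sum_eq_single i]
        · simp
        · intro j _ hj
          simp [hj.symm]
        · simp
    have h2 : (∑ j, C (eval z (pderiv j p)) * (X j - C (z j))) * (X i - C (z i)) ∈
        ptIdeal z ^ 2 := by
      rw [pow_two]
      exact Ideal.mul_mem_mul (Ideal.sum_mem _ fun j _ => Ideal.mul_mem_left _ _ (hx j)) (hx i)
    convert Ideal.add_mem _ (Ideal.mul_mem_right (X i) _ hp) h2 using 1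
    rw [h1]
    simp only [map_mul, eval_X]
    ring

lemma mem_ptIdeal {n : ℕ} (z : Fin n → ℝ) (f : MvPolynomial (Fin n) ℝ) :
    f ∈ ptIdeal z ↔ eval z f = 0 := by
  constructor
  · intro hf
    have : ptIdeal z ≤ RingHom.ker (eval z) := by
      rw [ptIdeal, Ideal.span_le]
      rintro _ ⟨j, rfl⟩
      simp [RingHom.mem_ker]
    exact this hf
  · intro hf
    have h := Ideal.pow_le_self two_ne_zero (taylor_mem z f)
    rw [hf, C_0, sub_zero] at h
    have h2 : ∑ j, C (eval z (pderiv j f)) * (X j - C (z j)) ∈ ptIdeal z :=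
      Ideal.sum_mem _ fun j _ => Ideal.mul_mem_left _ _ (Ideal.subset_span ⟨j, rfl⟩)
    simpa using Ideal.add_mem _ h h2

/-- the Jacobian matrix -/
noncomputable def jac {n : ℕ} (F : Fin n → MvPolynomial (Fin n) ℝ) (z : Fin n → ℝ) :
    Matrix (Fin n) (Fin n) ℝ := fun i j => eval z (pderiv j (F i))

lemma ptIdeal_le {n : ℕ} (F : Fin n → MvPolynomial (Fin n) ℝ) (z : Fin n → ℝ)
    (hz : ∀ i, eval z (F i) = 0) (hdet : (jac F z).det ≠ 0) :
    ptIdeal z ≤ ptIdeal z ^ 2 ⊔ Ideal.span (Set.range F) := by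
  have h1 : ∀ i, ∑ j, C (jac F z i j) * (X j - C (z j)) ∈
      ptIdeal z ^ 2 ⊔ Ideal.span (Set.range F) := by
    intro i
    have h := Ideal.mem_sup_left (T := Ideal.span (Set.range F)) (taylor_mem z (F i))
    rw [hz i, C_0, sub_zero] at h
    have h' : F i ∈ ptIdeal z ^ 2 ⊔ Ideal.span (Set.range F) :=
      Ideal.mem_sup_right (Ideal.subset_span ⟨i, rfl⟩)
    simpa [jac] using Ideal.sub_mem _ h' h
  conv_lhs => rw [ptIdeal]
  rw [Ideal.span_le]
  rintro _ ⟨k, rfl⟩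
  have h2 : ∑ i, C ((jac F z)⁻¹ k i) * ∑ j, C (jac F z i j) * (X j - C (z j)) ∈
      ptIdeal z ^ 2 ⊔ Ideal.span (Set.range F) :=
    Ideal.sum_mem _ fun i _ => Ideal.mul_mem_left _ _ (h1 i)
  convert h2 using 1
  simp only [Finset.mul_sum]
  rw [Finset.sum_comm]
  have h3 : ∀ j, ∑ i, C ((jac F z)⁻¹ k i) * (C (jac F z i j) * (X j - C (z j))) =
      C ((1 : Matrix (Fin n) (Fin n) ℝ) k j) * (X j - C (z j)) := by
    intro j
    rw [← Matrix.nonsing_inv_mul _ (isUnit_iff_ne_zero.mpr hdet), Matrix.mul_apply, map_sum,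
      Finset.sum_mul]
    exact Finset.sum_congr rfl fun i _ => by rw [map_mul]; ring
  simp_rw [h3, Matrix.one_apply]
  simp

lemma even_of_even_finrank {n : ℕ} (F : Fin n → MvPolynomial (Fin n) ℝ)
    (hfin : Module.Finite ℝ (MvPolynomial (Fin n) ℝ ⧸ Ideal.span (Set.range F)))
    (hev : Even (Module.finrank ℝ (MvPolynomial (Fin n) ℝ ⧸ Ideal.span (Set.range F))))
    (Z : Finset (Fin n → ℝ)) (hZ : ∀ z, z ∈ Z ↔ ∀ i, eval z (F i) = 0)
    (hdet : ∀ z ∈ Z, (jac F z).det ≠ 0) : Even Z.card := by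
  set I := Ideal.span (Set.range F) with hI
  let A := MvPolynomial (Fin n) ℝ ⧸ I
  have : IsNoetherianRing A := inferInstance
  let ev : ∀ z : Z, A →ₐ[ℝ] ℝ := fun z => Ideal.Quotient.liftₐ I (aeval z.1) (by
    intro a ha
    have : I ≤ RingHom.ker (aeval z.1 : MvPolynomial (Fin n) ℝ →ₐ[ℝ] ℝ) := by
      rw [hI, Ideal.span_le]
      rintro _ ⟨i, rfl⟩
      have := (hZ z.1).1 z.2 i
      simpa [RingHom.mem_ker, coe_aeval_eq_eval] using this
    exact this ha)
  have hev_mk : ∀ z f, ev z (Ideal.Quotient.mk I f) = eval z.1 f := by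
    intro z f
    change (aeval z.1) f = _
    rw [aeval_eq_eval]
  let 𝔪 : Z → Ideal A := fun z => RingHom.ker (ev z)
  have hmap : ∀ z, 𝔪 z = (ptIdeal z.1).map (Ideal.Quotient.mk I) := by
    intro z
    ext a
    obtain ⟨f, rfl⟩ := Ideal.Quotient.mk_surjective a
    constructor
    · intro h
      refine Ideal.mem_map_of_mem _ ((mem_ptIdeal _ _).2 ?_)
      rw [← hev_mk]; exact h
    · intro h
      have : (ptIdeal z.1).map (Ideal.Quotient.mk I) ≤ 𝔪 z := by
        rw [Ideal.map_le_iff_le_comap]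
        intro g hg
        change ev z _ = 0
        rw [hev_mk]
        exact (mem_ptIdeal _ _).1 hg
      exact this h
  have hidem : ∀ z, 𝔪 z * 𝔪 z = 𝔪 z := by
    intro z
    apply le_antisymm Ideal.mul_le_left
    rw [hmap, ← Ideal.map_mul, ← pow_two]
    have := Ideal.map_mono (f := Ideal.Quotient.mk I)
      (ptIdeal_le F z.1 ((hZ _).1 z.2) (hdet _ z.2))
    rw [Ideal.map_sup, ← hI, Ideal.map_quotient_self, sup_bot_eq] at this
    exact this
  have hcop : Pairwise (Function.onFun IsCoprime 𝔪) := by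
    intro z w hzw
    have hne : z.1 ≠ w.1 := fun h => hzw (Subtype.ext h)
    obtain ⟨i, hi⟩ := Function.ne_iff.1 hne
    rw [Function.onFun, Ideal.isCoprime_iff_exists]
    have hd : z.1 i - w.1 i ≠ 0 := sub_ne_zero.2 hi
    refine ⟨Ideal.Quotient.mk I (C (z.1 i - w.1 i)⁻¹ * (C (z.1 i) - X i)), ?_,
      Ideal.Quotient.mk I (C (z.1 i - w.1 i)⁻¹ * (X i - C (w.1 i))), ?_, ?_⟩
    · change ev z _ = 0
      rw [hev_mk]; simp
    · change ev w _ = 0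
      rw [hev_mk]; simp
    · rw [← map_add, ← mul_add]
      have : C (z.1 i) - X i + (X i - C (w.1 i)) =
        (C (z.1 i - w.1 i) : MvPolynomial (Fin n) ℝ) := by rw [C_sub]; ring
      rw [this, ← C_mul, inv_mul_cancel₀ hd, C_1, map_one]
  let J : Ideal A := ∏ z, 𝔪 z
  have hJ : J = ⨅ z, 𝔪 z := by
    have := Ideal.prod_eq_iInf_of_pairwise_isCoprime (s := Finset.univ) (J := 𝔪)
      (fun a _ b _ hab => hcop hab)
    simpa [J] using this
  have hJJ : IsIdempotentElem J := by
    change J * J = J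
    simp only [J, ← Finset.prod_mul_distrib, hidem]
  obtain ⟨e, he, heJ⟩ := (Ideal.isIdempotentElem_iff_of_fg J (IsNoetherian.noetherian J)).1 hJJ
  let Jr : Submodule ℝ A := J.restrictScalars ℝ
  have hJfin : Module.Finite ℝ J := inferInstanceAs (Module.Finite ℝ Jr)
  have hJeven : Even (Module.finrank ℝ J) := by
    refine even_finrank_of_no_real (A := A) _ J ?_ rfl
    intro χ
    refine ⟨1 - e, ?_, ?_⟩
    · let z : Fin n → ℝ := fun i => χ (Ideal.Quotient.mk I (X i))
      have hχ : ∀ f, χ (Ideal.Quotient.mk I f) = eval z f := by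
        intro f
        have : χ.comp (Ideal.Quotient.mkₐ ℝ I) = aeval z := by
          ext i
          simp only [AlgHom.comp_apply, aeval_X, z]
          rfl
        have := DFunLike.congr_fun this f
        rw [aeval_eq_eval] at this
        exact this
      have hz : z ∈ Z := by
        rw [hZ]
        intro i
        rw [← hχ, Ideal.Quotient.eq_zero_iff_mem.2 (hI ▸ Ideal.subset_span (Set.mem_range_self i)),
          map_zero]
      have heJ' : e ∈ 𝔪 ⟨z, hz⟩ := by
        have : e ∈ J := by rw [heJ]; exact Submodule.mem_span_singleton_self e
        rw [hJ] at this
        exact (Ideal.mem_iInf.1 this) _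
      have : χ e = 0 := by
        obtain ⟨f, rfl⟩ := Ideal.Quotient.mk_surjective e
        rw [hχ]
        have := heJ'
        change ev _ _ = 0 at this
        rwa [hev_mk] at this
      simp [this]
    · rintro ⟨x, hx⟩
      rw [heJ] at hx
      obtain ⟨a, rfl⟩ := Submodule.mem_span_singleton.1 hx
      apply Subtype.ext
      change (1 - e) * (a * e) = 0
      have : e * e = e := he
      linear_combination -a * this
  let T : A →ₗ[ℝ] (Z → ℝ) := LinearMap.pi fun z => (ev z).toLinearMap
  have hTker : LinearMap.ker T = Jr := by
    ext a
    rw [LinearMap.mem_ker]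
    change _ ↔ a ∈ J
    rw [hJ, Ideal.mem_iInf, _root_.funext_iff]
    rfl
  have hTsurj : LinearMap.range T = ⊤ := by
    rw [LinearMap.range_eq_top]
    intro v
    obtain ⟨r, hr⟩ := Ideal.exists_forall_sub_mem_ideal hcop
      (fun z => algebraMap ℝ A (v z))
    refine ⟨r, funext fun z => ?_⟩
    have := hr z
    change ev z _ = 0 at this
    rw [map_sub, AlgHom.commutes, sub_eq_zero] at this
    exact this
  have hrn := LinearMap.finrank_range_add_finrank_ker T
  rw [hTker, hTsurj, finrank_top, Module.finrank_fintype_fun_eq_card, Fintype.card_coe] at hrn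
  have hJeven' : Even (Module.finrank ℝ Jr) := hJeven
  rw [← hrn] at hev
  exact (Nat.even_add.1 hev).2 hJeven'

lemma perturb {E : Type*} [NormedAddCommGroup E] [NormedSpace ℝ E] [FiniteDimensional ℝ E]
    (H : ℝ × E → E) (H' : ℝ × E → (ℝ × E →L[ℝ] E)) (hH : ∀ v, HasStrictFDerivAt H (H' v) v)
    (R : ℝ) (hR : ∀ᶠ t in 𝓝 (0:ℝ), ∀ x, H (t, x) = 0 → ‖x‖ ≤ R)
    (g : ℝ × E → ℝ) (hg : Continuous g) (hg0 : ∀ z, H (0, z) = 0 → g (0, z) ≠ 0)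
    (hinv : ∀ z, H (0, z) = 0 → (H' (0, z) ∘L .inr ℝ ℝ E).IsInvertible) :
    {x | H (0, x) = 0}.Finite ∧ ∀ᶠ t in 𝓝 (0:ℝ), {x | H (t, x) = 0}.Finite ∧
      {x | H (t, x) = 0}.ncard = {x | H (0, x) = 0}.ncard ∧
      ∀ x, H (t, x) = 0 → g (t, x) ≠ 0 := by
  have : CompleteSpace E := FiniteDimensional.complete ℝ E
  have : ProperSpace E := FiniteDimensional.proper ℝ E
  have hcont : Continuous H := continuous_iff_continuousAt.2 fun v => (hH v).continuousAt
  set Z := {x | H (0, x) = 0} with hZ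
  have hex : ∀ z ∈ Z, ∃ ψ : ℝ → E, Tendsto ψ (𝓝 0) (𝓝 z) ∧
      (∀ᶠ t in 𝓝 (0:ℝ), H (t, ψ t) = 0) ∧ ∀ᶠ v in 𝓝 ((0:ℝ), z), H v = 0 ↔ ψ v.1 = v.2 := by
    intro z hz
    have hz' : H (0, z) = 0 := hz
    have h1 := (hH (0, z)).tendsto_implicitFunctionOfProdDomain (hinv z hz)
    have h2 := (hH (0, z)).eventually_apply_implicitFunctionOfProdDomain (hinv z hz)
    have h3 := (hH (0, z)).eventually_apply_eq_iff_implicitFunctionOfProdDomain (hinv z hz)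
    rw [hz'] at h2 h3
    exact ⟨_, h1, h2, h3⟩
  choose! ψ hψ1 hψ2 hψ3 using hex
  have hZcl : IsClosed Z := isClosed_eq (by fun_prop) continuous_const
  have hZc : IsCompact Z := by
    refine (isCompact_closedBall (0:E) R).of_isClosed_subset hZcl ?_
    intro x hx
    rw [mem_closedBall_zero_iff]
    exact hR.self_of_nhds x hx
  have hZfin : Z.Finite := by
    obtain ⟨t, _, ht⟩ := hZc.elim_nhds_subcover (fun x => {w | H (0, w) = 0 → w = x}) (by
      intro x hx
      have h0 : ψ x 0 = x := (hψ3 x hx).self_of_nhds.1 hx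
      have hc : Tendsto (fun w : E => ((0:ℝ), w)) (𝓝 x) (𝓝 ((0:ℝ), x)) :=
        (Continuous.prodMk_right (0:ℝ)).tendsto x
      filter_upwards [hc.eventually (hψ3 x hx)] with w hw h
      rw [← hw.1 h, h0])
    refine t.finite_toSet.subset fun x hx => ?_
    have := ht hx
    simp only [Set.mem_iUnion] at this
    obtain ⟨z, hz, h⟩ := this
    have hxz : x = z := h hx
    rw [hxz]
    exact hz
  refine ⟨hZfin, ?_⟩
  have hA : ∀ᶠ t in 𝓝 (0:ℝ), ∀ x ∈ Metric.closedBall (0:E) R, H (t, x) = 0 →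
      ∃ z ∈ Z, ψ z t = x := by
    refine (isCompact_closedBall (0:E) R).eventually_forall_of_forall_eventually ?_
    intro x _
    by_cases hx : H (0, x) = 0
    · filter_upwards [hψ3 x hx] with v hv h0
      exact ⟨x, hx, hv.1 h0⟩
    · filter_upwards [hcont.continuousAt.eventually_ne hx] with v hv h0
      exact absurd h0 hv
  have hG : ∀ᶠ t in 𝓝 (0:ℝ), ∀ x ∈ Metric.closedBall (0:E) R, H (t, x) = 0 → g (t, x) ≠ 0 := by
    refine (isCompact_closedBall (0:E) R).eventually_forall_of_forall_eventually ?_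
    intro x _
    by_cases hx : H (0, x) = 0
    · filter_upwards [hg.continuousAt.eventually_ne (hg0 x hx)] with v hv h0
      exact hv
    · filter_upwards [hcont.continuousAt.eventually_ne hx] with v hv h0
      exact absurd h0 hv
  have hB : ∀ᶠ t in 𝓝 (0:ℝ), ∀ z ∈ Z, H (t, ψ z t) = 0 :=
    (Filter.eventually_all_finite hZfin).2 hψ2
  have hC : ∀ᶠ t in 𝓝 (0:ℝ), ∀ z ∈ Z, ∀ w ∈ Z, z ≠ w → ψ z t ≠ ψ w t := by
    refine (Filter.eventually_all_finite hZfin).2 fun z hz =>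
      (Filter.eventually_all_finite hZfin).2 fun w hw => ?_
    by_cases hzw : z = w
    · simp [hzw]
    · filter_upwards [((hψ1 z hz).prodMk_nhds (hψ1 w hw)).eventually
        ((isOpen_ne_fun continuous_fst continuous_snd).mem_nhds hzw)] with t ht _ using ht
  filter_upwards [hA, hB, hC, hR, hG] with t h1 h2 h3 h4 h5
  have heq : {x | H (t, x) = 0} = (fun z => ψ z t) '' Z := by
    ext x
    constructor
    · intro hx
      exact h1 x (mem_closedBall_zero_iff.2 (h4 x hx)) hx
    · rintro ⟨z, hz, rfl⟩
      exact h2 z hz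
  rw [heq]
  refine ⟨hZfin.image _, Set.InjOn.ncard_image ?_,
    fun x hx => h5 x (mem_closedBall_zero_iff.2 (h4 x hx)) hx⟩
  intro z hz w hw h
  by_contra hne
  exact h3 z hz w hw hne h

lemma hasStrictFDerivAt_eval {n : ℕ} (p : MvPolynomial (Fin n) ℝ) (z : Fin n → ℝ) :
    HasStrictFDerivAt (fun x : Fin n → ℝ => eval x p)
      (∑ j, eval z (pderiv j p) • ContinuousLinearMap.proj (R := ℝ) (φ := fun _ : Fin n => ℝ) j)
      z := by
  induction p using MvPolynomial.induction_on with
  | C a => simpa using hasStrictFDerivAt_const a z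
  | add p q hp hq =>
    simp only [map_add, add_smul, Finset.sum_add_distrib]
    exact hp.add hq
  | mul_X p i hp =>
    have hX : HasStrictFDerivAt (fun x : Fin n → ℝ => x i)
      (ContinuousLinearMap.proj (R := ℝ) (φ := fun _ : Fin n => ℝ) i) z :=
      (ContinuousLinearMap.proj (R := ℝ) (φ := fun _ : Fin n => ℝ) i).hasStrictFDerivAt
    have h := hp.mul hX
    simp only [map_mul, eval_X]
    refine h.congr_fderiv ?_
    ext v
    simp [pderiv_X, Pi.single_apply, add_mul, Finset.sum_add_distrib, Finset.mul_sum,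
      apply_ite (eval z), ite_mul, mul_ite]
    exact Finset.sum_congr rfl fun j _ => by ring

lemma hom_eval_smul {n k : ℕ} {p : MvPolynomial (Fin n) ℝ} (hp : p.IsHomogeneous k) (s : ℝ)
    (x : Fin n → ℝ) : eval (s • x) p = s ^ k * eval x p := by
  rw [eval_eq', eval_eq', Finset.mul_sum]
  refine Finset.sum_congr rfl fun d hd => ?_
  have hdk : d.degree = k := by
    have := hp (mem_support_iff.1 hd)
    rw [Finsupp.degree_eq_weight_one]
    exact this
  simp only [Pi.smul_apply, smul_eq_mul, mul_pow, Finset.prod_mul_distrib]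
  rw [Finset.prod_pow_eq_pow_sum, ← Finsupp.degree_eq_sum, hdk]
  ring

lemma hasStrictFDerivAt_jac {n : ℕ} (F : Fin n → MvPolynomial (Fin n) ℝ) (z : Fin n → ℝ) :
    HasStrictFDerivAt (fun (x : Fin n → ℝ) (i : Fin n) => eval x (F i))
      (LinearMap.toContinuousLinearMap (Matrix.toLin' (jac F z))) z := by
  rw [hasStrictFDerivAt_pi']
  intro i
  refine (hasStrictFDerivAt_eval (F i) z).congr_fderiv ?_
  ext v
  simp [Matrix.mulVec, dotProduct, jac, -Matrix.toLin'_apply, Matrix.toLin'_apply]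

lemma contDiff_eval {n : ℕ} (p : MvPolynomial (Fin n) ℝ) :
    ContDiff ℝ 1 (fun x : Fin n → ℝ => eval x p) := by
  have := (AnalyticOnNhd.eval_mvPolynomial (𝕜 := ℝ) p).contDiffOn (n := 1) uniqueDiffOn_univ
  rwa [contDiffOn_univ] at this

lemma bounded_zeros {n m : ℕ} (hm : 0 < m) (p : ℕ → Fin n → MvPolynomial (Fin n) ℝ)
    (hp : ∀ k ≤ m, ∀ i, (p k i).IsHomogeneous k)
    (htop : ∀ z : Fin n → ℝ, z ≠ 0 → (fun i => eval z (p m i)) ≠ 0) (y : Fin n → ℝ) :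
    ∃ R : ℝ, ∀ᶠ t in 𝓝 (0:ℝ), ∀ x : Fin n → ℝ,
      (fun i => ∑ k ∈ Finset.range (m + 1), eval x (p k i) - y i + t * x i ^ m) = 0 →
      ‖x‖ ≤ R := by
  let K : ℝ × ℝ → (Fin n → ℝ) → (Fin n → ℝ) := fun w u i =>
    ∑ k ∈ Finset.range (m + 1), w.2 ^ (m - k) * eval u (p k i) - w.2 ^ m * y i + w.1 * u i ^ m
  have hKc : Continuous (fun v : (ℝ × ℝ) × (Fin n → ℝ) => K v.1 v.2) := by
    refine continuous_pi fun i => ?_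
    have : ∀ k, Continuous fun v : (ℝ × ℝ) × (Fin n → ℝ) => eval v.2 (p k i) := fun k =>
      (MvPolynomial.continuous_eval (p k i)).comp continuous_snd
    fun_prop
  have hK0 : ∀ u, K (0, 0) u = fun i => eval u (p m i) := by
    intro u
    funext i
    simp only [K]
    rw [Finset.sum_range_succ, Finset.sum_eq_zero]
    · simp [hm.ne']
    · intro k hk
      have : m - k ≠ 0 := by have := Finset.mem_range.1 hk; omega
      simp [this]
  have hev : ∀ᶠ w in 𝓝 ((0:ℝ), (0:ℝ)), ∀ u ∈ Metric.sphere (0 : Fin n → ℝ) 1, K w u ≠ 0 := by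
    refine (isCompact_sphere _ _).eventually_forall_of_forall_eventually ?_
    intro u hu
    refine hKc.continuousAt.eventually_ne ?_
    rw [hK0]
    apply htop
    rintro rfl
    simp at hu
  obtain ⟨δ, hδ, h⟩ := Metric.eventually_nhds_iff.1 hev
  refine ⟨2 / δ, ?_⟩
  filter_upwards [Metric.ball_mem_nhds (0:ℝ) hδ] with t ht x hx
  by_contra! hlt
  have hxpos : 0 < ‖x‖ := lt_trans (by positivity) hlt
  have hs : ‖x‖⁻¹ < δ := by
    rw [inv_lt_comm₀ hxpos hδ]
    refine lt_trans ?_ hlt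
    rw [inv_eq_one_div]
    exact div_lt_div_of_pos_right (by norm_num) hδ
  refine h (y := (t, ‖x‖⁻¹)) ?_ (‖x‖⁻¹ • x) ?_ ?_
  · rw [Prod.dist_eq, max_lt_iff]
    refine ⟨ht, ?_⟩
    rw [Real.dist_eq, sub_zero, abs_of_pos (by positivity)]
    exact hs
  · rw [mem_sphere_zero_iff_norm, norm_smul, norm_inv, norm_norm, inv_mul_cancel₀ hxpos.ne']
  · funext i
    have hxi := congrFun hx i
    simp only [Pi.zero_apply] at hxi
    have : K (t, ‖x‖⁻¹) (‖x‖⁻¹ • x) i = ‖x‖⁻¹ ^ m *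
        (∑ k ∈ Finset.range (m + 1), eval x (p k i) - y i + t * x i ^ m) := by
      simp only [K, mul_add, mul_sub, Finset.mul_sum]
      congr 1
      · congr 1
        refine Finset.sum_congr rfl fun k hk => ?_
        have hk' : k ≤ m := by have := Finset.mem_range.1 hk; omega
        rw [hom_eval_smul (hp k hk' i), ← mul_assoc, ← pow_add, Nat.sub_add_cancel hk']
      · simp only [Pi.smul_apply, smul_eq_mul, mul_pow]
        ring
    rw [this, hxi, mul_zero]
    rfl

lemma main_pos {n m : ℕ} (hn : n ≠ 0) (hm : 0 < m) (heven : Even m)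
    (p : ℕ → Fin n → MvPolynomial (Fin n) ℝ)
    (hp : ∀ k ≤ m, ∀ i, (p k i).IsHomogeneous k)
    (htop : ∀ z : Fin n → ℝ, z ≠ 0 → (fun i => eval z (p m i)) ≠ 0) (y : Fin n → ℝ)
    (q : Fin n → MvPolynomial (Fin n) ℝ)
    (hq : ∀ i, q i = ∑ k ∈ Finset.range (m + 1), p k i - C (y i))
    (hdet : ∀ z, (∀ i, eval z (q i) = 0) → (jac q z).det ≠ 0) :
    {x : Fin n → ℝ | ∀ i, eval x (q i) = 0}.Finite ∧
      Even {x : Fin n → ℝ | ∀ i, eval x (q i) = 0}.ncard := by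
  let Q : ℝ → Fin n → MvPolynomial (Fin n) ℝ := fun t i => q i + C t * X i ^ m
  have hQ0 : Q 0 = q := by funext i; simp [Q]
  let H : ℝ × (Fin n → ℝ) → (Fin n → ℝ) := fun v i => eval v.2 (Q v.1 i)
  have hHe : ∀ v i, H v i = eval v.2 (q i) + v.1 * v.2 i ^ m := by
    intro v i; simp [H, Q]
  have hHc : ContDiff ℝ 1 H := by
    rw [contDiff_pi]
    intro i
    simp only [hHe]
    have := (contDiff_eval (q i)).comp (contDiff_snd (E := ℝ) (F := Fin n → ℝ) (𝕜 := ℝ))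
    have h2 : ContDiff ℝ 1 (fun v : ℝ × (Fin n → ℝ) => v.1 * v.2 i ^ m) := by fun_prop
    exact this.add h2
  have hH' : ∀ v, HasStrictFDerivAt H (fderiv ℝ H v) v := fun v =>
    hHc.contDiffAt.hasStrictFDerivAt one_ne_zero
  obtain ⟨R, hR⟩ := bounded_zeros hm p hp htop y
  let g : ℝ × (Fin n → ℝ) → ℝ := fun v => (jac (Q v.1) v.2).det
  have hg : Continuous g := by
    refine Continuous.matrix_det (continuous_pi fun i => continuous_pi fun j => ?_)
    have h1 : ∀ f : MvPolynomial (Fin n) ℝ, Continuous fun v : ℝ × (Fin n → ℝ) => eval v.2 f :=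
      fun f => (MvPolynomial.continuous_eval f).comp continuous_snd
    have h2 : (fun v : ℝ × (Fin n → ℝ) => jac (Q v.1) v.2 i j) =
        fun v => eval v.2 (pderiv j (q i)) + v.1 * eval v.2 (pderiv j (X i ^ m)) := by
      funext v
      simp only [jac, Q, map_add, pderiv_C_mul, map_mul, eval_C]
    rw [h2]
    exact (h1 _).add (continuous_fst.mul (h1 _))
  have hzero : ∀ t x, H (t, x) = 0 ↔ ∀ i, eval x (Q t i) = 0 := fun t x => _root_.funext_iff
  have hinv : ∀ z, H (0, z) = 0 →
      (fderiv ℝ H (0, z) ∘L .inr ℝ ℝ (Fin n → ℝ)).IsInvertible := by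
    intro z hz
    rw [hzero, hQ0] at hz
    have hd := hdet z hz
    have h1 : HasFDerivAt (fun x => H (0, x)) (fderiv ℝ H (0, z) ∘L .inr ℝ ℝ (Fin n → ℝ)) z :=
      HasFDerivAt.comp z (hH' (0, z)).hasFDerivAt (hasFDerivAt_prodMk_right (0:ℝ) z)
    have h2 := (hasStrictFDerivAt_jac (Q 0) z).hasFDerivAt
    have h3 := h1.unique h2
    rw [h3, hQ0]
    have h4 : (LinearMap.toContinuousLinearMap (Matrix.toLin' (jac q z))).det ≠ 0 := by
      rw [ContinuousLinearMap.det]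
      simpa using hd
    exact ⟨ContinuousLinearMap.toContinuousLinearEquivOfDetNeZero _ h4, by ext; simp⟩
  obtain ⟨hfin, hev⟩ := perturb H (fderiv ℝ H) hH' R (by
      filter_upwards [hR] with t ht x hx
      apply ht x
      rw [← hx]
      funext i
      simp [hHe, hq]) g hg (by
      intro z hz
      rw [hzero, hQ0] at hz
      simp only [g, hQ0]
      exact hdet z hz) hinv
  have hbad := countable_bad (m := m) q
  have hbad' : {t : ℝ | t⁻¹ ∈ {d : ℝ | ∃ N, (cmat m N (fun i => X i ^ m + C d * q i)).det = 0}}.Countable :=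
    hbad.preimage inv_injective
  have hdense := ((hbad'.insert (0:ℝ))).dense_compl ℝ
  obtain ⟨U, hUsub, hUo, hU0⟩ := mem_nhds_iff.1 hev
  obtain ⟨t, htU, htg⟩ := hdense.exists_mem_open hUo ⟨0, hU0⟩ |>.imp fun t h => And.symm h
  obtain ⟨hfin_t, hcard_t, hdet_t⟩ := hUsub htU
  have ht0 : t ≠ 0 := fun h => htg (by simp [h])
  have hgood : ∀ N, (cmat m N (fun i => X i ^ m + C t⁻¹ * q i)).det ≠ 0 := by
    intro N h
    exact htg (Set.mem_insert_of_mem _ ⟨N, h⟩)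
  have hqdeg : ∀ i, (q i).totalDegree ≤ m := by
    intro i
    rw [hq]
    refine (totalDegree_sub _ _).trans (max_le ?_ (by simp))
    refine totalDegree_finsetSum_le fun k hk => ?_
    have hk' : k ≤ m := by have := Finset.mem_range.1 hk; omega
    exact ((hp k hk' i).totalDegree_le).trans hk'
  let F : Fin n → MvPolynomial (Fin n) ℝ := fun i => X i ^ m + C t⁻¹ * q i
  have hFQ : ∀ i, F i = C t⁻¹ * Q t i := by
    intro i
    simp only [F, Q, mul_add, ← mul_assoc, ← C_mul, inv_mul_cancel₀ ht0, C_1, one_mul]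
    ring
  have hFdeg : ∀ i, (F i).totalDegree ≤ m := by
    intro i
    refine (totalDegree_add _ _).trans (max_le ?_ ?_)
    · rw [totalDegree_X_pow]
    · refine (totalDegree_mul _ _).trans ?_
      simpa using hqdeg i
  obtain ⟨hAfin, hAdim⟩ := quot_dim hm F hFdeg hgood
  have hZeq : {x : Fin n → ℝ | ∀ i, eval x (q i) = 0} = {x | H (0, x) = 0} := by
    ext x
    change _ ↔ H (0, x) = 0
    rw [hzero, hQ0]
    rfl
  rw [hZeq]
  refine ⟨hfin, ?_⟩
  rw [← hcard_t, Set.ncard_eq_toFinset_card _ hfin_t]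
  refine even_of_even_finrank F hAfin ?_ _ ?_ ?_
  · rw [hAdim]
    exact heven.pow_of_ne_zero hn
  · intro z
    rw [Set.Finite.mem_toFinset]
    change H (t, z) = 0 ↔ _
    rw [hzero]
    simp [hFQ, ht0]
  · intro z hz
    rw [Set.Finite.mem_toFinset] at hz
    have h1 := hdet_t z hz
    have h2 : jac F z = t⁻¹ • jac (Q t) z := by
      ext i j
      simp [jac, hFQ]
    rw [h2, Matrix.det_smul]
    exact mul_ne_zero (pow_ne_zero _ (inv_ne_zero ht0)) h1

/-- Let `P = P₀ + ⋯ + P_m : ℝⁿ → ℝⁿ` be a polynomial map, each `P k` homogeneous of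
degree `k`, with `P_m ≠ 0` and `P_m(z) ≠ 0` for all `z ≠ 0`, and let `m` be even.
If `y` is such that every solution `z` of `P(z) = y` satisfies `det DP(z) ≠ 0`, then the
solution set of `P(x) = y` is finite of even cardinality. -/
theorem stmt_4 {n m : ℕ} (P : ℕ → (Fin n → ℝ) → (Fin n → ℝ))
    (Pfull : (Fin n → ℝ) → (Fin n → ℝ))
    (hPfull : ∀ x, Pfull x = ∑ k ∈ Finset.range (m + 1), P k x)
    (hP : ∀ k ≤ m, ∀ i : Fin n, ∃ p : MvPolynomial (Fin n) ℝ, p.IsHomogeneous k ∧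
      ∀ x : Fin n → ℝ, P k x i = MvPolynomial.eval x p)
    (hPm : P m ≠ 0)
    (htop : ∀ z : Fin n → ℝ, z ≠ 0 → P m z ≠ 0)
    (heven : Even m)
    (y : Fin n → ℝ)
    (hy : ∀ z : Fin n → ℝ, Pfull z = y →
      LinearMap.det ((fderiv ℝ Pfull z : (Fin n → ℝ) →L[ℝ] (Fin n → ℝ)) :
        (Fin n → ℝ) →ₗ[ℝ] (Fin n → ℝ)) ≠ 0) :
    {x : Fin n → ℝ | Pfull x = y}.Finite ∧ Even {x : Fin n → ℝ | Pfull x = y}.ncard := by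
  have hn : n ≠ 0 := by
    rintro rfl
    exact hPm (Subsingleton.elim _ _)
  choose! p hp hpe using hP
  let q : Fin n → MvPolynomial (Fin n) ℝ := fun i =>
    ∑ k ∈ Finset.range (m + 1), p k i - C (y i)
  have hPq : ∀ x i, Pfull x i = eval x (q i) + y i := by
    intro x i
    rw [hPfull, Finset.sum_apply]
    simp only [q, map_sub, map_sum, eval_C, sub_add_cancel]
    refine Finset.sum_congr rfl fun k hk => ?_
    have hk' : k ≤ m := by have := Finset.mem_range.1 hk; omega
    exact hpe k hk' i x
  have hsol : ∀ x, Pfull x = y ↔ ∀ i, eval x (q i) = 0 := by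
    intro x
    rw [_root_.funext_iff]
    simp [hPq]
  have hfd : ∀ z, fderiv ℝ Pfull z =
      LinearMap.toContinuousLinearMap (Matrix.toLin' (jac q z)) := by
    intro z
    have h1 : Pfull = fun x => (fun i => eval x (q i)) + y := by
      funext x i
      exact hPq x i
    rw [h1]
    exact ((hasStrictFDerivAt_jac q z).hasFDerivAt.add_const y).fderiv
  have hdet : ∀ z, (∀ i, eval z (q i) = 0) → (jac q z).det ≠ 0 := by
    intro z hz
    have := hy z ((hsol z).2 hz)
    rw [hfd] at this
    simpa using this
  simp only [hsol]
  rcases Nat.eq_zero_or_pos m with rfl | hm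
  · have hempty : {x : Fin n → ℝ | ∀ i, eval x (q i) = 0} = ∅ := by
      rw [Set.eq_empty_iff_forall_notMem]
      intro z hz
      apply hdet z hz
      have : NeZero n := ⟨hn⟩
      have h0 : jac q z = 0 := by
        ext i j
        have h1 : p 0 i = C (coeff 0 (p 0 i)) :=
          totalDegree_eq_zero_iff_eq_C.1 (Nat.le_zero.1 (hp 0 le_rfl i).totalDegree_le)
        simp only [jac, q, zero_add, Finset.sum_range_one]
        rw [h1]
        simp
      rw [h0, Matrix.det_zero]
    rw [hempty]
    simp
  · refine main_pos hn hm heven p hp ?_ y q (fun i => rfl) hdet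
    intro z hz h
    apply htop z hz
    rw [← h]
    funext i
    exact hpe m le_rfl i z
end

section
/- Let Q : ℝ^n → ℝ^n be a homogeneous polynomial map of even degree m. Then there exists v ≠ 0 with Q(v) = 0, or there exists c ≠ 0 with Q(c) = c. -/
open MvPolynomial

theorem real_odd_root (p : Polynomial ℝ) (hp : p.Monic) (h : Odd p.natDegree) :
    ∃ r, p.IsRoot r := by
  have hd : 0 < p.natDegree := h.pos
  have h1 : Filter.Tendsto (fun x => p.eval x) Filter.atTop Filter.atTop :=
    Polynomial.tendsto_atTop_of_leadingCoeff_nonneg p (Polynomial.natDegree_pos_iff_degree_pos.1 hd)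
      (by rw [hp.leadingCoeff]; norm_num)
  have hqd : (-(p.comp (-Polynomial.X))).natDegree = p.natDegree := by
    simp [Polynomial.natDegree_comp]
  have h2 : Filter.Tendsto (fun x => (-(p.comp (-Polynomial.X))).eval x) Filter.atTop Filter.atTop := by
    apply Polynomial.tendsto_atTop_of_leadingCoeff_nonneg
    · apply Polynomial.natDegree_pos_iff_degree_pos.1
      rw [hqd]; exact hd
    · rw [Polynomial.leadingCoeff_neg, Polynomial.leadingCoeff_comp (by simp)]
      simp [hp.leadingCoeff, h.neg_one_pow]
  obtain ⟨a, ha⟩ := (h1.eventually_ge_atTop 0).exists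
  obtain ⟨b, hb⟩ := (h2.eventually_ge_atTop 0).exists
  simp at hb
  have := mem_range_of_exists_le_of_exists_ge p.continuous ⟨-b, hb⟩ ⟨a, ha⟩
  obtain ⟨r, hr⟩ := this
  exact ⟨r, hr⟩

noncomputable def defF {n : ℕ} {R : Type*} [CommRing R] (m : ℕ)
    (p : Fin n → MvPolynomial (Fin n) R) (s : R) (i : Fin n) : MvPolynomial (Fin n) R :=
  X i ^ m + C s * p i

noncomputable def defB {n : ℕ} {R : Type*} [CommRing R] (m : ℕ)
    (p : Fin n → MvPolynomial (Fin n) R) (s : R) (γ : Fin n →₀ ℕ) : MvPolynomial (Fin n) R :=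
  ∏ i, (X i ^ (γ i % m) * defF m p s i ^ (γ i / m))

theorem defB_map {n : ℕ} {R S : Type*} [CommRing R] [CommRing S] (m : ℕ)
    (p : Fin n → MvPolynomial (Fin n) R) (s : R) (f : R →+* S) (γ : Fin n →₀ ℕ) :
    MvPolynomial.map f (defB m p s γ) = defB m (fun i => MvPolynomial.map f (p i)) (f s) γ := by
  simp [defB, defF, map_prod]

theorem defB_zero {n : ℕ} {R : Type*} [CommRing R] (m : ℕ)
    (p : Fin n → MvPolynomial (Fin n) R) (γ : Fin n →₀ ℕ) :
    defB m p 0 γ = monomial γ 1 := by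
  rw [MvPolynomial.monomial_eq]
  simp only [defB, defF, map_zero, zero_mul, add_zero, ← pow_mul, ← pow_add, Nat.mod_add_div]
  rw [Finsupp.prod_fintype _ _ (by simp)]
  simp

theorem defF_totalDegree {n : ℕ} {R : Type*} [CommRing R] [Nontrivial R] (m : ℕ)
    (p : Fin n → MvPolynomial (Fin n) R) (hp : ∀ i, (p i).totalDegree ≤ m) (s : R) (i : Fin n) :
    (defF m p s i).totalDegree ≤ m := by
  refine (totalDegree_add _ _).trans (max_le ?_ ?_)
  · simp
  · refine (totalDegree_mul _ _).trans ?_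
    simpa using hp i

theorem defB_totalDegree {n : ℕ} {R : Type*} [CommRing R] [Nontrivial R] (m : ℕ)
    (p : Fin n → MvPolynomial (Fin n) R) (hp : ∀ i, (p i).totalDegree ≤ m) (s : R)
    (γ : Fin n →₀ ℕ) : (defB m p s γ).totalDegree ≤ γ.degree := by
  rw [Finsupp.degree_eq_sum]
  refine (totalDegree_finsetProd _ _).trans (Finset.sum_le_sum fun i _ => ?_)
  refine (totalDegree_mul _ _).trans ?_
  have h1 : (X i ^ (γ i % m) : MvPolynomial (Fin n) R).totalDegree ≤ γ i % m := by simp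
  have h2 : (defF m p s i ^ (γ i / m)).totalDegree ≤ (γ i / m) * m :=
    (totalDegree_pow _ _).trans (Nat.mul_le_mul_left _ (defF_totalDegree m p hp s i))
  calc _ ≤ γ i % m + (γ i / m) * m := add_le_add h1 h2
    _ = γ i := Nat.mod_add_div' _ _

theorem defB_add {n : ℕ} {R : Type*} [CommRing R] (m : ℕ) (hm : 0 < m)
    (p : Fin n → MvPolynomial (Fin n) R) (s : R) (γ : Fin n →₀ ℕ) (i : Fin n) :
    defB m p s (γ + Finsupp.single i m) = defB m p s γ * defF m p s i := by
  classical
  unfold defB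
  rw [← Finset.mul_prod_erase _ _ (Finset.mem_univ i), ← Finset.mul_prod_erase (a := i) _ (fun i => (X i ^ (γ i % m) * defF m p s i ^ (γ i / m))) (Finset.mem_univ i)]
  have : ∏ x ∈ Finset.univ.erase i, (X x ^ ((γ + Finsupp.single i m) x % m) * defF m p s x ^ ((γ + Finsupp.single i m) x / m))
     = ∏ x ∈ Finset.univ.erase i, (X x ^ (γ x % m) * defF m p s x ^ (γ x / m)) := by
    refine Finset.prod_congr rfl fun x hx => ?_
    have hx : x ≠ i := Finset.ne_of_mem_erase hx
    simp [hx.symm]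
  rw [this]
  simp [Nat.add_div_right _ hm, pow_succ]
  ring

/-- For `s` outside a countable set, the family is a basis. -/
theorem exists_countable_basis {n : ℕ} (m : ℕ) (p : Fin n → MvPolynomial (Fin n) ℝ)
    (hp : ∀ i, (p i).totalDegree ≤ m) :
    ∃ S : Set ℝ, S.Countable ∧ ∀ s ∉ S,
      LinearIndependent ℝ (defB m p s) ∧ ⊤ ≤ Submodule.span ℝ (Set.range (defB m p s)) := by
  classical
  let pp : Fin n → MvPolynomial (Fin n) (Polynomial ℝ) := fun i => MvPolynomial.map Polynomial.C (p i)
  let ι : ℕ → Type := fun d => {γ : Fin n →₀ ℕ // γ.degree ≤ d}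
  let _ : ∀ d, Fintype (ι d) := fun d => (Finsupp.finite_of_degree_le (σ := Fin n) d).fintype
  let M : (d : ℕ) → Matrix (ι d) (ι d) (Polynomial ℝ) := fun d =>
    Matrix.of fun γ δ => coeff δ.1 (defB m pp Polynomial.X γ.1)
  let N : (d : ℕ) → ℝ → Matrix (ι d) (ι d) ℝ := fun d s =>
    Matrix.of fun γ δ => coeff δ.1 (defB m p s γ.1)
  have hMN : ∀ d s, (M d).map (Polynomial.evalRingHom s) = N d s := by
    intro d s
    ext γ δ
    have := defB_map m pp Polynomial.X (Polynomial.evalRingHom s) γ.1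
    have h2 : (fun i => MvPolynomial.map (Polynomial.evalRingHom s) (pp i)) = p := by
      funext i
      simp only [pp, MvPolynomial.map_map]
      convert MvPolynomial.map_id (p i)
      ext; simp
    rw [h2] at this
    simp only [Polynomial.coe_evalRingHom, Polynomial.eval_X] at this
    simp only [M, N, Matrix.map_apply, Matrix.of_apply, ← this, MvPolynomial.coeff_map]
  have hdet : ∀ d s, (N d s).det = (M d).det.eval s := by
    intro d s
    rw [← hMN, ← Polynomial.coe_evalRingHom, RingHom.map_det]; rfl
  have hne : ∀ d, (M d).det ≠ 0 := by
    intro d h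
    have h0 := hdet d 0
    have : N d 0 = 1 := by
      ext γ δ
      simp only [N, Matrix.of_apply, defB_zero, coeff_monomial, Matrix.one_apply]
      exact if_congr Subtype.ext_iff.symm rfl rfl
    rw [this, h] at h0
    simp at h0
  refine ⟨⋃ d, {s | (M d).det.IsRoot s}, Set.countable_iUnion fun d =>
    (Polynomial.finite_setOfPred_isRoot (hne d)).countable, fun s hs => ?_⟩
  have hs' : ∀ d, (N d s).det ≠ 0 := by
    intro d h
    exact hs (Set.mem_iUnion.2 ⟨d, by rw [hdet] at h; exact h⟩)
  constructor
  · rw [linearIndependent_iff']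
    intro t g hg
    let d := t.sup Finsupp.degree
    let v : ι d → ℝ := fun γ => if γ.1 ∈ t then g γ.1 else 0
    have hv : Matrix.vecMul v (N d s) = 0 := by
      ext δ
      have := congrArg (coeff δ.1) hg
      simp only [coeff_sum, coeff_smul, coeff_zero, smul_eq_mul] at this
      simp only [Matrix.vecMul, dotProduct, Pi.zero_apply, N, Matrix.of_apply]
      rw [← this]
      symm
      refine Finset.sum_bij_ne_zero (fun γ hγ _ => (⟨γ, Finset.le_sup hγ⟩ : ι d)) ?_ ?_ ?_ ?_
      · simp
      · intro a _ _ b _ _ h; exact congrArg Subtype.val h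
      · intro b _ hb
        have hbt : b.1 ∈ t := by
          by_contra h; simp [v, h] at hb
        exact ⟨b.1, hbt, by simpa [v, hbt] using hb, rfl⟩
      · intro a ha _; simp [v, ha]
    have h0 := Matrix.eq_zero_of_vecMul_eq_zero (hs' d) hv
    intro γ hγ
    have := congrFun h0 ⟨γ, Finset.le_sup hγ⟩
    simpa [v, hγ] using this
  · have hmon : ∀ δ : Fin n →₀ ℕ, monomial δ (1:ℝ) ∈ Submodule.span ℝ (Set.range (defB m p s)) := by
      intro δ
      let d := δ.degree
      let e : ι d → ℝ := Pi.single ⟨δ, le_rfl⟩ 1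
      let v := Matrix.vecMul e (N d s)⁻¹
      have hv : Matrix.vecMul v (N d s) = e := by
        simp only [v, Matrix.vecMul_vecMul]
        rw [Matrix.nonsing_inv_mul _ (isUnit_iff_ne_zero.2 (hs' d)), Matrix.vecMul_one]
      have : monomial δ (1:ℝ) = ∑ γ : ι d, v γ • defB m p s γ.1 := by
        ext η
        simp only [coeff_sum, coeff_smul, smul_eq_mul]
        by_cases hη : η.degree ≤ d
        · have := congrFun hv ⟨η, hη⟩
          simp only [Matrix.vecMul, dotProduct, N, Matrix.of_apply] at this
          rw [this]
          simp only [e, Pi.single_apply, coeff_monomial]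
          exact if_congr ⟨fun h => Subtype.ext h.symm, fun h => (congrArg Subtype.val h).symm⟩ rfl rfl
        · rw [Finset.sum_eq_zero, coeff_monomial, if_neg]
          · rintro rfl; exact hη le_rfl
          · intro γ _
            rw [coeff_eq_zero_of_totalDegree_lt, mul_zero]
            have h1 := defB_totalDegree m p hp s γ.1
            have h2 := γ.2
            have h3 : η.degree = ∑ i ∈ η.support, η i := rfl
            omega
      rw [this]
      exact Submodule.sum_mem _ fun γ _ => Submodule.smul_mem _ _ (Submodule.subset_span ⟨γ.1, rfl⟩)
    intro f _
    rw [f.as_sum]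
    refine Submodule.sum_mem _ fun δ _ => ?_
    rw [← mul_one (coeff δ f), ← smul_eq_mul, ← smul_monomial]
    exact Submodule.smul_mem _ _ (hmon δ)


theorem exists_common_eigen (A : Type*) [CommRing A] [Algebra ℝ A] :
    ∀ (d : ℕ) (M : Type*) [AddCommGroup M] [Module ℝ M] [Module A M] [IsScalarTower ℝ A M],
      Module.finrank ℝ M = d → Odd d →
      ∃ v : M, v ≠ 0 ∧ ∀ a : A, ∃ r : ℝ, a • v = r • v := by
  intro d
  induction d using Nat.strong_induction_on with
  | _ d ih =>
  intro M _ _ _ _ hd hodd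
  have hpos : 0 < Module.finrank ℝ M := hd ▸ hodd.pos
  have : Module.Finite ℝ M := Module.finite_of_finrank_pos hpos
  have : Nontrivial M := Module.nontrivial_of_finrank_pos hpos
  by_cases hs : ∀ a : A, ∃ r : ℝ, ∀ v : M, a • v = r • v
  · obtain ⟨v, hv⟩ := exists_ne (0 : M)
    exact ⟨v, hv, fun a => (hs a).imp fun r h => h v⟩
  push Not at hs
  obtain ⟨a, ha⟩ := hs
  let T : Module.End ℝ M := (LinearMap.lsmul A M a).restrictScalars ℝ
  have : ∃ r : ℝ, T.charpoly.IsRoot r := by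
    exact real_odd_root _ T.charpoly_monic (by rw [LinearMap.charpoly_natDegree, hd]; exact hodd)
  obtain ⟨r, hr⟩ := this
  rw [← Module.End.hasEigenvalue_iff_isRoot_charpoly] at hr
  obtain ⟨w, hw⟩ := hr.exists_hasEigenvector
  have hw1 : a • w = r • w := hw.apply_eq_smul
  let g : M →ₗ[A] M := LinearMap.lsmul A M (a - algebraMap ℝ A r)
  have hg : ∀ v, g v = a • v - r • v := fun v => by simp [g]
  have hsum := LinearMap.finrank_range_add_finrank_ker (g.restrictScalars ℝ)
  have e1 : Module.finrank ℝ (LinearMap.range (g.restrictScalars ℝ)) = Module.finrank ℝ (LinearMap.range g) := rfl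
  have e2 : Module.finrank ℝ (LinearMap.ker (g.restrictScalars ℝ)) = Module.finrank ℝ (LinearMap.ker g) := rfl
  have hk : 0 < Module.finrank ℝ (LinearMap.ker (g.restrictScalars ℝ)) := by
    rw [Module.finrank_pos_iff_exists_ne_zero]
    refine ⟨⟨w, ?_⟩, ?_⟩
    · simp [hg, hw1]
    · intro h; exact hw.2 (congrArg Subtype.val h)
  have hrg : 0 < Module.finrank ℝ (LinearMap.range (g.restrictScalars ℝ)) := by
    rw [Module.finrank_pos_iff_exists_ne_zero]
    obtain ⟨v, hv⟩ := ha r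
    refine ⟨⟨g v, v, rfl⟩, ?_⟩
    intro h
    have := congrArg Subtype.val h
    simp only [hg, ZeroMemClass.coe_zero, sub_eq_zero] at this
    exact hv this
  have key : ∀ N : Submodule A M, Module.finrank ℝ N < d → Odd (Module.finrank ℝ N) →
      ∃ v : M, v ≠ 0 ∧ ∀ a : A, ∃ r : ℝ, a • v = r • v := by
    intro N h1 h2
    obtain ⟨v, hv, h⟩ := ih _ h1 N rfl h2
    refine ⟨v, by simpa using hv, fun a => (h a).imp fun r hr => ?_⟩
    exact congrArg Subtype.val hr
  rw [e1] at hrg hsum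
  rw [e2] at hk hsum
  rcases Nat.even_or_odd (Module.finrank ℝ (LinearMap.range g)) with h | h
  · refine key (LinearMap.ker g) (by omega) ?_
    rw [← hd, ← hsum] at hodd
    grind
  · exact key (LinearMap.range g) (by omega) h


theorem finrank_quot {n : ℕ} (m : ℕ) (hm : 0 < m) (p : Fin n → MvPolynomial (Fin n) ℝ) (s : ℝ)
    (hli : LinearIndependent ℝ (defB m p s))
    (hsp : ⊤ ≤ Submodule.span ℝ (Set.range (defB m p s))) :
    Module.finrank ℝ (MvPolynomial (Fin n) ℝ ⧸ Ideal.span (Set.range (defF m p s))) = m ^ n := by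
  classical
  set I := Ideal.span (Set.range (defF m p s)) with hI
  let B := Module.Basis.mk hli hsp
  have hB : ∀ γ, B γ = defB m p s γ := fun γ => by simp [B]
  let red : Set (Fin n →₀ ℕ) := {γ | ∀ i, γ i < m}
  let φ : MvPolynomial (Fin n) ℝ →ₗ[ℝ] (red →₀ ℝ) :=
    (Finsupp.lsubtypeDomain red).comp B.repr.toLinearMap
  have hφ : ∀ f (γ : red), φ f γ = B.repr f γ.1 := fun f γ => rfl
  have hsurj : Function.Surjective φ := by
    intro g
    refine ⟨B.repr.symm (g.embDomain (Function.Embedding.subtype _)), ?_⟩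
    ext γ
    rw [hφ]
    simp only [LinearEquiv.apply_symm_apply]
    exact Finsupp.embDomain_apply_self (Function.Embedding.subtype _) g γ
  have hker : LinearMap.ker φ = I.restrictScalars ℝ := by
    apply le_antisymm
    · intro f hf
      rw [Submodule.restrictScalars_mem, ← B.linearCombination_repr f, Finsupp.linearCombination_apply]
      refine Submodule.sum_mem _ fun γ _ => ?_
      by_cases hγ : γ ∈ red
      · have := DFunLike.congr_fun (LinearMap.mem_ker.1 hf) ⟨γ, hγ⟩
        rw [hφ] at this
        simp only [Finsupp.coe_zero, Pi.zero_apply] at this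
        simp [this]
      · simp only [red, Set.mem_ofPred_eq, not_forall, not_lt] at hγ
        obtain ⟨i, hi⟩ := hγ
        have : γ = (γ - Finsupp.single i m) + Finsupp.single i m := by
          rw [tsub_add_cancel_of_le]
          simpa using hi
        change (B.repr f) γ • B γ ∈ I
        have hb : B γ = defB m p s (γ - Finsupp.single i m) * defF m p s i := by
          rw [hB, ← defB_add m hm, ← this]
        rw [hb, ← smul_mul_assoc]
        exact Ideal.mul_mem_left _ _ (Ideal.subset_span ⟨i, rfl⟩)
    · intro f hf
      rw [Submodule.restrictScalars_mem, hI, Ideal.mem_span_range_iff_exists_fun] at hf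
      obtain ⟨c, rfl⟩ := hf
      refine Submodule.sum_mem _ fun i _ => ?_
      have : φ.comp (LinearMap.mulRight ℝ (defF m p s i)) = 0 := by
        apply B.ext
        intro γ
        simp only [LinearMap.comp_apply, LinearMap.mulRight_apply, hB, LinearMap.zero_apply]
        rw [← defB_add m hm, ← hB]
        ext δ
        rw [hφ, B.repr_self, Finsupp.single_apply, if_neg]
        · rfl
        · intro h
          have := δ.2 i
          rw [← h] at this
          simp at this
      exact LinearMap.congr_fun this (c i)
  let e1 := Submodule.Quotient.restrictScalarsEquiv ℝ I
  let e2 := Submodule.quotEquivOfEq _ _ hker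
  let e3 := φ.quotKerEquivOfSurjective hsurj
  rw [← e1.finrank_eq, ← e2.finrank_eq, e3.finrank_eq]
  let er : red ≃ (Fin n → Fin m) :=
    { toFun := fun γ i => ⟨γ.1 i, γ.2 i⟩
      invFun := fun g => ⟨Finsupp.equivFunOnFinite.symm fun i => (g i : ℕ), fun i => by simp⟩
      left_inv := fun γ => by ext; simp
      right_inv := fun g => by ext; simp }
  let _ : Fintype red := Fintype.ofEquiv _ er.symm
  rw [Module.finrank_finsupp_self, Fintype.card_congr er]
  simp

theorem exists_zero_of_generic {n m : ℕ} (hn : 0 < n) (hm : Even m) (hm0 : 0 < m)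
    (q : Fin n → MvPolynomial (Fin n) ℝ) (hq : ∀ i, (q i).IsHomogeneous m) (s : ℝ) (hs : s ≠ 0)
    (hli : LinearIndependent ℝ (defB m (fun i => q i - X i) s))
    (hsp : ⊤ ≤ Submodule.span ℝ (Set.range (defB m (fun i => q i - X i) s))) :
    ∃ a : Fin n → ℝ, a ≠ 0 ∧ ∀ i, eval a (defF m (fun i => q i - X i) s i) = 0 := by
  classical
  have hm2 : 2 ≤ m := by obtain ⟨k, rfl⟩ := hm; omega
  have hfr := finrank_quot m hm0 _ s hli hsp
  set F := defF m (fun i => q i - X i) s with hF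
  set I := Ideal.span (Set.range F) with hI
  let J := idealOfVars (Fin n) ℝ
  have hJ2 : ∀ f : MvPolynomial (Fin n) ℝ, f.IsHomogeneous m → f ∈ J ^ 2 := by
    intro f hf
    rw [mem_pow_idealOfVars_iff']
    intro x hx
    exact hf.coeff_eq_zero (by omega)
  have hJ1 : ∀ f : MvPolynomial (Fin n) ℝ, eval 0 f = 0 ↔ f ∈ J := by
    intro f
    have h1 : f ∈ J ↔ f ∈ J ^ 1 := by rw [pow_one]
    rw [h1, mem_pow_idealOfVars_iff', eval_zero, constantCoeff_eq]
    constructor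
    · intro h x hx
      have : x = 0 := (Finsupp.degree_eq_zero_iff x).1 (by simpa using hx)
      rw [this, h]
    · intro h; exact h 0 (by simp)
  have hXJ : ∀ i, (X i : MvPolynomial (Fin n) ℝ) ∈ J := fun i => (hJ1 _).1 (by simp)
  have hFJ : ∀ i, F i ∈ J := by
    intro i
    have h1 : q i ∈ J := Ideal.pow_le_self two_ne_zero (hJ2 _ (hq i))
    simp only [hF, defF]
    exact J.add_mem (J.pow_mem_of_mem (hXJ i) m hm0) (J.mul_mem_left _ (J.sub_mem h1 (hXJ i)))
  have hIJ : I ≤ J := Ideal.span_le.2 (by rintro _ ⟨i, rfl⟩; exact hFJ i)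
  let ev : (MvPolynomial (Fin n) ℝ ⧸ I) →ₐ[ℝ] ℝ :=
    Ideal.Quotient.liftₐ I (aeval (0 : Fin n → ℝ)) (fun f hf => by
      rw [← coe_aeval_eq_eval] at hJ1; exact (hJ1 f).2 (hIJ hf))
  have hev : ∀ f, ev (Ideal.Quotient.mk I f) = eval 0 f := by
    intro f
    rw [← coe_aeval_eq_eval]; rfl
  let N : Ideal (MvPolynomial (Fin n) ℝ ⧸ I) := RingHom.ker ev
  have hN : N = J.map (Ideal.Quotient.mk I) := by
    ext y
    obtain ⟨f, rfl⟩ := Ideal.Quotient.mk_surjective y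
    rw [RingHom.mem_ker, hev, hJ1]
    constructor
    · exact fun h => Ideal.mem_map_of_mem _ h
    · intro h
      have := Ideal.mem_comap.2 h
      rw [Ideal.comap_map_of_surjective _ Ideal.Quotient.mk_surjective] at this
      rw [← RingHom.ker_eq_comap_bot, Ideal.mk_ker, sup_eq_left.2 hIJ] at this
      exact this
  have hpos : 0 < Module.finrank ℝ (MvPolynomial (Fin n) ℝ ⧸ I) := by
    rw [hfr]; positivity
  have : Module.Finite ℝ (MvPolynomial (Fin n) ℝ ⧸ I) := Module.finite_of_finrank_pos hpos
  have hNodd : Odd (Module.finrank ℝ N) := by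
    have h := LinearMap.finrank_range_add_finrank_ker ev.toLinearMap
    have h1 : LinearMap.range ev.toLinearMap = ⊤ := by
      rw [LinearMap.range_eq_top]
      intro r
      exact ⟨algebraMap ℝ _ r, by simp⟩
    have h2 : Module.finrank ℝ (LinearMap.ker ev.toLinearMap) = Module.finrank ℝ N := rfl
    rw [h1, h2, hfr, finrank_top, Module.finrank_self] at h
    have h3 : Even (m ^ n) := hm.pow_of_ne_zero hn.ne'
    rw [← h] at h3
    grind
  obtain ⟨⟨v, hvN⟩, hv0, hv⟩ := exists_common_eigen (MvPolynomial (Fin n) ℝ ⧸ I) _ N rfl hNodd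
  replace hv0 : v ≠ 0 := fun h => hv0 (Subtype.ext h)
  replace hv : ∀ a, ∃ r : ℝ, a * v = r • v := fun a => (hv a).imp fun r h => congrArg Subtype.val h
  choose a ha using fun i => hv (Ideal.Quotient.mk I (X i))
  have heval : ∀ f, Ideal.Quotient.mk I f * v = eval a f • v := by
    intro f
    induction f using MvPolynomial.induction_on with
    | C r =>
      rw [eval_C]
      obtain ⟨f, rfl⟩ := Ideal.Quotient.mk_surjective v
      rw [← map_mul, C_mul']
      rfl
    | add f g hf hg => rw [map_add, map_add, add_mul, hf, hg, add_smul]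
    | mul_X f i hf =>
      rw [map_mul, map_mul, mul_assoc, ha, mul_smul_comm, hf, smul_smul, eval_X, mul_comm]
  refine ⟨a, ?_, ?_⟩
  · rintro rfl
    have hNv : ∀ y ∈ N, y * v = 0 := by
      intro y hy
      obtain ⟨f, rfl⟩ := Ideal.Quotient.mk_surjective y
      rw [heval, ← hev, RingHom.mem_ker.1 hy, zero_smul]
    have hle : N ≤ N • N := by
      rw [smul_eq_mul, hN, ← Ideal.map_mul, ← pow_two]
      refine Ideal.map_le_iff_le_comap.2 ?_
      refine Ideal.span_le.2 ?_
      rintro _ ⟨i, rfl⟩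
      have e : (X i : MvPolynomial (Fin n) ℝ) = C s⁻¹ * (X i ^ m + C s * q i) - C s⁻¹ * F i := by
        have hc : (C s⁻¹ * C s : MvPolynomial (Fin n) ℝ) = 1 := by
          rw [← C_mul, inv_mul_cancel₀ hs, C_1]
        simp only [hF, defF]
        linear_combination (-X i) * hc
      have hz : Ideal.Quotient.mk I (F i) = 0 :=
        Ideal.Quotient.eq_zero_iff_mem.2 (Ideal.subset_span ⟨i, rfl⟩)
      rw [SetLike.mem_coe, Ideal.mem_comap, e, map_sub, map_mul _ _ (F i), hz, mul_zero, sub_zero]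
      apply Ideal.mem_map_of_mem
      refine Ideal.mul_mem_left _ _ (Ideal.add_mem _ (hJ2 _ ?_) (Ideal.mul_mem_left _ _ (hJ2 _ (hq i))))
      simpa using (isHomogeneous_X ℝ i).pow m
    obtain ⟨r, hr1, hr⟩ := Submodule.exists_sub_one_mem_and_smul_eq_zero_of_fg_of_le_smul N N
      (IsNoetherian.noetherian N) hle
    have h1 := hr v hvN
    have h2 := hNv _ hr1
    rw [smul_eq_mul] at h1
    rw [sub_mul, h1, one_mul, zero_sub, neg_eq_zero] at h2
    exact hv0 h2
  · intro i
    have hz : Ideal.Quotient.mk I (F i) = 0 :=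
      Ideal.Quotient.eq_zero_iff_mem.2 (Ideal.subset_span ⟨i, rfl⟩)
    have := heval (F i)
    rw [hz, zero_mul] at this
    exact (smul_eq_zero.1 this.symm).resolve_right hv0

theorem hom_eval_smul_s5 {n m : ℕ} (q : MvPolynomial (Fin n) ℝ) (hq : q.IsHomogeneous m) (t : ℝ)
    (x : Fin n → ℝ) : eval (t • x) q = t ^ m * eval x q := by
  rw [eval_eq, eval_eq, Finset.mul_sum]
  refine Finset.sum_congr rfl fun d hd => ?_
  have : ∑ i ∈ d.support, d i = m := by
    by_contra h
    exact (mem_support_iff.1 hd) (hq.coeff_eq_zero h)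
  simp only [Pi.smul_apply, smul_eq_mul, mul_pow, Finset.prod_mul_distrib,
    Finset.prod_pow_eq_pow_sum, this]
  ring

/-- A homogeneous polynomial map `Q : ℝⁿ → ℝⁿ` of even degree admits a nilpotent
(`v ≠ 0` with `Q v = 0`) or an idempotent (`c ≠ 0` with `Q c = c`). -/
theorem stmt_5 {n m : ℕ} (hn : 0 < n) (hm : Even m)
    (Q : (Fin n → ℝ) → (Fin n → ℝ))
    (hQ : ∀ i : Fin n, ∃ p : MvPolynomial (Fin n) ℝ, p.IsHomogeneous m ∧
      ∀ x : Fin n → ℝ, Q x i = MvPolynomial.eval x p) :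
    (∃ v : Fin n → ℝ, v ≠ 0 ∧ Q v = 0) ∨ (∃ c : Fin n → ℝ, c ≠ 0 ∧ Q c = c) := by
  choose q hq hQq using hQ
  have hsm : ∀ (t : ℝ) x, Q (t • x) = t ^ m • Q x := by
    intro t x
    ext i
    rw [hQq, hom_eval_smul_s5 _ (hq i), ← hQq]; rfl
  have hcont : Continuous Q := by
    refine continuous_pi fun i => ?_
    have : (fun x => Q x i) = fun x => eval x (q i) := funext (hQq i)
    rw [this]
    exact MvPolynomial.continuous_eval _
  rcases Nat.eq_zero_or_pos m with rfl | hm0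
  · have hc : ∀ x, Q x = Q 0 := by
      intro x
      have := hsm 0 x
      simpa using this.symm
    by_cases h : Q 0 = 0
    · left
      refine ⟨fun _ => 1, ?_, by rw [hc, h]⟩
      intro h; have := congrFun h ⟨0, hn⟩; simp at this
    · right; exact ⟨Q 0, h, hc _⟩
  have hdeg : ∀ i, (q i - X i).totalDegree ≤ m := by
    intro i
    refine (totalDegree_sub _ _).trans (max_le (hq i).totalDegree_le ?_)
    rw [totalDegree_X]; exact hm0
  obtain ⟨S, hS, hgood⟩ := exists_countable_basis m (fun i => q i - X i) hdeg
  have hseq : ∀ k : ℕ, ∃ u : Fin n → ℝ, ∃ ε : ℝ, ‖u‖ = 1 ∧ 0 < ε ∧ ε < 1 / ((k : ℝ) + 1) ∧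
      ∃ l : ℝ, 0 < l ∧ Q u + ε • (fun i => u i ^ m) = l • u := by
    intro k
    obtain ⟨s, hsS, hsk⟩ := (hS.dense_compl ℝ).exists_gt ((k : ℝ) + 1)
    have hk : (0 : ℝ) < (k : ℝ) + 1 := by positivity
    have hs0 : 0 < s := hk.trans hsk
    obtain ⟨h1, h2⟩ := hgood s hsS
    obtain ⟨a, ha, haz⟩ := exists_zero_of_generic hn hm hm0 q hq s hs0.ne' h1 h2
    have hna : 0 < ‖a‖ := norm_pos_iff.2 ha
    refine ⟨‖a‖⁻¹ • a, s⁻¹, ?_, inv_pos.2 hs0, ?_, ‖a‖⁻¹ ^ m * ‖a‖, by positivity, ?_⟩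
    · rw [norm_smul, norm_inv, norm_norm, inv_mul_cancel₀ hna.ne']
    · rw [one_div]; exact inv_strictAnti₀ hk hsk
    · rw [hsm]
      ext i
      have := haz i
      simp only [defF, map_add, map_mul, map_pow, eval_X, eval_C, map_sub, ← hQq] at this
      simp only [Pi.add_apply, Pi.smul_apply, smul_eq_mul, mul_pow]
      field_simp
      linear_combination this
  choose u ε hu hε hεk l hl heq using hseq
  have hε0 : Filter.Tendsto ε Filter.atTop (nhds 0) :=
    squeeze_zero (fun k => (hε k).le) (fun k => (hεk k).le) tendsto_one_div_add_atTop_nhds_zero_nat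
  obtain ⟨w, hw, φ, hφ, hlim⟩ := (isCompact_sphere (0 : Fin n → ℝ) 1).tendsto_subseq
    (x := u) (fun k => by simp [hu k])
  have hw1 : ‖w‖ = 1 := by simpa using hw
  have hw0 : w ≠ 0 := by rintro rfl; simp at hw1
  have hl' : ∀ k, l k = ‖Q (u k) + ε k • (fun i => u k i ^ m)‖ := by
    intro k
    rw [heq, norm_smul, hu, mul_one, Real.norm_of_nonneg (hl k).le]
  have hpw : Continuous (fun x : Fin n → ℝ => (fun i => x i ^ m : Fin n → ℝ)) := by fun_prop
  have hL : Filter.Tendsto (fun k => Q (u (φ k)) + ε (φ k) • (fun i => u (φ k) i ^ m : Fin n → ℝ))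
      Filter.atTop (nhds (Q w)) := by
    have h1 := (hcont.tendsto w).comp hlim
    have h2 := (hε0.comp hφ.tendsto_atTop).smul ((hpw.tendsto w).comp hlim)
    have h3 := h1.add h2
    rw [zero_smul, add_zero] at h3
    exact h3
  have hfin : Q w = ‖Q w‖ • w := by
    refine tendsto_nhds_unique hL ?_
    have := hL.norm.smul hlim
    refine this.congr fun k => ?_
    rw [← hl', heq]; rfl
  by_cases h0 : Q w = 0
  · exact Or.inl ⟨w, hw0, h0⟩
  right
  have hpos : 0 < ‖Q w‖ := norm_pos_iff.2 h0
  have hm1 : m - 1 ≠ 0 := by obtain ⟨k, rfl⟩ := hm; omega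
  let t : ℝ := (‖Q w‖⁻¹) ^ (((m - 1 : ℕ) : ℝ)⁻¹)
  have ht : 0 < t := by positivity
  have htm : t ^ (m - 1) = ‖Q w‖⁻¹ := Real.rpow_inv_natCast_pow (by positivity) hm1
  refine ⟨t • w, smul_ne_zero ht.ne' hw0, ?_⟩
  rw [hsm, hfin, smul_smul]
  congr 1
  have : t ^ m = t ^ (m - 1) * t := by rw [← pow_succ]; congr 1; omega
  rw [this, htm]
  field_simp
end
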